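/- In the setting of Proposition 3.1 of the paper (Assumption 1: densities p(θ,x,y) with p(θ₀,·,·) ≡ 1 differentiable at θ₀, ψ-irreducibility, minorization on K, drift condition with λ ∈ (0,1) and function V ≥ 1, V-operator-norm differentiability at θ₀, sup_x g_{ii}(x)/V(x) < ∞, sup_x |f(x)|/√(V(x)) < ∞, invariant probability π for P(θ₀) with ∫V dπ < ∞, α(θ₀) = ∫f dπ, Σ ∈ ℝ^{d×d} with Σ_{ij} = ∫ g_{ij} dπ, initial distribution μ with ∫V dμ < ∞), define under the chain law P_μ the discrete stochastic integral Y_n = (1/n)·∑_{k=1}^{n−1} ∑_{l=k}^{n−1} f(Φ_l)·D_k ∈ ℝ^d. Then the laws of n^{−1/2}·Y_n converge weakly, as n → ∞, to the centered multivariate Gaussian distribution on ℝ^d with covariance matrix (α(θ₀)²/3)·Σ. -/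

import Mathlib

open MeasureTheory ProbabilityTheory Filter
open scoped ENNReal NNReal Topology

noncomputable section

/-- The `k`-step transition kernel `P^k`. -/
def kpow {X : Type*} [MeasurableSpace X] (P : Kernel X X) : ℕ → Kernel X X
  | 0 => Kernel.id
  | k + 1 => P ∘ₖ kpow P k

/-- `Pμ` is the law on path space of the Markov chain with initial distribution `μ`
and one-step transition kernel `P`. -/
def IsMarkovChainLaw {X : Type*} [MeasurableSpace X] (μ : Measure X) (P : Kernel X X)
    (Pμ : Measure (ℕ → X)) : Prop :=
  IsProbabilityMeasure Pμ ∧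
  Pμ.map (fun ω => ω 0) = μ ∧
  ∀ (n : ℕ) (g : (Fin (n + 1) → X) → ℝ≥0∞) (h : X → ℝ≥0∞),
    Measurable g → Measurable h →
    ∫⁻ ω, g (fun i => ω i) * h (ω (n + 1)) ∂Pμ
      = ∫⁻ ω, g (fun i => ω i) * ∫⁻ y, h y ∂(P (ω n)) ∂Pμ

section

/-- geometric drift condition -/
structure DriftC {X : Type*} [MeasurableSpace X] (P : Kernel X X) (K : Set X) (W : X → ℝ)
    (l b : ℝ) : Prop where
  meas : Measurable W
  one_le : ∀ x, 1 ≤ W x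
  hK : MeasurableSet K
  l0 : 0 ≤ l
  l1 : l < 1
  b0 : 0 ≤ b
  drift : ∀ x, ∫⁻ y, ENNReal.ofReal (W y) ∂(P x)
        ≤ ENNReal.ofReal (l * W x + b * K.indicator (fun _ => 1) x)

/-- measurable functions bounded by a multiple of `W` -/
def FW {X : Type*} [MeasurableSpace X] (W : X → ℝ) : Submodule ℝ (X → ℝ) where
  carrier := {h | Measurable h ∧ ∃ C : ℝ, ∀ x, |h x| ≤ C * W x}
  add_mem' := by
    rintro f g ⟨hf, C, hC⟩ ⟨hg, D, hD⟩
    refine ⟨hf.add hg, C + D, fun x => ?_⟩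
    calc |f x + g x| ≤ |f x| + |g x| := abs_add_le _ _
      _ ≤ (C + D) * W x := by rw [add_mul]; exact add_le_add (hC x) (hD x)
  zero_mem' := ⟨measurable_const, 0, by simp⟩
  smul_mem' := by
    rintro c f ⟨hf, C, hC⟩
    refine ⟨hf.const_smul c, |c| * C, fun x => ?_⟩
    simp only [Pi.smul_apply, smul_eq_mul, abs_mul, mul_assoc]
    exact mul_le_mul_of_nonneg_left (hC x) (abs_nonneg c)

namespace DriftC
variable {X : Type*} [MeasurableSpace X] {P : Kernel X X} {K : Set X} {W : X → ℝ} {l b : ℝ}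

lemma Wpos (D : DriftC P K W l b) (x : X) : 0 < W x := lt_of_lt_of_le one_pos (D.one_le x)

lemma integrable_W (D : DriftC P K W l b) (x : X) : Integrable W (P x) := by
  refine ⟨D.meas.aestronglyMeasurable, ?_⟩
  rw [hasFiniteIntegral_iff_ofReal (Eventually.of_forall fun y => (D.Wpos y).le)]
  exact (D.drift x).trans_lt ENNReal.ofReal_lt_top

lemma integral_W_le (D : DriftC P K W l b) (x : X) :
    ∫ y, W y ∂(P x) ≤ l * W x + b * K.indicator (fun _ => 1) x := by
  rw [integral_eq_lintegral_of_nonneg_ae (Eventually.of_forall fun y => (D.Wpos y).le)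
    D.meas.aestronglyMeasurable]
  refine ENNReal.toReal_le_of_le_ofReal ?_ (D.drift x)
  have h1 := D.l0
  have h2 := (D.Wpos x).le
  have h3 := D.b0
  have h4 : (0:ℝ) ≤ K.indicator (fun _ => 1) x := Set.indicator_nonneg (fun _ _ => zero_le_one) x
  positivity

lemma integrable_of_FW {ρ : Measure X} (hW : Integrable W ρ) (h : FW W) :
    Integrable (h : X → ℝ) ρ := by
  obtain ⟨h, hm, C, hC⟩ := h
  refine Integrable.mono' (hW.const_mul C) hm.aestronglyMeasurable (Eventually.of_forall hC)

/-- the transition operator -/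
def T (D : DriftC P K W l b) : FW W →ₗ[ℝ] FW W where
  toFun h := ⟨fun x => ∫ y, (h : X → ℝ) y ∂(P x), by
    obtain ⟨h, hm, C, hC⟩ := h
    refine ⟨(hm.stronglyMeasurable.integral_kernel).measurable, |C| * (l + b), fun x => ?_⟩
    have h1 : ∫ y, |C| * W y ∂(P x) ≤ |C| * ((l + b) * W x) := by
      rw [integral_const_mul]
      refine mul_le_mul_of_nonneg_left ((D.integral_W_le x).trans ?_) (abs_nonneg C)
      have h4 : K.indicator (fun _ => (1:ℝ)) x ≤ 1 := Set.indicator_le_self' (by simp) x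
      rw [add_mul]
      have := mul_le_mul_of_nonneg_left (h4.trans (D.one_le x)) D.b0
      linarith
    rw [mul_assoc]
    refine le_trans ?_ h1
    rw [← Real.norm_eq_abs]
    refine norm_integral_le_of_norm_le ((D.integrable_W x).const_mul _)
      (Eventually.of_forall fun y => ?_)
    exact (hC y).trans (mul_le_mul_of_nonneg_right (le_abs_self C) (D.Wpos y).le)⟩
  map_add' f g := by
    ext x
    exact integral_add (integrable_of_FW (D.integrable_W x) f) (integrable_of_FW (D.integrable_W x) g)
  map_smul' c f := by
    ext x
    exact integral_const_mul _ _

lemma T_apply (D : DriftC P K W l b) (h : FW W) (x : X) :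
    (D.T h : X → ℝ) x = ∫ y, (h : X → ℝ) y ∂(P x) := rfl

lemma T_mono (D : DriftC P K W l b) {f g : FW W} (h : ∀ x, (f : X → ℝ) x ≤ (g : X → ℝ) x) (x : X) :
    (D.T f : X → ℝ) x ≤ (D.T g : X → ℝ) x :=
  integral_mono (integrable_of_FW (D.integrable_W x) f) (integrable_of_FW (D.integrable_W x) g) h

lemma Tk_mono (D : DriftC P K W l b) (k : ℕ) : ∀ {f g : FW W},
    (∀ x, (f : X → ℝ) x ≤ (g : X → ℝ) x) → ∀ x,
    ((D.T ^ k) f : X → ℝ) x ≤ ((D.T ^ k) g : X → ℝ) x := by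
  induction k with
  | zero => intro f g h x; simpa using h x
  | succ k ih =>
    intro f g h x
    rw [pow_succ]
    exact ih (D.T_mono h) x

/-- constants -/
def cst (D : DriftC P K W l b) (c : ℝ) : FW W :=
  ⟨fun _ => c, measurable_const, |c|, fun x => by
    simpa using mul_le_mul_of_nonneg_left (D.one_le x) (abs_nonneg c)⟩

/-- the weight itself -/
def Wf (D : DriftC P K W l b) : FW W :=
  ⟨W, D.meas, 1, fun x => by simp [abs_of_pos (D.Wpos x)]⟩

/-- the indicator of `K` -/
def KF (D : DriftC P K W l b) : FW W :=
  ⟨K.indicator (fun _ => 1), measurable_const.indicator D.hK, 1, fun x => by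
    have h4 : K.indicator (fun _ => (1:ℝ)) x ≤ 1 := Set.indicator_le_self' (by simp) x
    have h5 : (0:ℝ) ≤ K.indicator (fun _ => 1) x := Set.indicator_nonneg (fun _ _ => zero_le_one) x
    rw [abs_of_nonneg h5, one_mul]
    exact h4.trans (D.one_le x)⟩

@[simp] lemma cst_apply (D : DriftC P K W l b) (c : ℝ) (x : X) : (D.cst c : X → ℝ) x = c := rfl
@[simp] lemma Wf_apply (D : DriftC P K W l b) (x : X) : (D.Wf : X → ℝ) x = W x := rfl
@[simp] lemma KF_apply (D : DriftC P K W l b) (x : X) :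
    (D.KF : X → ℝ) x = K.indicator (fun _ => 1) x := rfl

lemma KF_nonneg (D : DriftC P K W l b) (x : X) : 0 ≤ (D.KF : X → ℝ) x :=
  Set.indicator_nonneg (fun _ _ => zero_le_one) x
lemma KF_le_one (D : DriftC P K W l b) (x : X) : (D.KF : X → ℝ) x ≤ 1 := by
  have h4 : K.indicator (fun _ => (1:ℝ)) x ≤ 1 := Set.indicator_le_self' (by simp) x
  exact h4

lemma T_cst (D : DriftC P K W l b) [IsMarkovKernel P] (c : ℝ) : D.T (D.cst c) = D.cst c := by
  ext x
  change ∫ _, c ∂(P x) = c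
  simp

lemma Tk_cst (D : DriftC P K W l b) [IsMarkovKernel P] (c : ℝ) (k : ℕ) :
    (D.T ^ k) (D.cst c) = D.cst c := by
  induction k with
  | zero => simp
  | succ k ih => rw [pow_succ, Module.End.mul_apply, T_cst, ih]

lemma Tk_nonneg (D : DriftC P K W l b) (k : ℕ) {f : FW W} (h : ∀ x, 0 ≤ (f : X → ℝ) x) (x : X) :
    0 ≤ ((D.T ^ k) f : X → ℝ) x := by
  have := D.Tk_mono k (f := 0) (g := f) h x
  simpa using this

lemma TW_le (D : DriftC P K W l b) (x : X) :
    (D.T D.Wf : X → ℝ) x ≤ ((l • D.Wf + b • D.KF : FW W) : X → ℝ) x := D.integral_W_le x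

lemma TkW_le_sum (D : DriftC P K W l b) (N : ℕ) (x : X) :
    ((D.T ^ N) D.Wf : X → ℝ) x ≤ l ^ N * W x
      + b * ∑ k ∈ Finset.range N, ((D.T ^ k) D.KF : X → ℝ) x := by
  induction N with
  | zero => simp
  | succ N ih =>
    have h1 := D.Tk_mono N D.TW_le x
    rw [map_add, map_smul, map_smul] at h1
    simp only [Submodule.coe_add, Submodule.coe_smul, Pi.add_apply, Pi.smul_apply, smul_eq_mul] at h1
    rw [pow_succ, Module.End.mul_apply, Finset.sum_range_succ]
    have h2 := mul_le_mul_of_nonneg_left ih D.l0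
    have h3 : 0 ≤ ∑ k ∈ Finset.range N, ((D.T ^ k) D.KF : X → ℝ) x :=
      Finset.sum_nonneg fun k _ => D.Tk_nonneg k D.KF_nonneg x
    have h4 := mul_nonneg D.b0 h3
    have h5 := mul_le_mul_of_nonneg_right D.l1.le h4
    rw [pow_succ]
    nlinarith

lemma TkW_le (D : DriftC P K W l b) [IsMarkovKernel P] (N : ℕ) (x : X) :
    ((D.T ^ N) D.Wf : X → ℝ) x ≤ l ^ N * W x + b / (1 - l) := by
  have hl : 0 < 1 - l := by linarith [D.l1]
  induction N with
  | zero => simpa using div_nonneg D.b0 hl.le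
  | succ N ih =>
    have h1 := D.Tk_mono N D.TW_le x
    rw [map_add, map_smul, map_smul] at h1
    simp only [Submodule.coe_add, Submodule.coe_smul, Pi.add_apply, Pi.smul_apply, smul_eq_mul] at h1
    rw [pow_succ, Module.End.mul_apply]
    have h2 := mul_le_mul_of_nonneg_left ih D.l0
    have h3 : ((D.T ^ N) D.KF : X → ℝ) x ≤ 1 := by
      have := D.Tk_mono N (f := D.KF) (g := D.cst 1) D.KF_le_one x
      rwa [Tk_cst] at this
    have h5 := mul_le_mul_of_nonneg_left h3 D.b0
    have h6 : b / (1 - l) = l * (b / (1 - l)) + b := by field_simp; ring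
    rw [h6, pow_succ]
    nlinarith

/-- uniform bound constant for the powers of `T` -/
def c2 (_ : DriftC P K W l b) : ℝ := 1 + b / (1 - l)

lemma one_le_c2 (D : DriftC P K W l b) : 1 ≤ D.c2 := by
  have hl : 0 < 1 - l := by linarith [D.l1]
  have := div_nonneg D.b0 hl.le
  simp [c2, this]

lemma TkW_le_c2 (D : DriftC P K W l b) [IsMarkovKernel P] (N : ℕ) (x : X) :
    ((D.T ^ N) D.Wf : X → ℝ) x ≤ D.c2 * W x := by
  have hl : 0 < 1 - l := by linarith [D.l1]
  have h0 := div_nonneg D.b0 hl.le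
  refine (D.TkW_le N x).trans ?_
  have h1 : l ^ N * W x ≤ 1 * W x :=
    mul_le_mul_of_nonneg_right (pow_le_one₀ D.l0 D.l1.le) (D.Wpos x).le
  have h2 := mul_le_mul_of_nonneg_left (D.one_le x) h0
  unfold c2; nlinarith

lemma Tk_bound (D : DriftC P K W l b) [IsMarkovKernel P] (k : ℕ) {C : ℝ} (hC0 : 0 ≤ C) {f : FW W}
    (h : ∀ x, |(f : X → ℝ) x| ≤ C * W x) (x : X) :
    |((D.T ^ k) f : X → ℝ) x| ≤ C * D.c2 * W x := by
  have hc := mul_le_mul_of_nonneg_left (D.TkW_le_c2 k x) hC0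
  rw [abs_le]
  constructor
  · have := D.Tk_mono k (f := - (C • D.Wf)) (g := f) (fun x => (abs_le.1 (h x)).1) x
    rw [map_neg, map_smul] at this
    simp only [Submodule.coe_neg, Submodule.coe_smul, Pi.neg_apply, Pi.smul_apply, smul_eq_mul] at this
    linarith
  · have := D.Tk_mono k (f := f) (g := C • D.Wf) (fun x => (abs_le.1 (h x)).2) x
    rw [map_smul] at this
    simp only [Submodule.coe_smul, Pi.smul_apply, smul_eq_mul] at this
    linarith

lemma exists_bound (D : DriftC P K W l b) (f : FW W) : ∃ C, 0 ≤ C ∧ ∀ x, |(f : X → ℝ) x| ≤ C * W x := by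
  obtain ⟨f, hm, C, hC⟩ := f
  exact ⟨|C|, abs_nonneg C, fun x =>
    (hC x).trans (mul_le_mul_of_nonneg_right (le_abs_self C) (D.Wpos x).le)⟩

/-- the absolute value -/
def absF (f : FW W) : FW W := ⟨fun x => |(f : X → ℝ) x|, by
  obtain ⟨f, hm, C, hC⟩ := f
  exact ⟨hm.abs, C, fun x => by simpa using hC x⟩⟩

lemma kpow_integral (D : DriftC P K W l b) (k : ℕ) (x : X) : ∀ (h : FW W),
    Integrable (h : X → ℝ) (kpow P k x) ∧
    ∫ y, (h : X → ℝ) y ∂(kpow P k x) = ((D.T ^ k) h : X → ℝ) x := by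
  induction k with
  | zero =>
    intro h
    have hm : StronglyMeasurable (h : X → ℝ) := h.2.1.stronglyMeasurable
    simp only [kpow, Kernel.id_apply, pow_zero, Module.End.one_apply]
    exact ⟨integrable_dirac' hm (by simp), integral_dirac' _ _ hm⟩
  | succ k ih =>
    intro h
    have hm : StronglyMeasurable (h : X → ℝ) := h.2.1.stronglyMeasurable
    have hi : Integrable (h : X → ℝ) ((P ∘ₖ kpow P k) x) := by
      rw [ProbabilityTheory.integrable_comp_iff hm.aestronglyMeasurable]
      refine ⟨Eventually.of_forall fun y => integrable_of_FW (D.integrable_W y) h, ?_⟩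
      exact (ih (D.T (absF h))).1
    refine ⟨hi, ?_⟩
    rw [kpow, Kernel.integral_comp hi, pow_succ, Module.End.mul_apply]
    exact (ih (D.T h)).2

lemma inv_integral (D : DriftC P K W l b) {π : Measure X}
    (hπ_inv : π.bind (fun x => P x) = π) (hπW : Integrable W π) (h : FW W) :
    ∫ x, (D.T h : X → ℝ) x ∂π = ∫ x, (h : X → ℝ) x ∂π := by
  have hi : Integrable (h : X → ℝ) (π.bind (fun x => P x)) := by
    rw [hπ_inv]; exact integrable_of_FW hπW h
  conv_rhs => rw [← hπ_inv]
  rw [show π.bind (fun x => P x) = (P ∘ₖ Kernel.const Unit π) () by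
    rw [Kernel.comp_apply, Kernel.const_apply]] at hi ⊢
  rw [Kernel.integral_comp hi]
  rfl

lemma inv_integral_k (D : DriftC P K W l b) {π : Measure X}
    (hπ_inv : π.bind (fun x => P x) = π) (hπW : Integrable W π) (k : ℕ) : ∀ (h : FW W),
    ∫ x, ((D.T ^ k) h : X → ℝ) x ∂π = ∫ x, (h : X → ℝ) x ∂π := by
  induction k with
  | zero => simp
  | succ k ih => intro h; rw [pow_succ, Module.End.mul_apply, ih, D.inv_integral hπ_inv hπW]

end DriftC
end

section

lemma shift_sum {M : Type*} [AddCommGroup M] (a : ℕ → M) (n i : ℕ) :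
    ∑ k ∈ Finset.range n, a (k + i) - ∑ k ∈ Finset.range n, a k
      = ∑ k ∈ Finset.range i, a (n + k) - ∑ k ∈ Finset.range i, a k := by
  have h1 := Finset.sum_range_add a n i
  have h2 := Finset.sum_range_add a i n
  rw [add_comm i n, h1] at h2
  simp only [add_comm _ i]
  rw [sub_eq_sub_iff_add_eq_add]
  rw [add_comm _ (∑ k ∈ Finset.range i, a k), ← h2, add_comm]

namespace DriftC
variable {X : Type*} [MeasurableSpace X] {P : Kernel X X} {K : Set X} {W : X → ℝ} {l b : ℝ}

/-- evaluation functional -/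
def ev (W : X → ℝ) (x : X) : FW W →ₗ[ℝ] ℝ := (LinearMap.proj x).comp (FW W).subtype

lemma ev_def (h : FW W) (x : X) : (h : X → ℝ) x = ev W x h := rfl

lemma contraction (D : DriftC P K W l b) [Nonempty X] (Q : FW W →ₗ[ℝ] FW W)
    (hQpos : ∀ h : FW W, (∀ x, 0 ≤ ev W x h) → ∀ x, 0 ≤ ev W x (Q h))
    (hQ1 : ∀ c, Q (D.cst c) = D.cst c) {c : ℝ} (hc : 0 ≤ c)
    (hQW : ∀ x, ev W x (Q D.Wf) ≤ l * W x + c)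
    (L : FW W →ₗ[ℝ] ℝ) (hLpos : ∀ h : FW W, (∀ x, 0 ≤ ev W x h) → 0 ≤ L h)
    (hL1 : L (D.cst 1) = 1) {a : ℝ} (ha : 0 < a)
    (hmin : ∀ x, W x ≤ 4 * (c + 1) / (1 - l) → ∀ h : FW W, (∀ x, 0 ≤ ev W x h) →
      a * L h ≤ ev W x (Q h)) :
    ∃ β > 0, ∃ ρ ∈ Set.Ico (0:ℝ) 1, ∀ s ≥ 0, ∀ h : FW W,
      (∀ x y, ev W x h - ev W y h ≤ s * (2 + β * W x + β * W y)) →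
      ∀ x y, ev W x (Q h) - ev W y (Q h) ≤ ρ * s * (2 + β * W x + β * W y) := by
  have hl : 0 < 1 - l := by linarith [D.l1]
  have hl0 := D.l0
  set β : ℝ := a / (2 * (c + 1)) with hβ
  have hβ0 : 0 < β := by positivity
  set ζ : ℝ := min ((1 - l) / 4) (min (β / 2) (a / 2)) with hζ
  have hζ0 : 0 < ζ := by simp only [hζ, lt_min_iff]; refine ⟨?_, ?_, ?_⟩ <;> positivity
  have hζ1 : ζ ≤ (1 - l) / 4 := min_le_left _ _
  have hζ2 : ζ ≤ β / 2 := (min_le_right _ _).trans (min_le_left _ _)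
  have hζ3 : ζ ≤ a / 2 := (min_le_right _ _).trans (min_le_right _ _)
  refine ⟨β, hβ0, 1 - ζ, ⟨by linarith, by linarith⟩, ?_⟩
  intro s hs h hh x y
  -- centering
  obtain ⟨c0, hc0⟩ : ∃ c0 : ℝ, ∀ x, |ev W x h - c0| ≤ s * (1 + β * W x) := by
    have hub : ∀ x y, ev W x h - s * (1 + β * W x) ≤ ev W y h + s * (1 + β * W y) := by
      intro x y; have := hh x y; nlinarith
    have hbdd : BddAbove (Set.range fun x => ev W x h - s * (1 + β * W x)) := by
      obtain ⟨y⟩ := ‹Nonempty X›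
      exact ⟨_, by rintro _ ⟨x, rfl⟩; exact hub x y⟩
    refine ⟨⨆ x, (ev W x h - s * (1 + β * W x)), fun x => ?_⟩
    have h1 := le_ciSup hbdd x
    have h2 : (⨆ x, (ev W x h - s * (1 + β * W x))) ≤ ev W x h + s * (1 + β * W x) :=
      ciSup_le fun z => hub z x
    rw [abs_le]; constructor <;> linarith
  set w : FW W := s • (D.cst 1 + β • D.Wf) with hw
  set g : FW W := h - D.cst c0 with hg
  have evw : ∀ x, ev W x w = s * (1 + β * W x) := fun x => rfl
  have evg : ∀ x, ev W x g = ev W x h - c0 := fun x => rfl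
  have hp1 : ∀ x, 0 ≤ ev W x (w - g) := fun x => by
    rw [map_sub, evw, evg]; linarith [(abs_le.1 (hc0 x)).2]
  have hp2 : ∀ x, 0 ≤ ev W x (w + g) := fun x => by
    rw [map_add, evw, evg]; linarith [(abs_le.1 (hc0 x)).1]
  have hQg : ∀ x, ev W x (Q g) = ev W x (Q h) - c0 := by
    intro x; rw [hg, map_sub, hQ1, map_sub]; rfl
  have hQw : ∀ x, ev W x (Q w) ≤ s * (1 + β * (l * W x + c)) := by
    intro x; rw [hw, map_smul, map_add, map_smul, hQ1, map_smul, map_add, map_smul]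
    have : ev W x (D.cst 1) = 1 := rfl
    rw [this, smul_eq_mul, smul_eq_mul]
    exact mul_le_mul_of_nonneg_left (by linarith [mul_le_mul_of_nonneg_left (hQW x) hβ0.le]) hs
  have hLw : s ≤ L w := by
    have : 0 ≤ L D.Wf := hLpos _ fun x => (D.Wpos x).le
    rw [hw, map_smul, map_add, map_smul, hL1, smul_eq_mul, smul_eq_mul]
    nlinarith [mul_nonneg hs (mul_nonneg hβ0.le this)]
  clear_value w g
  have hWx := D.Wpos x
  have hWy := D.Wpos y
  have hβc : 2 * (β * c) ≤ a := by
    have : β * (2 * (c + 1)) = a := by rw [hβ]; field_simp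
    nlinarith
  by_cases hS : W x + W y ≤ 4 * (c + 1) / (1 - l)
  · have h1 := hmin x (by linarith) (w - g) hp1
    have h2 := hmin y (by linarith) (w + g) hp2
    rw [map_sub, map_sub, map_sub, hQg] at h1
    rw [map_add, map_add, map_add, hQg] at h2
    have h3 := hQw x
    have h4 := hQw y
    have key : ev W x (Q h) - ev W y (Q h) ≤
        s * (2 + β * l * (W x + W y) + 2 * (β * c) - 2 * a) := by nlinarith
    refine key.trans ?_
    rw [show (1 - ζ) * s * (2 + β * W x + β * W y)
      = s * ((1 - ζ) * (2 + β * W x + β * W y)) by ring]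
    refine mul_le_mul_of_nonneg_left ?_ hs
    have h5 : β * l * (W x + W y) ≤ (1 - ζ) * (β * (W x + W y)) := by
      have : 0 ≤ β * (W x + W y) := by positivity
      nlinarith
    nlinarith
  · push Not at hS
    have h1 := hQpos (w - g) hp1 x
    have h2 := hQpos (w + g) hp2 y
    rw [map_sub, map_sub, hQg] at h1
    rw [map_add, map_add, hQg] at h2
    have h3 := hQw x
    have h4 := hQw y
    have key : ev W x (Q h) - ev W y (Q h) ≤
        s * (2 + β * l * (W x + W y) + 2 * (β * c)) := by nlinarith
    refine key.trans ?_
    rw [show (1 - ζ) * s * (2 + β * W x + β * W y)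
      = s * ((1 - ζ) * (2 + β * W x + β * W y)) by ring]
    refine mul_le_mul_of_nonneg_left ?_ hs
    rw [div_lt_iff₀ hl] at hS
    -- S (1 - l) > 4 (c+1)
    have h5 : 2 * (β * c) + 2 * β ≤ β * ((W x + W y) * (1 - l)) / 2 := by nlinarith
    have h6 : ζ * (β * (W x + W y)) ≤ (1 - l) / 4 * (β * (W x + W y)) :=
      mul_le_mul_of_nonneg_right hζ1 (by positivity)
    nlinarith

/-- averaged operator -/
def Q (D : DriftC P K W l b) (N m : ℕ) : FW W →ₗ[ℝ] FW W :=
  (1 / (N : ℝ)) • ∑ k ∈ Finset.range N, D.T ^ (k + m + 1)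

lemma ev_Q (D : DriftC P K W l b) (N m : ℕ) (h : FW W) (x : X) :
    ev W x (D.Q N m h) = (1 / (N : ℝ)) * ∑ k ∈ Finset.range N, ev W x ((D.T ^ (k + m + 1)) h) := by
  rw [Q, LinearMap.smul_apply, map_smul, LinearMap.sum_apply, map_sum, smul_eq_mul]

lemma Q_avg_le {N : ℕ} (hN : 0 < N) {a : ℕ → ℝ} {B : ℝ} (h : ∀ k, a k ≤ B) :
    (1 / (N : ℝ)) * ∑ k ∈ Finset.range N, a k ≤ B := by
  have : ∑ k ∈ Finset.range N, a k ≤ N * B := by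
    simpa using Finset.sum_le_sum (s := Finset.range N) fun k _ => h k
  have hN' : (0:ℝ) < N := by exact_mod_cast hN
  rw [one_div, inv_mul_le_iff₀ hN']; exact this

lemma Q_bound (D : DriftC P K W l b) [IsMarkovKernel P] {N : ℕ} (hN : 0 < N) (m : ℕ) {C : ℝ}
    (hC0 : 0 ≤ C) {f : FW W}
    (h : ∀ x, |ev W x f| ≤ C * W x) (x : X) :
    |ev W x (D.Q N m f)| ≤ C * D.c2 * W x := by
  rw [ev_Q, abs_mul, abs_of_nonneg (by positivity)]
  refine (mul_le_mul_of_nonneg_left (Finset.abs_sum_le_sum_abs _ _) (by positivity)).trans ?_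
  exact Q_avg_le hN fun k => D.Tk_bound _ hC0 h x

lemma Qj_bound (D : DriftC P K W l b) [IsMarkovKernel P] {N : ℕ} (hN : 0 < N) (m : ℕ)
    {f : FW W} (h : ∀ x, |ev W x f| ≤ W x) (j : ℕ) : ∀ (x : X),
    |ev W x ((D.Q N m ^ j) f)| ≤ D.c2 ^ j * W x := by
  induction j with
  | zero => simpa using h
  | succ j ih =>
    intro x
    rw [pow_succ', Module.End.mul_apply, pow_succ]
    exact D.Q_bound hN m (pow_nonneg (zero_le_one.trans D.one_le_c2) j) ih x

lemma minor (D : DriftC P K W l b) [IsMarkovKernel P] [Nonempty X] {δ : ℝ} (hδ : 0 < δ) (m : ℕ)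
    (ν : Measure X) [IsProbabilityMeasure ν]
    (hminor : ∀ x ∈ K, ∀ A : Set X, MeasurableSet A →
      ENNReal.ofReal δ * ν A ≤ (kpow P m) x A) (R : ℝ) :
    ∃ N : ℕ, 0 < N ∧ ∃ a > 0, ∃ L : FW W →ₗ[ℝ] ℝ,
      (∀ h : FW W, (∀ x, 0 ≤ ev W x h) → 0 ≤ L h) ∧ L (D.cst 1) = 1 ∧
      ∀ x, W x ≤ R → ∀ h : FW W, (∀ x, 0 ≤ ev W x h) → a * L h ≤ ev W x (D.Q N m h) := by
  obtain ⟨x0⟩ := ‹Nonempty X›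
  set R' := max R (W x0) with hR'
  have hR'0 : 0 < R' := (D.Wpos x0).trans_le (le_max_right _ _)
  obtain ⟨N, hN⟩ : ∃ N : ℕ, l ^ N < 1 / (2 * R') :=
    exists_pow_lt_of_lt_one (by positivity) D.l1
  have hhit : ∀ x, W x ≤ R' → 1 / (2 * (b + 1)) ≤
      ∑ k ∈ Finset.range N, ev W x ((D.T ^ k) D.KF) := by
    intro x hx
    have h1 := D.TkW_le_sum N x
    have h2 : 1 ≤ ((D.T ^ N) D.Wf : X → ℝ) x := by
      have := D.Tk_mono N (f := D.cst 1) (g := D.Wf) D.one_le x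
      rwa [Tk_cst] at this
    have h3 : l ^ N * W x ≤ 1 / 2 := by
      calc l ^ N * W x ≤ 1 / (2 * R') * R' :=
            mul_le_mul hN.le hx (D.Wpos x).le (by positivity)
        _ = 1 / 2 := by field_simp
    have h4 : 0 ≤ ∑ k ∈ Finset.range N, ev W x ((D.T ^ k) D.KF) :=
      Finset.sum_nonneg fun k _ => D.Tk_nonneg k D.KF_nonneg x
    have h5 : 1 ≤ 1/2 + b * ∑ k ∈ Finset.range N, ev W x ((D.T ^ k) D.KF) := by
      refine h2.trans (h1.trans ?_)
      exact add_le_add h3 le_rfl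
    have hb := D.b0
    rw [div_le_iff₀ (by positivity)]
    nlinarith
  have hb := D.b0
  have hNpos : 0 < N := by
    rcases Nat.eq_zero_or_pos N with h | h
    · exfalso
      have := hhit x0 (le_max_right _ _)
      rw [h] at this
      simp only [Finset.range_zero, Finset.sum_empty] at this
      have : (0:ℝ) < 1 / (2 * (b + 1)) := by positivity
      linarith
    · exact h
  have hKne : ∃ z, z ∈ K := by
    by_contra hcon
    push Not at hcon
    have h0 : D.KF = 0 := by
      ext x
      change K.indicator (fun _ => (1:ℝ)) x = 0
      simp [hcon x]
    have := hhit x0 (le_max_right _ _)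
    simp only [h0, map_zero, Finset.sum_const_zero] at this
    have : (0:ℝ) < 1 / (2 * (b + 1)) := by positivity
    linarith
  have hle : ∀ x ∈ K, ENNReal.ofReal δ • ν ≤ kpow P m x := fun x hx =>
    Measure.le_iff.2 fun s hs => by simpa using hminor x hx s hs
  have hνW : Integrable W ν := by
    obtain ⟨z, hz⟩ := hKne
    have h1 := ((D.kpow_integral m z D.Wf).1).mono_measure (hle z hz)
    rwa [integrable_smul_measure (by simpa using hδ) (by simp)] at h1
  have hKm : ∀ x ∈ K, ∀ h : FW W, (∀ x, 0 ≤ ev W x h) →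
      δ * ∫ y, (h : X → ℝ) y ∂ν ≤ ev W x ((D.T ^ m) h) := by
    intro x hx h hh
    have h1 := D.kpow_integral m x h
    rw [← ev_def, ← h1.2]
    have h2 := integral_mono_measure (hle x hx) (Eventually.of_forall hh) h1.1
    rw [integral_smul_measure, ENNReal.toReal_ofReal hδ.le] at h2
    exact h2
  let L : FW W →ₗ[ℝ] ℝ :=
    { toFun := fun h => ∫ y, (D.T h : X → ℝ) y ∂ν
      map_add' := fun f g => by
        rw [map_add]
        exact integral_add (integrable_of_FW hνW _) (integrable_of_FW hνW _)
      map_smul' := fun c f => by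
        rw [map_smul]
        exact integral_const_mul _ _ }
  have hL : ∀ h, L h = ∫ y, (D.T h : X → ℝ) y ∂ν := fun h => rfl
  have hTpos : ∀ h : FW W, (∀ x, 0 ≤ ev W x h) → ∀ x, 0 ≤ ev W x (D.T h) := fun h hh x => by
    have := D.Tk_nonneg 1 hh x
    rwa [pow_one] at this
  have hLpos : ∀ h : FW W, (∀ x, 0 ≤ ev W x h) → 0 ≤ L h := fun h hh => by
    rw [hL]; exact integral_nonneg (hTpos h hh)
  have hN0 : (0:ℝ) < N := by exact_mod_cast hNpos
  refine ⟨N, hNpos, 1 / N * (δ * (1 / (2 * (b + 1)))), by positivity, L, hLpos, ?_, ?_⟩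
  · rw [hL, T_cst]; simp
  · intro x hx h hh
    rw [ev_Q, mul_assoc]
    refine mul_le_mul_of_nonneg_left ?_ (by positivity)
    have hLh := hLpos h hh
    calc δ * (1 / (2 * (b + 1))) * L h = (δ * L h) * (1 / (2 * (b + 1))) := by ring
      _ ≤ (δ * L h) * ∑ k ∈ Finset.range N, ev W x ((D.T ^ k) D.KF) :=
          mul_le_mul_of_nonneg_left (hhit x (hx.trans (le_max_left _ _))) (by positivity)
      _ = ∑ k ∈ Finset.range N, ev W x ((D.T ^ k) ((δ * L h) • D.KF)) := by
          simp only [map_smul, smul_eq_mul, Finset.mul_sum]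
      _ ≤ _ := by
          refine Finset.sum_le_sum fun k _ => ?_
          rw [add_assoc, pow_add, Module.End.mul_apply]
          refine D.Tk_mono k (fun z => ?_) x
          rw [pow_succ, Module.End.mul_apply]
          change (δ * L h) * K.indicator (fun _ => (1:ℝ)) z ≤ ev W z ((D.T ^ m) (D.T h))
          by_cases hz : z ∈ K
          · rw [Set.indicator_of_mem hz, mul_one, hL]
            exact hKm z hz _ (hTpos h hh)
          · rw [Set.indicator_of_notMem hz, mul_zero]
            exact D.Tk_nonneg m (hTpos h hh) z

end DriftC
end

section

namespace DriftC
variable {X : Type*} [MeasurableSpace X] {P : Kernel X X} {K : Set X} {W : X → ℝ} {l b : ℝ}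

lemma Qj_shift (D : DriftC P K W l b) [IsMarkovKernel P] {N : ℕ} (hN : 0 < N) (m j : ℕ) :
    ∃ C : ℝ, 0 ≤ C ∧ ∀ h : FW W, (∀ x, |ev W x h| ≤ W x) → ∀ n x,
      |∑ k ∈ Finset.range n, ev W x ((D.T ^ k) ((D.Q N m ^ j) h))
        - ∑ k ∈ Finset.range n, ev W x ((D.T ^ k) h)| ≤ C * W x := by
  have hc2 := zero_le_one.trans D.one_le_c2
  induction j with
  | zero => exact ⟨0, le_rfl, fun h _ n x => by simp⟩
  | succ j ih =>
    obtain ⟨C, hC0, hC⟩ := ih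
    set B : ℝ := D.c2 ^ j * D.c2 with hB
    have hB0 : 0 ≤ B := by positivity
    refine ⟨C + (N + m + 1 : ℕ) * (2 * B), by positivity, fun h hh n x => ?_⟩
    set g := (D.Q N m ^ j) h with hg
    have hgb : ∀ k x, |ev W x ((D.T ^ k) g)| ≤ B * W x := fun k x =>
      D.Tk_bound k (pow_nonneg hc2 j) (D.Qj_bound hN m hh j) x
    have hWx := (D.Wpos x).le
    have h1 : ∀ i ≤ N + m + 1, |∑ k ∈ Finset.range n, ev W x ((D.T ^ (k + i)) g)
        - ∑ k ∈ Finset.range n, ev W x ((D.T ^ k) g)| ≤ (N + m + 1 : ℕ) * (2 * B) * W x := by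
      intro i hi
      rw [shift_sum (fun k => ev W x ((D.T ^ k) g)) n i, ← Finset.sum_sub_distrib]
      refine (Finset.abs_sum_le_sum_abs _ _).trans ?_
      calc ∑ k ∈ Finset.range i, |ev W x ((D.T ^ (n + k)) g) - ev W x ((D.T ^ k) g)|
          ≤ ∑ k ∈ Finset.range i, 2 * B * W x := Finset.sum_le_sum fun k _ => by
            refine (abs_sub _ _).trans ?_
            linarith [hgb (n + k) x, hgb k x]
        _ = i * (2 * B) * W x := by simp [mul_assoc]
        _ ≤ _ := by
            have : (i:ℝ) ≤ (N + m + 1 : ℕ) := by exact_mod_cast hi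
            gcongr
    have h2 : ∑ k ∈ Finset.range n, ev W x ((D.T ^ k) ((D.Q N m ^ (j + 1)) h))
        - ∑ k ∈ Finset.range n, ev W x ((D.T ^ k) g)
        = 1 / (N:ℝ) * ∑ i ∈ Finset.range N, (∑ k ∈ Finset.range n, ev W x ((D.T ^ (k + (i + m + 1))) g)
          - ∑ k ∈ Finset.range n, ev W x ((D.T ^ k) g)) := by
      have hN0 : (N:ℝ) ≠ 0 := by exact_mod_cast hN.ne'
      rw [Finset.sum_sub_distrib, mul_sub]
      congr 1
      · rw [Finset.sum_comm, Finset.mul_sum]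
        refine Finset.sum_congr rfl fun k _ => ?_
        rw [pow_succ', Module.End.mul_apply, ← hg, Q, LinearMap.smul_apply, map_smul, map_smul,
          LinearMap.sum_apply, map_sum, map_sum, smul_eq_mul]
        simp only [pow_add D.T k, Module.End.mul_apply]
      · simp only [Finset.sum_const, Finset.card_range, nsmul_eq_mul]
        field_simp
    have h3 : |∑ k ∈ Finset.range n, ev W x ((D.T ^ k) ((D.Q N m ^ (j + 1)) h))
        - ∑ k ∈ Finset.range n, ev W x ((D.T ^ k) g)| ≤ (N + m + 1 : ℕ) * (2 * B) * W x := by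
      rw [h2, abs_mul, abs_of_nonneg (by positivity)]
      refine (mul_le_mul_of_nonneg_left (Finset.abs_sum_le_sum_abs _ _) (by positivity)).trans ?_
      rw [one_div, inv_mul_le_iff₀ (by exact_mod_cast hN)]
      calc _ ≤ ∑ i ∈ Finset.range N, (N + m + 1 : ℕ) * (2 * B) * W x :=
            Finset.sum_le_sum fun i hi => h1 _ (by have := Finset.mem_range.1 hi; omega)
        _ = _ := by simp
    have h4 := hC h hh n x
    rw [← hg] at h4
    rw [add_mul]
    calc _ = |(∑ k ∈ Finset.range n, ev W x ((D.T ^ k) ((D.Q N m ^ (j + 1)) h))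
        - ∑ k ∈ Finset.range n, ev W x ((D.T ^ k) g)) +
        (∑ k ∈ Finset.range n, ev W x ((D.T ^ k) g)
        - ∑ k ∈ Finset.range n, ev W x ((D.T ^ k) h))| := by congr 1; ring
      _ ≤ _ := abs_add_le _ _
      _ ≤ _ := by linarith

theorem ergodic (D : DriftC P K W l b) [IsMarkovKernel P] {δ : ℝ} (hδ : 0 < δ) (m : ℕ)
    (ν : Measure X) [IsProbabilityMeasure ν]
    (hminor : ∀ x ∈ K, ∀ A : Set X, MeasurableSet A →
      ENNReal.ofReal δ * ν A ≤ (kpow P m) x A)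
    {π : Measure X} [IsProbabilityMeasure π]
    (hπ_inv : π.bind (fun x => P x) = π) (hπW : Integrable W π) (τ : ℝ) (hτ : 0 < τ) :
    ∃ C : ℝ, 0 ≤ C ∧ ∀ h : FW W, (∀ x, |ev W x h| ≤ W x) → ∀ (n : ℕ) x,
      |∑ k ∈ Finset.range n, ev W x ((D.T ^ k) h) - n * ∫ x, (h : X → ℝ) x ∂π|
        ≤ (τ * n + C) * W x := by
  have hl : 0 < 1 - l := by linarith [D.l1]
  have hl0 := D.l0
  have hb := D.b0
  have : Nonempty X := by
    by_contra hcon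
    rw [not_nonempty_iff] at hcon
    have h1 := measure_univ (μ := π)
    rw [Measure.eq_zero_of_isEmpty π] at h1
    simp at h1
  set c := b / (1 - l) with hc
  have hc0 : 0 ≤ c := by positivity
  obtain ⟨N, hN, a, ha, L, hLpos, hL1, hmin⟩ :=
    D.minor hδ m ν hminor (4 * (c + 1) / (1 - l))
  have hN0 : (N:ℝ) ≠ 0 := by exact_mod_cast hN.ne'
  have hQpos : ∀ h : FW W, (∀ x, 0 ≤ ev W x h) → ∀ x, 0 ≤ ev W x (D.Q N m h) := by
    intro h hh x
    rw [ev_Q]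
    exact mul_nonneg (by positivity) (Finset.sum_nonneg fun k _ => D.Tk_nonneg _ hh x)
  have hQ1 : ∀ c, D.Q N m (D.cst c) = D.cst c := by
    intro c
    ext x
    rw [ev_def, ev_def, ev_Q]
    simp only [Tk_cst]
    simp only [Finset.sum_const, Finset.card_range, nsmul_eq_mul]
    field_simp
  have hQW : ∀ x, ev W x (D.Q N m D.Wf) ≤ l * W x + c := by
    intro x
    rw [ev_Q]
    refine Q_avg_le hN fun k => (D.TkW_le _ x).trans ?_
    have : l ^ (k + m + 1) ≤ l := by
      rw [pow_succ]; exact mul_le_of_le_one_left hl0 (pow_le_one₀ hl0 D.l1.le)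
    have := mul_le_mul_of_nonneg_right this (D.Wpos x).le
    linarith
  obtain ⟨β, hβ, ρ, ⟨hρ0, hρ1⟩, hcon⟩ :=
    D.contraction (D.Q N m) hQpos hQ1 hc0 hQW L hLpos hL1 ha hmin
  have hiter : ∀ j, ∀ h : FW W, (∀ x, |ev W x h| ≤ W x) → ∀ x y,
      ev W x ((D.Q N m ^ j) h) - ev W y ((D.Q N m ^ j) h)
        ≤ ρ ^ j * (1 / β) * (2 + β * W x + β * W y) := by
    intro j h hh
    induction j with
    | zero =>
      intro x y
      have h1 := (abs_le.1 (hh x)).2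
      have h2 := (abs_le.1 (hh y)).1
      have : (1 / β) * (2 + β * W x + β * W y) = 2 / β + W x + W y := by field_simp
      rw [pow_zero ρ, one_mul, this]
      have : 0 < 2 / β := by positivity
      simp only [pow_zero, Module.End.one_apply]
      linarith
    | succ j ih =>
      intro x y
      have := hcon _ (by positivity) _ ih x y
      rw [pow_succ', Module.End.mul_apply, pow_succ' ρ]
      linarith
  let πL : FW W →ₗ[ℝ] ℝ :=
    { toFun := fun h => ∫ y, (h : X → ℝ) y ∂π
      map_add' := fun f g => integral_add (integrable_of_FW hπW _) (integrable_of_FW hπW _)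
      map_smul' := fun c f => integral_const_mul _ _ }
  have hπL : ∀ h, πL h = ∫ y, (h : X → ℝ) y ∂π := fun h => rfl
  have hπLpos : ∀ h : FW W, (∀ x, 0 ≤ ev W x h) → 0 ≤ πL h := fun h hh => by
    rw [hπL]; exact integral_nonneg hh
  have hπc : ∀ c, πL (D.cst c) = c := fun c => by rw [hπL]; simp
  have hπQ : ∀ h, πL (D.Q N m h) = πL h := by
    intro h
    have hk : ∀ k, πL ((D.T ^ k) h) = πL h := fun k => D.inv_integral_k hπ_inv hπW k h
    rw [Q, LinearMap.smul_apply, map_smul, LinearMap.sum_apply, map_sum, smul_eq_mul]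
    simp only [hk, Finset.sum_const, Finset.card_range, nsmul_eq_mul]
    field_simp
  have hπQj : ∀ j h, πL ((D.Q N m ^ j) h) = πL h := by
    intro j h
    induction j with
    | zero => simp
    | succ j ih => rw [pow_succ', Module.End.mul_apply, hπQ, ih]
  set w0 := πL D.Wf with hw0
  have hw00 : 0 ≤ w0 := hπLpos _ fun x => (D.Wpos x).le
  set C1 : ℝ := (1 / β) * (2 + β + β * w0) with hC1
  have hC10 : 0 ≤ C1 := by positivity
  have hconv : ∀ j, ∀ h : FW W, (∀ x, |ev W x h| ≤ W x) → ∀ x,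
      |ev W x ((D.Q N m ^ j) h - D.cst (πL h))| ≤ ρ ^ j * C1 * W x := by
    intro j h hh x
    set g := (D.Q N m ^ j) h with hg
    have hs : 0 ≤ ρ ^ j * (1 / β) := by positivity
    have hW1 := D.one_le x
    have hfin : ρ ^ j * (1 / β) * (2 + β * W x + β * w0) ≤ ρ ^ j * C1 * W x := by
      rw [hC1, ← mul_assoc, mul_assoc (ρ ^ j * (1 / β))]
      refine mul_le_mul_of_nonneg_left ?_ hs
      have : 0 ≤ β * w0 := by positivity
      nlinarith
    have e1 : πL ((ρ ^ j * (1 / β)) • (D.cst (2 + β * W x) + β • D.Wf))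
        = ρ ^ j * (1 / β) * (2 + β * W x + β * w0) := by
      rw [map_smul, map_add, map_smul, hπc, smul_eq_mul, smul_eq_mul]
    have e2 : ev W x (g - D.cst (πL h)) = ev W x g - πL h := rfl
    rw [e2, abs_le]
    constructor
    · have h1 := hπLpos ((ρ ^ j * (1 / β)) • (D.cst (2 + β * W x) + β • D.Wf)
        - (g - D.cst (ev W x g))) fun y => by
          have := hiter j h hh y x
          change 0 ≤ (ρ ^ j * (1 / β)) * ((2 + β * W x) + β * W y) - (ev W y g - ev W x g)
          rw [← hg] at this
          linarith
      rw [map_sub, map_sub, e1, hπc, hg, hπQj, ← hg] at h1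
      linarith
    · have h1 := hπLpos ((ρ ^ j * (1 / β)) • (D.cst (2 + β * W x) + β • D.Wf)
        - (D.cst (ev W x g) - g)) fun y => by
          have := hiter j h hh x y
          change 0 ≤ (ρ ^ j * (1 / β)) * ((2 + β * W x) + β * W y) - (ev W x g - ev W y g)
          rw [← hg] at this
          linarith
      rw [map_sub, map_sub, e1, hπc, hg, hπQj, ← hg] at h1
      linarith
  have hc2 := D.one_le_c2
  obtain ⟨j, hj⟩ : ∃ j : ℕ, ρ ^ j < τ / (C1 * D.c2 + 1) :=
    exists_pow_lt_of_lt_one (by positivity) hρ1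
  obtain ⟨C, hC0, hC⟩ := D.Qj_shift hN m j
  refine ⟨C, hC0, fun h hh n x => ?_⟩
  have hWx := D.Wpos x
  have h1 := hC h hh n x
  have hτ' : ρ ^ j * C1 * D.c2 ≤ τ := by
    rw [lt_div_iff₀ (by positivity)] at hj
    nlinarith [pow_nonneg hρ0 j]
  have h2 : |∑ k ∈ Finset.range n, ev W x ((D.T ^ k) ((D.Q N m ^ j) h - D.cst (πL h)))|
      ≤ τ * n * W x := by
    refine (Finset.abs_sum_le_sum_abs _ _).trans ?_
    calc _ ≤ ∑ k ∈ Finset.range n, ρ ^ j * C1 * D.c2 * W x :=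
          Finset.sum_le_sum fun k _ => D.Tk_bound k (by positivity) (hconv j h hh) x
      _ = (ρ ^ j * C1 * D.c2) * (n * W x) := by simp; ring
      _ ≤ τ * (n * W x) := mul_le_mul_of_nonneg_right hτ' (by positivity)
      _ = _ := by ring
  have h3 : ∑ k ∈ Finset.range n, ev W x ((D.T ^ k) ((D.Q N m ^ j) h - D.cst (πL h)))
      = ∑ k ∈ Finset.range n, ev W x ((D.T ^ k) ((D.Q N m ^ j) h)) - n * πL h := by
    simp only [map_sub, Tk_cst, Finset.sum_sub_distrib]
    congr 1
    have : ev W x (D.cst (πL h)) = πL h := rfl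
    rw [this]; simp
  rw [h3] at h2
  rw [← hπL]
  calc _ = |(∑ k ∈ Finset.range n, ev W x ((D.T ^ k) ((D.Q N m ^ j) h)) - n * πL h) -
      (∑ k ∈ Finset.range n, ev W x ((D.T ^ k) ((D.Q N m ^ j) h))
        - ∑ k ∈ Finset.range n, ev W x ((D.T ^ k) h))| := by congr 1; ring
    _ ≤ _ := abs_sub _ _
    _ ≤ _ := by rw [add_mul]; linarith

end DriftC
end

section

section paths
variable {X : Type*} [MeasurableSpace X] {P : Kernel X X} {μ : Measure X} {Pμ : Measure (ℕ → X)}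

/-- the path frozen after time `n` -/
def frz (n : ℕ) (ω : ℕ → X) : ℕ → X := fun k => ω (min k n)

lemma measurable_frz (n : ℕ) : Measurable (frz n : (ℕ → X) → ℕ → X) := by
  unfold frz; fun_prop

lemma frz_apply {n k : ℕ} (h : k ≤ n) (ω : ℕ → X) : frz n ω k = ω k := by
  simp [frz, h]

lemma joint_law [IsMarkovKernel P] (hP : IsMarkovChainLaw μ P Pμ) (n : ℕ) :
    Pμ.map (fun ω => (frz n ω, ω (n + 1)))
      = (Pμ.map (frz n)) ⊗ₘ (P.comap (fun v : ℕ → X => v n) (measurable_pi_apply n)) := by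
  have := hP.1
  have hfz := measurable_frz (X := X) n
  have hpair : Measurable (fun ω : ℕ → X => (frz n ω, ω (n + 1))) := by fun_prop
  have : IsProbabilityMeasure (Pμ.map (fun ω : ℕ → X => (frz n ω, ω (n + 1)))) :=
    Measure.isProbabilityMeasure_map hpair.aemeasurable
  have : IsProbabilityMeasure (Pμ.map (frz n : (ℕ → X) → ℕ → X)) :=
    Measure.isProbabilityMeasure_map hfz.aemeasurable
  refine Measure.ext_prod fun {s t} hs ht => ?_
  rw [Measure.map_apply hpair (hs.prod ht), Measure.compProd_apply_prod hs ht,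
    setLIntegral_map hs (Kernel.measurable_coe _ ht) hfz]
  have key := hP.2.2 n (fun v => s.indicator (fun _ => 1)
      (fun k => v ⟨min k n, Nat.lt_succ_of_le (min_le_right _ _)⟩))
    (t.indicator fun _ => 1) ((measurable_const.indicator hs).comp (by fun_prop))
    (measurable_const.indicator ht)
  have e : ∀ ω : ℕ → X, (fun k => (fun i : Fin (n+1) => ω i)
      ⟨min k n, Nat.lt_succ_of_le (min_le_right k n)⟩) = frz n ω := fun ω => rfl
  simp only [e] at key
  have hs' : MeasurableSet (frz n ⁻¹' s : Set (ℕ → X)) := hfz hs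
  have ht' : MeasurableSet ((fun ω : ℕ → X => ω (n+1)) ⁻¹' t) := (measurable_pi_apply (n+1)) ht
  calc _ = ∫⁻ ω, ((frz n ⁻¹' s) ∩ ((fun ω : ℕ → X => ω (n+1)) ⁻¹' t)).indicator 1 ω ∂Pμ := by
        rw [lintegral_indicator_one (hs'.inter ht')]; rfl
    _ = ∫⁻ ω, s.indicator (fun _ => 1) (frz n ω) * t.indicator (fun _ => 1) (ω (n+1)) ∂Pμ := by
        refine lintegral_congr fun ω => ?_
        rw [Set.inter_indicator_one]
        rfl
    _ = _ := key
    _ = _ := by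
        rw [← lintegral_indicator hs']
        refine lintegral_congr fun ω => ?_
        have : ∫⁻ y, t.indicator (fun _ => 1) y ∂(P (ω n)) = P (ω n) t := lintegral_indicator_one ht
        rw [this]
        by_cases h : frz n ω ∈ s
        · rw [Set.indicator_of_mem h, Set.indicator_of_mem (by exact h), one_mul, Kernel.comap_apply,
            frz_apply le_rfl]
        · rw [Set.indicator_of_notMem h, Set.indicator_of_notMem (by exact h), zero_mul]

lemma markov_lint [IsMarkovKernel P] (hP : IsMarkovChainLaw μ P Pμ) (n : ℕ)
    {F : (ℕ → X) × X → ℝ≥0∞} (hF : Measurable F) (hFz : ∀ ω y, F (frz n ω, y) = F (ω, y)) :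
    ∫⁻ ω, F (ω, ω (n + 1)) ∂Pμ = ∫⁻ ω, ∫⁻ y, F (ω, y) ∂(P (ω n)) ∂Pμ := by
  have := hP.1
  have hfz := measurable_frz (X := X) n
  have hpair : Measurable (fun ω : ℕ → X => (frz n ω, ω (n + 1))) := by fun_prop
  have : IsProbabilityMeasure (Pμ.map (frz n : (ℕ → X) → ℕ → X)) :=
    Measure.isProbabilityMeasure_map hfz.aemeasurable
  calc _ = ∫⁻ ω, F (frz n ω, ω (n + 1)) ∂Pμ := by simp only [hFz]
    _ = ∫⁻ z, F z ∂(Pμ.map (fun ω => (frz n ω, ω (n + 1)))) := by rw [lintegral_map hF hpair]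
    _ = _ := by
      rw [joint_law hP, Measure.lintegral_compProd hF,
        lintegral_map (Measurable.lintegral_kernel_prod_right' hF) hfz]
      simp only [hFz, Kernel.comap_apply, frz_apply le_rfl]

lemma markov_int [IsMarkovKernel P] (hP : IsMarkovChainLaw μ P Pμ) (n : ℕ)
    {E : Type*} [NormedAddCommGroup E] [NormedSpace ℝ E]
    {F : (ℕ → X) × X → E} (hF : StronglyMeasurable F) (hFz : ∀ ω y, F (frz n ω, y) = F (ω, y))
    (hi : Integrable (fun ω => F (ω, ω (n + 1))) Pμ) :
    ∫ ω, F (ω, ω (n + 1)) ∂Pμ = ∫ ω, ∫ y, F (ω, y) ∂(P (ω n)) ∂Pμ := by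
  have := hP.1
  have hfz := measurable_frz (X := X) n
  have hpair : Measurable (fun ω : ℕ → X => (frz n ω, ω (n + 1))) := by fun_prop
  have : IsProbabilityMeasure (Pμ.map (frz n : (ℕ → X) → ℕ → X)) :=
    Measure.isProbabilityMeasure_map hfz.aemeasurable
  have hi' : Integrable F (Pμ.map (fun ω => (frz n ω, ω (n + 1)))) := by
    rw [integrable_map_measure hF.aestronglyMeasurable hpair.aemeasurable]
    refine hi.congr (Eventually.of_forall fun ω => ?_)
    simp [hFz]
  calc _ = ∫ ω, F (frz n ω, ω (n + 1)) ∂Pμ := by simp only [hFz]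
    _ = ∫ z, F z ∂(Pμ.map (fun ω => (frz n ω, ω (n + 1)))) := by
        rw [integral_map hpair.aemeasurable hF.aestronglyMeasurable]
    _ = _ := by
      rw [joint_law hP] at hi' ⊢
      rw [Measure.integral_compProd hi', integral_map hfz.aemeasurable]
      · simp only [hFz, Kernel.comap_apply, frz_apply le_rfl]
      · exact (StronglyMeasurable.integral_kernel_prod_right' hF).aestronglyMeasurable

end paths

namespace DriftC
variable {X : Type*} [MeasurableSpace X] {P : Kernel X X} {K : Set X} {W : X → ℝ} {l b : ℝ}
  {μ : Measure X} {Pμ : Measure (ℕ → X)}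

lemma path_integrable_W (D : DriftC P K W l b) [IsMarkovKernel P] (hP : IsMarkovChainLaw μ P Pμ)
    (hμ : Integrable W μ) (k : ℕ) : Integrable (fun ω => W (ω k)) Pμ := by
  have := hP.1
  have hWm := D.meas
  induction k with
  | zero =>
    have h2 := hP.2.1
    rw [← h2] at hμ
    exact (integrable_map_measure D.meas.aestronglyMeasurable
      (measurable_pi_apply 0).aemeasurable).1 hμ
  | succ k ih =>
    refine ⟨(D.meas.comp (measurable_pi_apply (k+1))).aestronglyMeasurable, ?_⟩
    rw [hasFiniteIntegral_iff_ofReal (Eventually.of_forall fun ω => (D.Wpos _).le)]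
    rw [markov_lint hP k (F := fun z => ENNReal.ofReal (W z.2)) (by fun_prop) (fun _ _ => rfl)]
    have h3 : Integrable (fun ω => l * W (ω k) + b) Pμ := (ih.const_mul l).add (integrable_const b)
    refine lt_of_le_of_lt (lintegral_mono fun ω => ?_) h3.lintegral_lt_top
    refine (D.drift (ω k)).trans (ENNReal.ofReal_le_ofReal ?_)
    have := mul_le_mul_of_nonneg_left (D.KF_le_one (ω k)) D.b0
    rw [mul_one] at this
    exact add_le_add le_rfl this

lemma path_integrable (D : DriftC P K W l b) [IsMarkovKernel P] (hP : IsMarkovChainLaw μ P Pμ)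
    (hμ : Integrable W μ) (k : ℕ) (h : FW W) : Integrable (fun ω => ev W (ω k) h) Pμ := by
  obtain ⟨C, hC0, hC⟩ := D.exists_bound h
  have hm : Measurable (h : X → ℝ) := h.2.1
  refine ((D.path_integrable_W hP hμ k).const_mul C).mono' ?_ (Eventually.of_forall fun ω => hC _)
  exact (hm.comp (measurable_pi_apply k)).aestronglyMeasurable

lemma path_integral (D : DriftC P K W l b) [IsMarkovKernel P] (hP : IsMarkovChainLaw μ P Pμ)
    (hμ : Integrable W μ) (k : ℕ) : ∀ (h : FW W),
    ∫ ω, ev W (ω k) h ∂Pμ = ∫ x, ev W x ((D.T ^ k) h) ∂μ := by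
  induction k with
  | zero =>
    intro h
    have hm : Measurable (h : X → ℝ) := h.2.1
    rw [pow_zero, Module.End.one_apply]
    conv_rhs => rw [← hP.2.1]
    change ∫ ω, (h:X→ℝ) (ω 0) ∂Pμ = ∫ x, (h:X→ℝ) x ∂_
    rw [integral_map (measurable_pi_apply 0).aemeasurable hm.aestronglyMeasurable]
  | succ k ih =>
    intro h
    have hm : Measurable (h : X → ℝ) := h.2.1
    rw [pow_succ, Module.End.mul_apply, ← ih (D.T h)]
    exact markov_int hP k (F := fun z => (h : X → ℝ) z.2)
      (hm.comp measurable_snd).stronglyMeasurable (fun _ _ => rfl)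
      (D.path_integrable hP hμ (k+1) h)

lemma path_W_le (D : DriftC P K W l b) [IsMarkovKernel P] (hP : IsMarkovChainLaw μ P Pμ)
    (hμ : Integrable W μ) (k : ℕ) : ∫ ω, W (ω k) ∂Pμ ≤ D.c2 * ∫ x, W x ∂μ := by
  have h1 := D.path_integral hP hμ k D.Wf
  change ∫ ω, W (ω k) ∂Pμ = _ at h1
  rw [h1, ← integral_const_mul]
  exact integral_mono (integrable_of_FW hμ _) (hμ.const_mul _) (D.TkW_le_c2 k)

/-- conclusion of the ergodic theorem -/
def Erg (D : DriftC P K W l b) (π : Measure X) : Prop :=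
  ∀ τ > 0, ∃ C : ℝ, 0 ≤ C ∧ ∀ h : FW W, (∀ x, |ev W x h| ≤ W x) → ∀ (n : ℕ) x,
      |∑ k ∈ Finset.range n, ev W x ((D.T ^ k) h) - n * ∫ x, (h : X → ℝ) x ∂π|
        ≤ (τ * n + C) * W x

lemma cesaro (D : DriftC P K W l b) [IsMarkovKernel P] (hP : IsMarkovChainLaw μ P Pμ)
    [IsProbabilityMeasure μ]
    (hμ : Integrable W μ) {π : Measure X} (hE : D.Erg π) (h : FW W) :
    Tendsto (fun n : ℕ => (1 / (n:ℝ)) * ∑ k ∈ Finset.range n, ∫ ω, ev W (ω k) h ∂Pμ) atTop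
      (𝓝 (∫ x, (h : X → ℝ) x ∂π)) := by
  obtain ⟨B, hB0, hB⟩ := D.exists_bound h
  set w := ∫ x, W x ∂μ with hw
  have hw0 : 0 ≤ w := integral_nonneg fun x => (D.Wpos x).le
  rw [Metric.tendsto_atTop]
  intro e he
  set B' := B + 1 with hB'
  have hB'0 : 0 < B' := by positivity
  have hbd : ∀ x, |ev W x (B'⁻¹ • h)| ≤ W x := by
    intro x
    rw [map_smul, smul_eq_mul, abs_mul, abs_of_pos (inv_pos.2 hB'0), inv_mul_le_iff₀ hB'0]
    exact (hB x).trans (by have := D.Wpos x; nlinarith)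
  obtain ⟨C, hC0, hC⟩ := hE (e / (2 * (B' * (w + 1)))) (by positivity)
  obtain ⟨N, hN⟩ := exists_nat_gt (C * B' * (w + 1) * 2 / e)
  refine ⟨N + 1, fun n hn => ?_⟩
  have hn0 : (0:ℝ) < n := by exact_mod_cast (by omega : 0 < n)
  have hnN : C * B' * (w + 1) * 2 / e < n := hN.trans (by exact_mod_cast (by omega : N < n))
  set t := e / (2 * (B' * (w + 1))) with ht
  have h1 : ∀ x, |∑ k ∈ Finset.range n, ev W x ((D.T ^ k) h) - n * ∫ x, (h : X → ℝ) x ∂π|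
        ≤ B' * (t * n + C) * W x := by
    intro x
    have := hC _ hbd n x
    have e1 : ∫ x, ((B'⁻¹ • h : FW W) : X → ℝ) x ∂π = B'⁻¹ * ∫ x, (h : X → ℝ) x ∂π :=
      integral_const_mul _ _
    simp only [e1, map_smul, smul_eq_mul, ← Finset.mul_sum] at this
    rw [mul_left_comm, ← mul_sub, abs_mul, abs_of_pos (inv_pos.2 hB'0), inv_mul_le_iff₀ hB'0] at this
    rw [mul_assoc]; exact this
  have h2 : |∑ k ∈ Finset.range n, ∫ ω, ev W (ω k) h ∂Pμ - n * ∫ x, (h : X → ℝ) x ∂π|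
      ≤ B' * (t * n + C) * w := by
    simp only [D.path_integral hP hμ]
    have hI : ∀ k, Integrable (fun x => ev W x ((D.T ^ k) h)) μ := fun k => integrable_of_FW hμ _
    rw [← integral_finsetSum _ fun k _ => hI k]
    have e2 : ∫ x, (∑ k ∈ Finset.range n, ev W x ((D.T ^ k) h)) ∂μ - n * ∫ x, (h : X → ℝ) x ∂π
      = ∫ x, ((∑ k ∈ Finset.range n, ev W x ((D.T ^ k) h)) - n * ∫ x, (h : X → ℝ) x ∂π) ∂μ := by
      rw [integral_sub (integrable_finsetSum _ fun k _ => hI k)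
        (integrable_const _)]
      simp
    rw [e2, hw, ← integral_const_mul (B' * (t * n + C)), ← Real.norm_eq_abs]
    exact norm_integral_le_of_norm_le (hμ.const_mul _) (Eventually.of_forall fun x => h1 x)
  have e3 : (1 / (n:ℝ)) * ∑ k ∈ Finset.range n, ∫ ω, ev W (ω k) h ∂Pμ - ∫ x, (h : X → ℝ) x ∂π
     = (1 / (n:ℝ)) * (∑ k ∈ Finset.range n, ∫ ω, ev W (ω k) h ∂Pμ - n * ∫ x, (h : X → ℝ) x ∂π) := by
    field_simp
  rw [Real.dist_eq, e3, abs_mul, abs_of_pos (by positivity), one_div, inv_mul_lt_iff₀ hn0]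
  refine h2.trans_lt ?_
  rw [div_lt_iff₀ he] at hnN
  have h4 : t * (2 * (B' * (w + 1))) = e := by rw [ht]; field_simp
  have ht0 : 0 < t := by positivity
  have h5 : B' * (t * n + C) * w ≤ B' * (t * n + C) * (w + 1) :=
    mul_le_mul_of_nonneg_left (by linarith) (by positivity)
  have h6 : B' * (t * n + C) * (w + 1) = n * (t * (2 * (B' * (w + 1)))) / 2 + C * B' * (w + 1) := by
    ring
  rw [h4] at h6
  linarith

end DriftC
end

section

lemma sq_sum_le (J : ℕ) : ∀ a : ℕ → ℝ, (∑ j ∈ Finset.range J, a j) ^ 2 ≤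
    ∑ i ∈ Finset.range J, 2 * (a i * ∑ r ∈ Finset.range (J - i), a (i + r)) := by
  induction J with
  | zero => intro a; simp
  | succ J ih =>
    intro a
    have h := ih (fun j => a (j + 1))
    rw [Finset.sum_range_succ' a J, Finset.sum_range_succ' _ J]
    simp only [Nat.add_sub_add_right, Nat.sub_zero, zero_add]
    rw [Finset.sum_range_succ' a J]
    have e : ∀ i r, a (i + r + 1) = a (i + 1 + r) := fun i r => by congr 1; omega
    simp only [e] at h
    nlinarith [sq_nonneg (a 0)]

namespace DriftC
variable {X : Type*} [MeasurableSpace X] {P : Kernel X X} {K : Set X} {W V : X → ℝ} {l b l' b' : ℝ}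
  {μ : Measure X} {Pμ : Measure (ℕ → X)}

lemma sqrt_drift (D : DriftC P K V l b) [IsMarkovKernel P] (hl : 0 < l) :
    DriftC P K (fun x => √(V x)) (√l) (√b) where
  meas := D.meas.sqrt
  one_le x := by rw [Real.one_le_sqrt]; exact D.one_le x
  hK := D.hK
  l0 := Real.sqrt_nonneg _
  l1 := by rw [Real.sqrt_lt' one_pos]; simpa using D.l1
  b0 := Real.sqrt_nonneg _
  drift x := by
    have hk : 0 ≤ b * K.indicator (fun _ => (1:ℝ)) x := mul_nonneg D.b0 (D.KF_nonneg x)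
    have hs0 : 0 < l * V x + b * K.indicator (fun _ => (1:ℝ)) x := by
      have := mul_pos hl (D.Wpos x); linarith
    set q := l * V x + b * K.indicator (fun _ => (1:ℝ)) x with hq
    set s := √q with hs
    have hsp : 0 < s := Real.sqrt_pos.2 hs0
    have hss : s * s = q := Real.mul_self_sqrt hs0.le
    have hpt : ∀ y, √(V y) ≤ (V y / s + s) / 2 := by
      intro y
      have h1 : √(V y) * √(V y) = V y := Real.mul_self_sqrt (D.Wpos y).le
      have h2 : V y / s * s = V y := by field_simp
      have : 0 ≤ (V y / s + s - 2 * √(V y)) * s := by nlinarith [sq_nonneg (√(V y) - s)]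
      have := nonneg_of_mul_nonneg_left this hsp
      linarith
    have hI : Integrable (fun y => (V y / s + s) / 2) (P x) :=
      (((D.integrable_W x).div_const s).add (integrable_const s)).div_const 2
    have hI2 : Integrable (fun y => √(V y)) (P x) :=
      hI.mono' D.meas.sqrt.aestronglyMeasurable (Eventually.of_forall fun y => by
        rw [Real.norm_of_nonneg (Real.sqrt_nonneg _)]; exact hpt y)
    rw [← ofReal_integral_eq_lintegral_ofReal hI2 (Eventually.of_forall fun y => Real.sqrt_nonneg _)]
    apply ENNReal.ofReal_le_ofReal
    have h1 : ∫ y, √(V y) ∂(P x) ≤ s := by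
      refine (integral_mono hI2 hI hpt).trans ?_
      rw [integral_div, integral_add ((D.integrable_W x).div_const s) (integrable_const s),
        integral_div]
      simp only [integral_const, probReal_univ, one_smul]
      have := div_le_div_of_nonneg_right (D.integral_W_le x) hsp.le
      rw [← hq, ← hss] at this
      have e : s * s / s = s := by field_simp
      rw [e] at this
      linarith
    refine h1.trans ?_
    rw [hs, hq]
    by_cases hx : x ∈ K
    · simp only [Set.indicator_of_mem hx, mul_one]
      rw [Real.sqrt_le_left (by positivity)]
      have h1 := Real.mul_self_sqrt (D.Wpos x).le
      have h2 := Real.mul_self_sqrt D.l0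
      have h3 := Real.mul_self_sqrt D.b0
      have h4 : 0 ≤ √l * √(V x) * √b := by positivity
      have h5 : l * V x = (√l * √(V x)) * (√l * √(V x)) := by
        rw [mul_mul_mul_comm, h1, h2]
      nlinarith
    · simp only [Set.indicator_of_notMem hx, mul_zero, add_zero]
      rw [Real.sqrt_mul D.l0]

lemma sqrt_integrable (D : DriftC P K V l b) {ρ : Measure X} (h : Integrable V ρ) :
    Integrable (fun x => √(V x)) ρ := by
  refine h.mono' D.meas.sqrt.aestronglyMeasurable (Eventually.of_forall fun x => ?_)
  rw [Real.norm_of_nonneg (Real.sqrt_nonneg _)]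
  rw [Real.sqrt_le_left (D.Wpos x).le]
  nlinarith [D.one_le x]

lemma erg_scaled (D : DriftC P K W l b) {π : Measure X} (hE : D.Erg π) (h : FW W) :
    ∀ τ > 0, ∃ C : ℝ, 0 ≤ C ∧ ∀ (n : ℕ) x,
      |∑ k ∈ Finset.range n, ev W x ((D.T ^ k) h) - n * ∫ x, (h : X → ℝ) x ∂π|
        ≤ (τ * n + C) * W x := by
  intro τ hτ
  obtain ⟨B, hB0, hB⟩ := D.exists_bound h
  set B' := B + 1 with hB'
  have hB'0 : 0 < B' := by positivity
  have hbd : ∀ x, |ev W x (B'⁻¹ • h)| ≤ W x := by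
    intro x
    rw [map_smul, smul_eq_mul, abs_mul, abs_of_pos (inv_pos.2 hB'0), inv_mul_le_iff₀ hB'0]
    exact (hB x).trans (by have := D.Wpos x; nlinarith)
  obtain ⟨C, hC0, hC⟩ := hE (τ / B') (by positivity)
  refine ⟨B' * C, by positivity, fun n x => ?_⟩
  have := hC _ hbd n x
  have e1 : ∫ x, ((B'⁻¹ • h : FW W) : X → ℝ) x ∂π = B'⁻¹ * ∫ x, (h : X → ℝ) x ∂π :=
    integral_const_mul _ _
  simp only [e1, map_smul, smul_eq_mul, ← Finset.mul_sum] at this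
  rw [mul_left_comm, ← mul_sub, abs_mul, abs_of_pos (inv_pos.2 hB'0), inv_mul_le_iff₀ hB'0] at this
  refine this.trans (le_of_eq ?_)
  field_simp

lemma prod_integrable (D : DriftC P K V l b) (S : DriftC P K (fun x => √(V x)) l' b')
    [IsMarkovKernel P] (hP : IsMarkovChainLaw μ P Pμ) (hμ : Integrable V μ)
    (i j : ℕ) (f h : FW (fun x => √(V x))) :
    Integrable (fun ω => ev _ (ω i) f * ev _ (ω j) h) Pμ := by
  obtain ⟨A, hA0, hA⟩ := S.exists_bound f
  obtain ⟨B, hB0, hB⟩ := S.exists_bound h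
  have hfm : Measurable (f : X → ℝ) := f.2.1
  have hhm : Measurable (h : X → ℝ) := h.2.1
  refine (((D.path_integrable_W hP hμ i).add (D.path_integrable_W hP hμ j)).const_mul (A * B)).mono'
    ((hfm.comp (measurable_pi_apply i)).mul (hhm.comp (measurable_pi_apply j))).aestronglyMeasurable
    (Eventually.of_forall fun ω => ?_)
  have h1 := hA (ω i)
  have h2 := hB (ω j)
  have h3 := Real.mul_self_sqrt (D.Wpos (ω i)).le
  have h4 := Real.mul_self_sqrt (D.Wpos (ω j)).le
  simp only [Pi.add_apply, norm_mul, Real.norm_eq_abs]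
  calc _ ≤ (A * √(V (ω i))) * (B * √(V (ω j))) :=
        mul_le_mul h1 h2 (abs_nonneg _) (by positivity)
    _ = (A * B) * (√(V (ω i)) * √(V (ω j))) := by ring
    _ ≤ _ := mul_le_mul_of_nonneg_left (by
        nlinarith [sq_nonneg (√(V (ω i)) - √(V (ω j))), D.Wpos (ω i), D.Wpos (ω j)]) (by positivity)

lemma cov (D : DriftC P K V l b) (S : DriftC P K (fun x => √(V x)) l' b')
    [IsMarkovKernel P] (hP : IsMarkovChainLaw μ P Pμ) (hμ : Integrable V μ)
    (i r : ℕ) (f : FW (fun x => √(V x))) : ∀ h : FW (fun x => √(V x)),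
    ∫ ω, ev _ (ω i) f * ev _ (ω (i + r)) h ∂Pμ = ∫ ω, ev _ (ω i) f * ev _ (ω i) ((S.T ^ r) h) ∂Pμ := by
  induction r with
  | zero => intro h; rfl
  | succ r ih =>
    intro h
    have hfm : Measurable (f : X → ℝ) := f.2.1
    have hhm : Measurable (h : X → ℝ) := h.2.1
    rw [pow_succ, Module.End.mul_apply, ← ih (S.T h)]
    have := markov_int hP (i + r) (F := fun z => (f : X → ℝ) (z.1 i) * (h : X → ℝ) z.2)
      ((hfm.comp ((measurable_pi_apply i).comp measurable_fst)).mul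
        (hhm.comp measurable_snd)).stronglyMeasurable
      (fun ω y => by simp only [frz_apply (Nat.le_add_right i r)])
      (prod_integrable D S hP hμ i (i + r + 1) f h)
    refine this.trans ?_
    simp only [integral_const_mul]
    rfl

lemma l2_lln (D : DriftC P K V l b) (S : DriftC P K (fun x => √(V x)) l' b')
    [IsMarkovKernel P] (hP : IsMarkovChainLaw μ P Pμ) (hμ : Integrable V μ)
    {π : Measure X} (hE : S.Erg π) (f : FW (fun x => √(V x)))
    (hf : ∫ x, (f : X → ℝ) x ∂π = 0) {τ : ℝ} (hτ : 0 < τ) :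
    ∃ J : ℕ, 1 ≤ J ∧ ∀ i, ∫ ω, ((1 / (J:ℝ)) * ∑ j ∈ Finset.range J, ev _ (ω (i + j)) f) ^ 2 ∂Pμ ≤ τ := by
  obtain ⟨A, hA0, hA⟩ := S.exists_bound f
  set B := D.c2 * ∫ x, V x ∂μ with hB
  have hVi := D.path_integrable_W hP hμ
  have hB0 : 0 ≤ B := mul_nonneg (zero_le_one.trans D.one_le_c2) (integral_nonneg fun x => (D.Wpos x).le)
  have hBi : ∀ i, ∫ ω, V (ω i) ∂Pμ ≤ B := fun i => D.path_W_le hP hμ i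
  set t := τ / (4 * (A + 1) * (B + 1)) with ht
  have ht0 : 0 < t := by positivity
  obtain ⟨C, hC0, hC⟩ := S.erg_scaled hE f t ht0
  rw [hf] at hC
  simp only [mul_zero, sub_zero] at hC
  obtain ⟨N, hN⟩ := exists_nat_gt (4 * (A + 1) * (B + 1) * C / τ)
  refine ⟨N + 1, by omega, fun i0 => ?_⟩
  set J := N + 1 with hJ
  have hJ0 : (0:ℝ) < J := by positivity
  have hJN : 4 * (A + 1) * (B + 1) * C < J * τ := by
    rw [div_lt_iff₀ hτ] at hN
    refine hN.trans (mul_lt_mul_of_pos_right (by exact_mod_cast (by omega)) hτ)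
  have hpi := prod_integrable D S hP hμ
  have key : ∀ i n, n ≤ J → ∫ ω, ev _ (ω i) f * ∑ r ∈ Finset.range n, ev _ (ω (i + r)) f ∂Pμ
      ≤ A * (t * J + C) * B := by
    intro i n hn
    have e1 : ∫ ω, ev _ (ω i) f * ∑ r ∈ Finset.range n, ev _ (ω (i + r)) f ∂Pμ
      = ∫ ω, ev _ (ω i) f * ∑ r ∈ Finset.range n, ev _ (ω i) ((S.T ^ r) f) ∂Pμ := by
      simp only [Finset.mul_sum]
      rw [integral_finsetSum _ fun r _ => hpi _ _ _ _, integral_finsetSum _ fun r _ => hpi _ _ _ _]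
      exact Finset.sum_congr rfl fun r _ => cov D S hP hμ i r f f
    rw [e1]
    have e2 : ∫ ω, ev _ (ω i) f * ∑ r ∈ Finset.range n, ev _ (ω i) ((S.T ^ r) f) ∂Pμ
       ≤ ∫ ω, (A * (t * J + C)) * V (ω i) ∂Pμ := by
      refine integral_mono ?_ ((hVi i).const_mul _) fun ω => ?_
      · simp only [Finset.mul_sum]
        exact integrable_finsetSum _ fun r _ => hpi _ _ _ _
      · have h1 := hA (ω i)
        have h2 := hC n (ω i)
        have h3 := Real.mul_self_sqrt (D.Wpos (ω i)).le
        have hnJ : (n:ℝ) ≤ J := by exact_mod_cast hn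
        refine (le_abs_self _).trans ?_
        rw [abs_mul]
        calc _ ≤ (A * √(V (ω i))) * ((t * n + C) * √(V (ω i))) :=
              mul_le_mul h1 h2 (abs_nonneg _) (by positivity)
          _ = (A * (t * n + C)) * (√(V (ω i)) * √(V (ω i))) := by ring
          _ ≤ _ := by
            rw [h3]
            have := D.Wpos (ω i)
            gcongr
    refine e2.trans ?_
    rw [integral_const_mul]
    exact mul_le_mul_of_nonneg_left (hBi i) (by positivity)
  have hsq : ∫ ω, (∑ j ∈ Finset.range J, ev _ (ω (i0 + j)) f) ^ 2 ∂Pμ ≤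
      ∫ ω, (∑ i ∈ Finset.range J, 2 * (ev _ (ω (i0 + i)) f *
        ∑ r ∈ Finset.range (J - i), ev _ (ω (i0 + i + r)) f)) ∂Pμ := by
    refine integral_mono ?_ ?_ fun ω => ?_
    · simp only [sq, Finset.sum_mul_sum]
      exact integrable_finsetSum _ fun _ _ => integrable_finsetSum _ fun _ _ => hpi _ _ _ _
    · simp only [Finset.mul_sum]
      exact integrable_finsetSum _ fun _ _ => integrable_finsetSum _ fun _ _ =>
        (hpi _ _ _ _).const_mul 2
    · have := sq_sum_le J (fun j => ev _ (ω (i0 + j)) f)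
      simpa only [add_assoc] using this
  have h2 : ∫ ω, (∑ j ∈ Finset.range J, ev _ (ω (i0 + j)) f) ^ 2 ∂Pμ ≤ J * (2 * (A * (t * J + C) * B)) := by
    refine hsq.trans ?_
    rw [integral_finsetSum]
    · refine (Finset.sum_le_card_nsmul _ _ (2 * (A * (t * J + C) * B)) fun i _ => ?_).trans
        (le_of_eq (by simp))
      rw [integral_const_mul]
      exact mul_le_mul_of_nonneg_left (key _ _ (Nat.sub_le _ _)) zero_le_two
    · intro i _
      simp only [Finset.mul_sum]
      exact integrable_finsetSum _ fun _ _ => (hpi _ _ _ _).const_mul 2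
  simp only [mul_pow]
  rw [integral_const_mul]
  have h3 : A * (t * J + C) * B ≤ (A + 1) * (t * J + C) * (B + 1) := by
    gcongr <;> linarith
  have h4 : t * (4 * (A + 1) * (B + 1)) = τ := by rw [ht]; field_simp
  rw [div_pow, one_pow, div_mul_eq_mul_div, one_mul, div_le_iff₀ (by positivity)]
  refine h2.trans ?_
  have h5 : (A + 1) * (t * J + C) * (B + 1) = (J * (t * (4 * (A + 1) * (B + 1))) + 4 * (A + 1) * (B + 1) * C) / 4 := by
    ring
  rw [h4] at h5
  nlinarith

end DriftC
end

section

section smoothing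
variable {Ω : Type*} [MeasurableSpace Ω] {E : Type*} [NormedAddCommGroup E] [NormedSpace ℝ E]

lemma smooth_det (E : Type*) [NormedAddCommGroup E] [NormedSpace ℝ E]
    (a : ℕ → ℝ) (U : ℕ → E) (J n : ℕ) (hJ : 1 ≤ J) :
    ‖∑ l ∈ Finset.range n, a l • U l‖ ≤
      ∑ l ∈ Finset.range n, |(1 / (J:ℝ)) * ∑ j ∈ Finset.range J, a (l + j)| * ‖U l‖
      + ∑ j ∈ Finset.range J, ∑ l ∈ Finset.range n, ∑ r ∈ Finset.range J,
          |a (l + j)| * ‖U (l + r + 1) - U (l + r)‖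
      + ∑ k ∈ Finset.range J, (|a (n + k)| * ‖U (n + k)‖ + |a k| * ‖U k‖) := by
  set S := ∑ l ∈ Finset.range n, a l • U l with hS
  set Bd := ∑ k ∈ Finset.range J, (|a (n + k)| * ‖U (n + k)‖ + |a k| * ‖U k‖) with hBd
  set I2 := ∑ j ∈ Finset.range J, ∑ l ∈ Finset.range n, ∑ r ∈ Finset.range J,
          |a (l + j)| * ‖U (l + r + 1) - U (l + r)‖ with hI2
  set I1 := ∑ l ∈ Finset.range n, |(1 / (J:ℝ)) * ∑ j ∈ Finset.range J, a (l + j)| * ‖U l‖ with hI1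
  have hJ0 : (0:ℝ) < J := by exact_mod_cast hJ
  have hJ1 : (1:ℝ) ≤ J := by exact_mod_cast hJ
  have hI20 : 0 ≤ I2 := by positivity
  have b1 : ∀ j ∈ Finset.range J, ‖S - ∑ l ∈ Finset.range n, a (l + j) • U (l + j)‖ ≤ Bd := by
    intro j hj
    rw [Finset.mem_range] at hj
    rw [norm_sub_rev, shift_sum (fun l => a l • U l) n j]
    refine (norm_sub_le _ _).trans ?_
    refine (add_le_add (norm_sum_le _ _) (norm_sum_le _ _)).trans ?_
    rw [← Finset.sum_add_distrib]
    simp only [norm_smul, Real.norm_eq_abs]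
    exact Finset.sum_le_sum_of_subset_of_nonneg (Finset.range_mono hj.le)
      (fun _ _ _ => by positivity)
  have b2 : ∀ j ∈ Finset.range J, ‖∑ l ∈ Finset.range n, a (l + j) • U (l + j)
      - ∑ l ∈ Finset.range n, a (l + j) • U l‖ ≤ ∑ l ∈ Finset.range n, ∑ r ∈ Finset.range J,
          |a (l + j)| * ‖U (l + r + 1) - U (l + r)‖ := by
    intro j hj
    rw [Finset.mem_range] at hj
    rw [← Finset.sum_sub_distrib]
    refine (norm_sum_le _ _).trans (Finset.sum_le_sum fun l _ => ?_)
    rw [← smul_sub, norm_smul, Real.norm_eq_abs, ← Finset.mul_sum]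
    refine mul_le_mul_of_nonneg_left ?_ (abs_nonneg _)
    have e : U (l + j) - U l = ∑ r ∈ Finset.range j, (U (l + r + 1) - U (l + r)) := by
      have := Finset.sum_range_sub (fun r => U (l + r)) j
      simp only [add_zero] at this
      rw [← this]; rfl
    rw [e]
    exact (norm_sum_le _ _).trans (Finset.sum_le_sum_of_subset_of_nonneg (Finset.range_mono hj.le)
      (fun _ _ _ => by positivity))
  have b3 : ‖∑ j ∈ Finset.range J, ∑ l ∈ Finset.range n, a (l + j) • U l‖ ≤ J * I1 := by
    rw [Finset.sum_comm, hI1, Finset.mul_sum]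
    refine (norm_sum_le _ _).trans (Finset.sum_le_sum fun l _ => le_of_eq ?_)
    rw [← Finset.sum_smul, norm_smul, abs_mul, abs_of_pos (by positivity : 0 < 1 / (J:ℝ)),
      Real.norm_eq_abs]
    field_simp
  have e : (J:ℝ) • S = ∑ j ∈ Finset.range J, (S - ∑ l ∈ Finset.range n, a (l + j) • U (l + j))
    + ∑ j ∈ Finset.range J, (∑ l ∈ Finset.range n, a (l + j) • U (l + j)
      - ∑ l ∈ Finset.range n, a (l + j) • U l)
    + ∑ j ∈ Finset.range J, ∑ l ∈ Finset.range n, a (l + j) • U l := by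
    rw [← Finset.sum_add_distrib, ← Finset.sum_add_distrib]
    simp [Nat.cast_smul_eq_nsmul]
  have h1 : J * ‖S‖ ≤ J * Bd + I2 + J * I1 := by
    have : J * ‖S‖ = ‖(J:ℝ) • S‖ := by rw [norm_smul, Real.norm_of_nonneg hJ0.le]
    rw [this, e]
    refine (norm_add_le _ _).trans (add_le_add ((norm_add_le _ _).trans (add_le_add ?_ ?_)) b3)
    · refine (norm_sum_le _ _).trans ((Finset.sum_le_sum b1).trans ?_)
      simp
    · exact (norm_sum_le _ _).trans (Finset.sum_le_sum b2)
  have h2 : J * ‖S‖ ≤ J * (I1 + I2 + Bd) := by nlinarith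
  exact le_of_mul_le_mul_left h2 hJ0

lemma amgm {m : Measure Ω} {a : Ω → ℝ} {u : Ω → E} (ha : MemLp a 2 m) (hu : MemLp u 2 m)
    {A C t : ℝ} (hA : ∫ ω, a ω ^ 2 ∂m ≤ A) (hC : ∫ ω, ‖u ω‖ ^ 2 ∂m ≤ C) (ht : 0 < t) :
    Integrable (fun ω => |a ω| * ‖u ω‖) m ∧ ∫ ω, |a ω| * ‖u ω‖ ∂m ≤ (A / t + t * C) / 2 := by
  have hi : Integrable (fun ω => |a ω| * ‖u ω‖) m := ha.norm.integrable_mul hu.norm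
  refine ⟨hi, ?_⟩
  have h1 : Integrable (fun ω => a ω ^ 2) m := ha.integrable_sq
  have h2 : Integrable (fun ω => ‖u ω‖ ^ 2) m := hu.norm.integrable_sq
  have h3 : ∫ ω, |a ω| * ‖u ω‖ ∂m ≤ ∫ ω, (a ω ^ 2 / t + t * ‖u ω‖ ^ 2) / 2 ∂m := by
    refine integral_mono hi (((h1.div_const t).add (h2.const_mul t)).div_const 2) fun ω => ?_
    have e : (a ω ^ 2 / t + t * ‖u ω‖ ^ 2) / 2 - |a ω| * ‖u ω‖ = (|a ω| - t * ‖u ω‖) ^ 2 / (2 * t) := by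
      rw [← sq_abs (a ω)]; field_simp; ring
    have : 0 ≤ (|a ω| - t * ‖u ω‖) ^ 2 / (2 * t) := by positivity
    change |a ω| * ‖u ω‖ ≤ (a ω ^ 2 / t + t * ‖u ω‖ ^ 2) / 2
    linarith
  refine h3.trans ?_
  rw [integral_div, integral_add (h1.div_const t) (h2.const_mul t), integral_div, integral_const_mul]
  have := div_le_div_of_nonneg_right hA ht.le
  have := mul_le_mul_of_nonneg_left hC ht.le
  linarith

theorem smoothing {m : Measure Ω} {a : ℕ → Ω → ℝ} {U : ℕ → ℕ → Ω → E} {B C : ℝ}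
    (ha : ∀ l, MemLp (a l) 2 m) (haB : ∀ l, ∫ ω, a l ω ^ 2 ∂m ≤ B)
    (hU : ∀ n l, MemLp (U n l) 2 m) (hUC : ∀ n l, ∫ ω, ‖U n l ω‖ ^ 2 ∂m ≤ C)
    (hUi : ∀ n l, 0 < n → ∫ ω, ‖U n (l + 1) ω - U n l ω‖ ^ 2 ∂m ≤ C / n)
    (hav : ∀ τ > 0, ∃ J : ℕ, 1 ≤ J ∧ ∀ i,
      ∫ ω, ((1 / (J:ℝ)) * ∑ j ∈ Finset.range J, a (i + j) ω) ^ 2 ∂m ≤ τ) :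
    Tendsto (fun n : ℕ => ∫ ω, ‖(1 / (n:ℝ)) • ∑ l ∈ Finset.range n, a l ω • U n l ω‖ ∂m) atTop (𝓝 0) := by
  have hB0 : 0 ≤ B := (integral_nonneg fun ω => sq_nonneg (a 0 ω)).trans (haB 0)
  have hC0 : 0 ≤ C := (integral_nonneg fun ω => sq_nonneg _).trans (hUC 0 0)
  have key : ∀ t > 0, ∃ J : ℕ, ∀ n : ℕ, 0 < n →
      ∫ ω, ‖(1 / (n:ℝ)) • ∑ l ∈ Finset.range n, a l ω • U n l ω‖ ∂m ≤
        t * (1 + C) / 2 + (J ^ 2 * ((B + C) / 2)) / √n + (J * (B + C)) / n := by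
    intro t ht
    obtain ⟨J, hJ, hJt⟩ := hav (t ^ 2) (by positivity)
    refine ⟨J, fun n hn => ?_⟩
    have hn0 : (0:ℝ) < n := by exact_mod_cast hn
    have hsn : 0 < √(n:ℝ) := Real.sqrt_pos.2 hn0
    have hss : √(n:ℝ) * √(n:ℝ) = n := Real.mul_self_sqrt hn0.le
    have hA : ∀ l, MemLp (fun ω => (1 / (J:ℝ)) * ∑ j ∈ Finset.range J, a (l + j) ω) 2 m := fun l =>
      (memLp_finsetSum _ fun j _ => ha (l + j)).const_mul _
    have p1 := fun l => amgm (hA l) (hU n l) (hJt l) (hUC n l) ht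
    have p2 := fun l j r => amgm (ha (l + j)) ((hU n (l + r + 1)).sub (hU n (l + r))) (haB _)
      (hUi n (l + r) hn) hsn
    have p3 := fun k => amgm (ha k) (hU n k) (haB _) (hUC n k) one_pos
    simp only [Pi.sub_apply] at p2
    have i1 := integrable_finsetSum (Finset.range n) fun l _ => (p1 l).1
    have i2 := integrable_finsetSum (Finset.range J) fun j _ =>
      integrable_finsetSum (Finset.range n) fun l _ => integrable_finsetSum (Finset.range J) fun r _ =>
      (p2 l j r).1
    have i3 := integrable_finsetSum (Finset.range J) fun k _ => ((p3 (n + k)).1).add ((p3 k).1)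
    have hle : ∫ ω, ‖∑ l ∈ Finset.range n, a l ω • U n l ω‖ ∂m ≤
        n * (t * (1 + C) / 2) + J * (n * (J * ((B + C) / 2 / √n))) + J * (B + C) := by
      refine (integral_mono_of_nonneg (Eventually.of_forall fun _ => norm_nonneg _) ((i1.add i2).add i3)
        (Eventually.of_forall fun ω => smooth_det E (fun l => a l ω) (fun l => U n l ω) J n hJ)).trans ?_
      rw [integral_add' (i1.add i2) i3, integral_add' i1 i2]
      refine add_le_add (add_le_add ?_ ?_) ?_
      · rw [integral_finsetSum _ fun l _ => (p1 l).1]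
        refine (Finset.sum_le_card_nsmul _ _ (t * (1 + C) / 2) fun l _ => (p1 l).2.trans
          (le_of_eq ?_)).trans (le_of_eq (by simp))
        field_simp
      · rw [integral_finsetSum _ fun j _ => integrable_finsetSum (Finset.range n) fun l _ =>
          integrable_finsetSum (Finset.range J) fun r _ => (p2 l j r).1]
        refine (Finset.sum_le_card_nsmul _ _ (n * (J * ((B + C) / 2 / √n))) fun j _ => ?_).trans
          (le_of_eq (by simp))
        rw [integral_finsetSum _ fun l _ =>
          integrable_finsetSum (Finset.range J) fun r _ => (p2 l j r).1]
        refine (Finset.sum_le_card_nsmul _ _ (J * ((B + C) / 2 / √n)) fun l _ => ?_).trans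
          (le_of_eq (by simp))
        rw [integral_finsetSum _ fun r _ => (p2 l j r).1]
        refine (Finset.sum_le_card_nsmul _ _ ((B + C) / 2 / √n) fun r _ => ?_).trans
          (le_of_eq (by simp))
        refine (p2 l j r).2.trans (le_of_eq ?_)
        have hc : √(n:ℝ) * (C / n) = C / √n := by
          rw [mul_div_assoc', div_eq_div_iff hn0.ne' hsn.ne']
          calc √(n:ℝ) * C * √n = C * (√n * √n) := by ring
            _ = _ := by rw [hss]
        rw [hc]; ring
      · rw [integral_finsetSum _ fun k _ => ((p3 (n + k)).1).add ((p3 k).1)]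
        refine (Finset.sum_le_card_nsmul _ _ (B + C) fun k _ => ?_).trans
          (le_of_eq (by rw [Finset.card_range, nsmul_eq_mul]))
        rw [integral_add' (p3 (n + k)).1 (p3 k).1]
        have := (p3 (n + k)).2
        have := (p3 k).2
        linarith
    simp only [norm_smul]
    rw [integral_const_mul, Real.norm_of_nonneg (by positivity), one_div, inv_mul_le_iff₀ hn0]
    refine hle.trans (le_of_eq ?_)
    field_simp
  rw [Metric.tendsto_atTop]
  intro e he
  obtain ⟨J, hJ⟩ := key (e / (2 * (1 + C))) (by positivity)
  have l1 : Tendsto (fun n : ℕ => (J ^ 2 * ((B + C) / 2)) / √(n:ℝ)) atTop (𝓝 0) :=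
    tendsto_const_nhds.div_atTop (Real.tendsto_sqrt_atTop.comp tendsto_natCast_atTop_atTop)
  have l2 : Tendsto (fun n : ℕ => (J * (B + C)) / (n:ℝ)) atTop (𝓝 0) :=
    tendsto_const_nhds.div_atTop tendsto_natCast_atTop_atTop
  obtain ⟨N, hN⟩ := (((l1.add l2).eventually_lt_const (by rw [add_zero]; positivity : (0:ℝ) + 0 < e / 2)).and
    (eventually_gt_atTop 0)).exists_forall_of_atTop
  refine ⟨N, fun n hn => ?_⟩
  rw [Real.dist_eq, sub_zero, abs_of_nonneg (integral_nonneg fun _ => norm_nonneg _)]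
  have h1 := hJ n (hN n hn).2
  have h2 := (hN n hn).1
  have h3 : e / (2 * (1 + C)) * (1 + C) / 2 < e / 2 := by
    rw [div_mul_eq_mul_div, div_div, div_lt_div_iff₀ (by positivity) two_pos]
    nlinarith [mul_pos he (by positivity : 0 < 1 + C)]
  linarith

end smoothing
end

section

/-- the standing assumptions on the chain -/
structure Env {X : Type*} [MeasurableSpace X] (P : Kernel X X) (K : Set X) (V : X → ℝ)
    (l b l' b' : ℝ) (μ π : Measure X) (Pμ : Measure (ℕ → X)) : Prop where
  D : DriftC P K V l b
  S : DriftC P K (fun x => √(V x)) l' b'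
  hP : IsMarkovChainLaw μ P Pμ
  hμ : Integrable V μ
  hπ : Integrable V π
  ED : D.Erg π
  ES : S.Erg π

namespace Env
open DriftC
variable {X : Type*} [MeasurableSpace X] {P : Kernel X X} {K : Set X} {V : X → ℝ} {l b l' b' : ℝ}
  {μ π : Measure X} {Pμ : Measure (ℕ → X)} [IsMarkovKernel P] [IsProbabilityMeasure μ]
  [IsProbabilityMeasure π] {E : Type*} [NormedAddCommGroup E] [NormedSpace ℝ E]

lemma memLp (e : Env P K V l b l' b' μ π Pμ) (f : FW (fun x => √(V x))) (k : ℕ) :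
    MemLp (fun ω => ev _ (ω k) f) 2 Pμ := by
  have hfm : Measurable (f : X → ℝ) := f.2.1
  rw [memLp_two_iff_integrable_sq]
  · simp only [sq]
    exact prod_integrable e.D e.S e.hP e.hμ k k f f
  · exact (hfm.comp (measurable_pi_apply k)).aestronglyMeasurable

lemma sq_le (e : Env P K V l b l' b' μ π Pμ) (f : FW (fun x => √(V x))) :
    ∃ B, ∀ k, ∫ ω, (ev _ (ω k) f) ^ 2 ∂Pμ ≤ B := by
  obtain ⟨A, hA0, hA⟩ := e.S.exists_bound f
  refine ⟨A ^ 2 * (e.D.c2 * ∫ x, V x ∂μ), fun k => ?_⟩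
  refine (integral_mono (e.memLp f k).integrable_sq
    ((e.D.path_integrable_W e.hP e.hμ k).const_mul (A ^ 2)) fun ω => ?_).trans ?_
  · have h1 := hA (ω k)
    have h3 := Real.sq_sqrt (e.D.Wpos (ω k)).le
    change (ev _ (ω k) f) ^ 2 ≤ A ^ 2 * V (ω k)
    rw [← h3, ← mul_pow, ← sq_abs]
    exact pow_le_pow_left₀ (abs_nonneg _) h1 2
  · rw [integral_const_mul]
    exact mul_le_mul_of_nonneg_left (e.D.path_W_le e.hP e.hμ k) (by positivity)

lemma smooth (e : Env P K V l b l' b' μ π Pμ) (f : FW (fun x => √(V x)))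
    (hf : ∫ x, (f : X → ℝ) x ∂π = 0) {U : ℕ → ℕ → (ℕ → X) → E} {C : ℝ}
    (hU : ∀ n l, MemLp (U n l) 2 Pμ) (hUC : ∀ n l, ∫ ω, ‖U n l ω‖ ^ 2 ∂Pμ ≤ C)
    (hUi : ∀ n l, 0 < n → ∫ ω, ‖U n (l + 1) ω - U n l ω‖ ^ 2 ∂Pμ ≤ C / n) :
    Tendsto (fun n : ℕ => ∫ ω, ‖(1 / (n:ℝ)) • ∑ l ∈ Finset.range n, ev _ (ω l) f • U n l ω‖ ∂Pμ)
      atTop (𝓝 0) := by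
  change Tendsto (fun n : ℕ => ∫ ω, ‖(1 / (n:ℝ)) • ∑ l ∈ Finset.range n,
    ((fun (l : ℕ) (ω : ℕ → X) => ev (fun x => √(V x)) (ω l) f) l ω) • U n l ω‖ ∂Pμ) atTop (𝓝 0)
  obtain ⟨B, hB⟩ := e.sq_le f
  have hm : ∀ l, MemLp ((fun (l : ℕ) (ω : ℕ → X) => ev _ (ω l) f) l) 2 Pμ := fun l => e.memLp f l
  have hl : ∀ τ > 0, ∃ J : ℕ, 1 ≤ J ∧ ∀ i, ∫ ω, ((1 / (J:ℝ)) * ∑ j ∈ Finset.range J,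
      (fun (l : ℕ) (ω : ℕ → X) => ev _ (ω l) f) (i + j) ω) ^ 2 ∂Pμ ≤ τ :=
    fun τ hτ => l2_lln e.D e.S e.hP e.hμ e.ES f hf hτ
  have hB' : ∀ l, ∫ ω, (fun (l : ℕ) (ω : ℕ → X) => ev _ (ω l) f) l ω ^ 2 ∂Pμ ≤ B := hB
  generalize (fun (l : ℕ) (ω : ℕ → X) => ev (fun x => √(V x)) (ω l) f) = a at hm hl hB'
  exact smoothing hm hB' hU hUC hUi hl

lemma trunc (e : Env P K V l b l' b' μ π Pμ) (g : FW V) {η : ℝ} (hη : 0 < η) :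
    ∃ c : ℕ, ∫ x, {x | (c:ℝ) < V x}.indicator (fun x => |(g : X → ℝ) x|) x ∂π < η := by
  have hVm := e.D.meas
  have hgm : Measurable (g : X → ℝ) := g.2.1
  have hgi : Integrable (g : X → ℝ) π := integrable_of_FW e.hπ g
  have : Tendsto (fun c : ℕ => ∫ x, {x | (c:ℝ) < V x}.indicator (fun x => |(g : X → ℝ) x|) x ∂π)
      atTop (𝓝 (∫ x, 0 ∂π)) := by
    refine tendsto_integral_of_dominated_convergence (fun x => |(g : X → ℝ) x|) (fun c => ?_)
      hgi.abs (fun c => ?_) ?_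
    · exact (hgm.abs.indicator (measurableSet_lt measurable_const hVm)).aestronglyMeasurable
    · refine Eventually.of_forall fun x => ?_
      rw [Real.norm_of_nonneg (Set.indicator_nonneg (fun _ _ => abs_nonneg _) _)]
      exact Set.indicator_le_self' (fun _ _ => abs_nonneg _) _
    · refine Eventually.of_forall fun x => ?_
      refine tendsto_const_nhds.congr' ?_
      obtain ⟨N, hN⟩ := exists_nat_gt (V x)
      filter_upwards [eventually_ge_atTop N] with c hc
      rw [Set.indicator_of_notMem]
      simp only [Set.mem_ofPred_eq, not_lt]
      exact hN.le.trans (by exact_mod_cast hc)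
  rw [integral_zero] at this
  exact (this.eventually_lt_const hη).exists

lemma smoothV (e : Env P K V l b l' b' μ π Pμ) (g : FW V)
    (hg : ∫ x, (g : X → ℝ) x ∂π = 0) {U : ℕ → ℕ → (ℕ → X) → E} {C u : ℝ}
    (hU : ∀ n l, AEStronglyMeasurable (U n l) Pμ) (hUb : ∀ n l ω, ‖U n l ω‖ ≤ u)
    (hUi : ∀ n l, 0 < n → ∫ ω, ‖U n (l + 1) ω - U n l ω‖ ^ 2 ∂Pμ ≤ C / n) :
    Tendsto (fun n : ℕ => ∫ ω, ‖(1 / (n:ℝ)) • ∑ l ∈ Finset.range n, ev V (ω l) g • U n l ω‖ ∂Pμ)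
      atTop (𝓝 0) := by
  have := e.hP.1
  have hne : Nonempty (ℕ → X) := Pμ.nonempty_of_neZero
  have hu0 : 0 ≤ u := (norm_nonneg _).trans (hUb 0 0 hne.some)
  have hVm := e.D.meas
  have hgm : Measurable (g : X → ℝ) := g.2.1
  have hgi : Integrable (g : X → ℝ) π := integrable_of_FW e.hπ g
  obtain ⟨B, hB0, hB⟩ := e.D.exists_bound g
  rw [Metric.tendsto_atTop]
  intro ε hε
  obtain ⟨c, hc⟩ := e.trunc g (η := ε / (4 * (u + 1))) (by positivity)
  have hms : MeasurableSet {x | (c:ℝ) < V x} := measurableSet_lt measurable_const hVm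
  -- large part
  let H : FW V := ⟨{x | (c:ℝ) < V x}.indicator (fun x => |(g : X → ℝ) x|),
    hgm.abs.indicator hms, B, fun x => by
      rw [abs_of_nonneg (Set.indicator_nonneg (fun _ _ => abs_nonneg _) _)]
      exact (Set.indicator_le_self' (fun _ _ => abs_nonneg _) _).trans (hB x)⟩
  set h0 := ∫ x, (H : X → ℝ) x ∂π with hh0
  have hH0 : ∀ x, 0 ≤ (H : X → ℝ) x := fun x => Set.indicator_nonneg (fun _ _ => abs_nonneg _) _
  -- truncated part
  let g1 : X → ℝ := {x | (c:ℝ) < V x}ᶜ.indicator (g : X → ℝ)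
  have hg1m : Measurable g1 := hgm.indicator hms.compl
  have hg1 : ∀ x, |(g : X → ℝ) x - g1 x| = (H : X → ℝ) x := by
    intro x
    by_cases hx : x ∈ {x | (c:ℝ) < V x}
    · simp only [g1, H, Set.indicator_of_mem hx, Set.indicator_of_notMem (Set.notMem_compl_iff.2 hx), sub_zero]
    · simp only [g1, H, Set.indicator_of_notMem hx, Set.indicator_of_mem (Set.mem_compl hx), sub_self, abs_zero]
  have hg1i : Integrable g1 π := hgi.indicator hms.compl
  set m1 := ∫ x, g1 x ∂π with hm1
  have hm1le : |m1| ≤ h0 := by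
    have : m1 = - ∫ x, ((g : X → ℝ) x - g1 x) ∂π := by
      rw [integral_sub hgi hg1i, hg]; ring
    rw [this, abs_neg, ← Real.norm_eq_abs]
    exact norm_integral_le_of_norm_le (integrable_of_FW e.hπ H)
      (Eventually.of_forall fun x => (hg1 x).le)
  have hg1b : ∀ x, |g1 x| ≤ B * c := by
    intro x
    by_cases hx : x ∈ {x | (c:ℝ) < V x}
    · simp only [g1, Set.indicator_of_notMem (Set.notMem_compl_iff.2 hx), abs_zero]; positivity
    · simp only [g1, Set.indicator_of_mem (Set.mem_compl hx)]
      refine (hB x).trans (mul_le_mul_of_nonneg_left ?_ hB0)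
      simpa using hx
  let g' : FW (fun x => √(V x)) := ⟨fun x => g1 x - m1, hg1m.sub_const _, B * c + |m1|, fun x => by
    have h1 : |g1 x - m1| ≤ B * c + |m1| := (abs_sub _ _).trans (by have := hg1b x; linarith)
    refine h1.trans (le_mul_of_one_le_right (by positivity) (e.S.one_le x))⟩
  have hg'0 : ∫ x, (g' : X → ℝ) x ∂π = 0 := by
    change ∫ x, (g1 x - m1) ∂π = 0
    rw [integral_sub hg1i (integrable_const _)]
    simp [hm1]
  have hsm : ∀ n l, ∫ ω, ‖U n l ω‖ ^ 2 ∂Pμ ≤ |C| + u ^ 2 := by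
    intro n l
    calc ∫ ω, ‖U n l ω‖ ^ 2 ∂Pμ ≤ ∫ ω, u ^ 2 ∂Pμ :=
          integral_mono_of_nonneg (Eventually.of_forall fun _ => by positivity) (integrable_const _)
            (Eventually.of_forall fun ω => pow_le_pow_left₀ (norm_nonneg _) (hUb n l ω) 2)
      _ = u ^ 2 := by simp
      _ ≤ _ := by have := abs_nonneg C; linarith
  have lim1 := e.smooth g' hg'0 (U := U) (C := |C| + u ^ 2)
    (fun n l => MemLp.of_bound (hU n l) u (Eventually.of_forall (hUb n l))) hsm
    (fun n l hn => (hUi n l hn).trans (div_le_div_of_nonneg_right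
      (by nlinarith [le_abs_self C]) (Nat.cast_nonneg n)))
  have lim2 := e.D.cesaro e.hP e.hμ e.ED H
  have hh0lt : h0 < ε / (4 * (u + 1)) := hc
  have hh00 : 0 ≤ h0 := integral_nonneg hH0
  obtain ⟨N, hN⟩ := ((lim1.eventually_lt_const (half_pos hε)).and
    ((lim2.eventually_lt_const hh0lt).and (eventually_gt_atTop 0))).exists_forall_of_atTop
  refine ⟨N, fun n hn => ?_⟩
  obtain ⟨a1, a2, a3⟩ := hN n hn
  have hn0 : (0:ℝ) < n := by exact_mod_cast a3
  rw [Real.dist_eq, sub_zero, abs_of_nonneg (integral_nonneg fun _ => norm_nonneg _)]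
  have hi1 : ∀ l, Integrable (fun ω => ev _ (ω l) g' • U n l ω) Pμ := by
    intro l
    refine (((e.memLp g' l).integrable one_le_two).norm.mul_const u).mono'
      ((e.memLp g' l).aestronglyMeasurable.smul (hU n l)) (Eventually.of_forall fun ω => ?_)
    rw [norm_smul]
    exact mul_le_mul_of_nonneg_left (hUb n l ω) (norm_nonneg _)
  have I1 : Integrable (fun ω => ‖(1 / (n:ℝ)) • ∑ l ∈ Finset.range n, ev _ (ω l) g' • U n l ω‖) Pμ :=
    ((integrable_finsetSum _ fun l _ => hi1 l).smul (1 / (n:ℝ))).norm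
  have iH : ∀ l, Integrable (fun ω => ev V (ω l) H) Pμ := fun l => e.D.path_integrable e.hP e.hμ l H
  have I2 : Integrable (fun ω => u * ((1 / (n:ℝ)) * ∑ l ∈ Finset.range n, ev V (ω l) H + h0)) Pμ :=
    (((integrable_finsetSum _ fun l _ => iH l).const_mul _).add (integrable_const _)).const_mul _
  have hpt : ∀ ω, ‖(1 / (n:ℝ)) • ∑ l ∈ Finset.range n, ev V (ω l) g • U n l ω‖ ≤
      ‖(1 / (n:ℝ)) • ∑ l ∈ Finset.range n, ev _ (ω l) g' • U n l ω‖ +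
      u * ((1 / (n:ℝ)) * ∑ l ∈ Finset.range n, ev V (ω l) H + h0) := by
    intro ω
    rw [← sub_le_iff_le_add']
    refine (norm_sub_norm_le _ _).trans ?_
    rw [← smul_sub, ← Finset.sum_sub_distrib, norm_smul, Real.norm_of_nonneg (by positivity)]
    have : ‖∑ l ∈ Finset.range n, (ev V (ω l) g • U n l ω - ev _ (ω l) g' • U n l ω)‖ ≤
        ∑ l ∈ Finset.range n, (ev V (ω l) H + h0) * u := by
      refine (norm_sum_le _ _).trans (Finset.sum_le_sum fun l _ => ?_)
      rw [← sub_smul, norm_smul]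
      refine mul_le_mul ?_ (hUb n l ω) (norm_nonneg _) (add_nonneg (hH0 _) hh00)
      change |(g : X → ℝ) (ω l) - (g1 (ω l) - m1)| ≤ (H : X → ℝ) (ω l) + h0
      rw [← hg1 (ω l), sub_sub_eq_add_sub, add_sub_right_comm]
      exact (abs_add_le _ _).trans (add_le_add le_rfl hm1le)
    refine (mul_le_mul_of_nonneg_left this (by positivity)).trans (le_of_eq ?_)
    rw [← Finset.sum_mul, Finset.sum_add_distrib]
    simp only [Finset.sum_const, Finset.card_range, nsmul_eq_mul]
    field_simp
  refine (integral_mono_of_nonneg (Eventually.of_forall fun _ => norm_nonneg _) (I1.add I2)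
    (Eventually.of_forall hpt)).trans_lt ?_
  rw [integral_add' I1 I2, integral_const_mul, integral_add
    ((integrable_finsetSum _ fun l _ => iH l).const_mul _) (integrable_const _), integral_const_mul,
    integral_finsetSum _ fun l _ => iH l]
  simp only [integral_const, probReal_univ, one_smul]
  have h4 : u * (1 / (n:ℝ) * ∑ l ∈ Finset.range n, ∫ ω, ev V (ω l) H ∂Pμ + h0)
      ≤ (u + 1) * (ε / (4 * (u + 1)) + ε / (4 * (u + 1))) := by
    refine mul_le_mul (by linarith) (by linarith) ?_ (by positivity)
    refine add_nonneg (mul_nonneg (by positivity) (Finset.sum_nonneg fun l _ =>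
      integral_nonneg fun ω => hH0 _)) hh00
  have h5 : (u + 1) * (ε / (4 * (u + 1)) + ε / (4 * (u + 1))) = ε / 2 := by field_simp; norm_num
  linarith

end Env
end

section

/-- martingale-difference kernel with `V`-bounded conditional variance -/
structure Xi {X : Type*} [MeasurableSpace X] (P : Kernel X X) (V : X → ℝ) (ξ : X → X → ℝ)
    (c : ℝ) : Prop where
  meas : Measurable (Function.uncurry ξ)
  c0 : 0 ≤ c
  sq : ∀ x, ∫⁻ y, ENNReal.ofReal (ξ x y ^ 2) ∂(P x) ≤ ENNReal.ofReal (c * V x)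
  zero : ∀ x, ∫ y, ξ x y ∂(P x) = 0

namespace Xi
open DriftC
variable {X : Type*} [MeasurableSpace X] {P : Kernel X X} {K : Set X} {V : X → ℝ} {l b l' b' : ℝ}
  {μ π : Measure X} {Pμ : Measure (ℕ → X)} [IsMarkovKernel P] [IsProbabilityMeasure μ]
  [IsProbabilityMeasure π] {E : Type*} [NormedAddCommGroup E] [NormedSpace ℝ E]
  {ξ : X → X → ℝ} {c : ℝ}

lemma cond (hP : IsMarkovChainLaw μ P Pμ) (n : ℕ) {q : X → X → ℝ}
    (hq : Measurable (Function.uncurry q)) {Z : (ℕ → X) → E} (hZ : StronglyMeasurable Z) [CompleteSpace E]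
    (hZz : ∀ ω, Z (frz n ω) = Z ω)
    (hi : Integrable (fun ω => q (ω n) (ω (n + 1)) • Z ω) Pμ) :
    ∫ ω, q (ω n) (ω (n + 1)) • Z ω ∂Pμ = ∫ ω, (∫ y, q (ω n) y ∂(P (ω n))) • Z ω ∂Pμ := by
  have h := markov_int hP n (F := fun z => q (z.1 n) z.2 • Z z.1)
    ((hq.comp (((measurable_pi_apply n).comp measurable_fst).prodMk
      measurable_snd)).stronglyMeasurable.smul (hZ.comp_measurable measurable_fst))
    (fun ω y => by simp only [hZz, frz_apply le_rfl]) hi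
  refine h.trans ?_
  simp only [integral_smul_const]

lemma meas_x (h : Measurable (Function.uncurry ξ)) (x : X) : Measurable (ξ x) :=
  h.comp measurable_prodMk_left

lemma meas_path {q : X → X → ℝ} (h : Measurable (Function.uncurry q)) (k : ℕ) :
    Measurable (fun ω : ℕ → X => q (ω k) (ω (k + 1))) :=
  Measurable.comp (f := fun ω : ℕ → X => (ω k, ω (k + 1))) h ((measurable_pi_apply k).prodMk (measurable_pi_apply (k + 1)))

lemma integrable_sq_x (x0 : Xi P V ξ c) (x : X) : Integrable (fun y => ξ x y ^ 2) (P x) := by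
  refine ⟨((meas_x x0.meas x).pow_const 2).aestronglyMeasurable, ?_⟩
  rw [hasFiniteIntegral_iff_ofReal (Eventually.of_forall fun y => sq_nonneg _)]
  exact (x0.sq x).trans_lt ENNReal.ofReal_lt_top

lemma integral_sq_le (x0 : Xi P V ξ c) (D : DriftC P K V l b) (x : X) :
    ∫ y, ξ x y ^ 2 ∂(P x) ≤ c * V x := by
  rw [integral_eq_lintegral_of_nonneg_ae (Eventually.of_forall fun y => sq_nonneg _)
    ((meas_x x0.meas x).pow_const 2).aestronglyMeasurable]
  exact ENNReal.toReal_le_of_le_ofReal (mul_nonneg x0.c0 (D.Wpos x).le) (x0.sq x)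

/-- `x ↦ ∫ q x y P(x,dy)` as an element of `FW V` -/
def KI (x0 : Xi P V ξ c) (D : DriftC P K V l b) (q : X → X → ℝ)
    (hq : Measurable (Function.uncurry q)) (h0 : ∀ x y, 0 ≤ q x y) (h1 : ∀ x y, q x y ≤ ξ x y ^ 2) :
    FW V :=
  ⟨fun x => ∫ y, q x y ∂(P x),
    (StronglyMeasurable.integral_kernel_prod_right' hq.stronglyMeasurable).measurable, c, fun x => by
      rw [abs_of_nonneg (integral_nonneg fun y => h0 x y)]
      exact (integral_mono_of_nonneg (Eventually.of_forall fun y => h0 x y) (x0.integrable_sq_x x)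
        (Eventually.of_forall fun y => h1 x y)).trans (x0.integral_sq_le D x)⟩

/-- the conditional variance -/
def G (x0 : Xi P V ξ c) (D : DriftC P K V l b) : FW V :=
  x0.KI D (fun x y => ξ x y ^ 2) (x0.meas.pow_const 2) (fun _ _ => sq_nonneg _) (fun _ _ => le_rfl)

lemma path_sq (x0 : Xi P V ξ c) (D : DriftC P K V l b) (hP : IsMarkovChainLaw μ P Pμ)
    (hμ : Integrable V μ) (k : ℕ) : Integrable (fun ω => ξ (ω k) (ω (k + 1)) ^ 2) Pμ := by
  refine ⟨((meas_path x0.meas k).pow_const 2).aestronglyMeasurable, ?_⟩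
  rw [hasFiniteIntegral_iff_ofReal (Eventually.of_forall fun y => sq_nonneg _)]
  have hm : Measurable (fun z : (ℕ → X) × X => ξ (z.1 k) z.2) :=
    Measurable.comp (f := fun z : (ℕ → X) × X => (z.1 k, z.2)) x0.meas (((measurable_pi_apply k).comp measurable_fst).prodMk measurable_snd)
  rw [markov_lint hP k (F := fun z => ENNReal.ofReal (ξ (z.1 k) z.2 ^ 2))
    (hm.pow_const 2).ennreal_ofReal (fun ω y => by simp only [frz_apply le_rfl])]
  refine (lintegral_mono fun ω : ℕ → X => x0.sq (ω k)).trans_lt ?_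
  exact ((D.path_integrable_W hP hμ k).const_mul c).lintegral_lt_top

lemma path_q (x0 : Xi P V ξ c) (D : DriftC P K V l b) (hP : IsMarkovChainLaw μ P Pμ)
    (hμ : Integrable V μ) (k : ℕ) {q : X → X → ℝ} (hq : Measurable (Function.uncurry q))
    (h1 : ∀ x y, |q x y| ≤ ξ x y ^ 2) :
    Integrable (fun ω => q (ω k) (ω (k + 1))) Pμ :=
  (x0.path_sq D hP hμ k).mono' (meas_path hq k).aestronglyMeasurable
    (Eventually.of_forall fun ω => h1 _ _)

lemma path_KI (x0 : Xi P V ξ c) (D : DriftC P K V l b) (hP : IsMarkovChainLaw μ P Pμ)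
    (hμ : Integrable V μ) (k : ℕ) (q : X → X → ℝ)
    (hq : Measurable (Function.uncurry q)) (h0 : ∀ x y, 0 ≤ q x y) (h1 : ∀ x y, q x y ≤ ξ x y ^ 2) :
    ∫ ω, q (ω k) (ω (k + 1)) ∂Pμ = ∫ ω, ev V (ω k) (x0.KI D q hq h0 h1) ∂Pμ := by
  have := cond hP k hq (Z := fun _ => (1:ℝ)) stronglyMeasurable_const (fun _ => rfl) (by
    simp only [smul_eq_mul, mul_one]
    exact x0.path_q D hP hμ k hq (fun x y => by rw [abs_of_nonneg (h0 x y)]; exact h1 x y))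
  simp only [smul_eq_mul, mul_one] at this
  exact this

lemma memLp (x0 : Xi P V ξ c) (D : DriftC P K V l b) (hP : IsMarkovChainLaw μ P Pμ)
    (hμ : Integrable V μ) (k : ℕ) : MemLp (fun ω => ξ (ω k) (ω (k + 1))) 2 Pμ := by
  rw [memLp_two_iff_integrable_sq (meas_path x0.meas k).aestronglyMeasurable]
  exact x0.path_sq D hP hμ k

lemma path_sq_le (x0 : Xi P V ξ c) (D : DriftC P K V l b) (hP : IsMarkovChainLaw μ P Pμ)
    (hμ : Integrable V μ) (k : ℕ) :
    ∫ ω, ξ (ω k) (ω (k + 1)) ^ 2 ∂Pμ ≤ c * (D.c2 * ∫ x, V x ∂μ) := by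
  have h := x0.path_KI D hP hμ k (fun x y => ξ x y ^ 2) (x0.meas.pow_const 2)
    (fun _ _ => sq_nonneg _) (fun _ _ => le_rfl)
  rw [h]
  refine (integral_mono (D.path_integrable hP hμ k _) ((D.path_integrable_W hP hμ k).const_mul c)
    fun ω => x0.integral_sq_le D (ω k)).trans ?_
  rw [integral_const_mul]
  exact mul_le_mul_of_nonneg_left (D.path_W_le hP hμ k) x0.c0

/-- weighted martingale sums -/
def M (ξ : X → X → ℝ) (w : ℕ → ℝ) (n : ℕ) (ω : ℕ → X) : ℝ :=
  ∑ k ∈ Finset.range n, w k * ξ (ω k) (ω (k + 1))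

lemma M_succ (w : ℕ → ℝ) (n : ℕ) (ω : ℕ → X) :
    M ξ w (n + 1) ω = M ξ w n ω + w n * ξ (ω n) (ω (n + 1)) := Finset.sum_range_succ _ _

lemma M_frz (w : ℕ → ℝ) (n : ℕ) (ω : ℕ → X) : M ξ w n (frz n ω) = M ξ w n ω := by
  refine Finset.sum_congr rfl fun k hk => ?_
  have := Finset.mem_range.1 hk
  rw [frz_apply (by omega), frz_apply (by omega)]

lemma M_meas (h : Measurable (Function.uncurry ξ)) (w : ℕ → ℝ) (n : ℕ) : Measurable (M ξ w n) :=
  Finset.measurable_fun_sum _ fun k _ => (meas_path h k).const_mul _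

lemma M_memLp (x0 : Xi P V ξ c) (D : DriftC P K V l b) (hP : IsMarkovChainLaw μ P Pμ)
    (hμ : Integrable V μ) (w : ℕ → ℝ) (n : ℕ) : MemLp (M ξ w n) 2 Pμ :=
  memLp_finsetSum _ fun k _ => (x0.memLp D hP hμ k).const_mul _

lemma M_sq (x0 : Xi P V ξ c) (D : DriftC P K V l b) (hP : IsMarkovChainLaw μ P Pμ)
    (hμ : Integrable V μ) (w : ℕ → ℝ) (n : ℕ) :
    ∫ ω, M ξ w n ω ^ 2 ∂Pμ ≤ (∑ k ∈ Finset.range n, w k ^ 2) * (c * (D.c2 * ∫ x, V x ∂μ)) := by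
  induction n with
  | zero => simp [M]
  | succ n ih =>
    have i1 : Integrable (fun ω => M ξ w n ω ^ 2) Pμ := (x0.M_memLp D hP hμ w n).integrable_sq
    have i2 : Integrable (fun ω => ξ (ω n) (ω (n + 1)) • M ξ w n ω) Pμ :=
      (x0.memLp D hP hμ n).integrable_mul (x0.M_memLp D hP hμ w n)
    have i3 := x0.path_sq D hP hμ n
    have h0 : ∫ ω, ξ (ω n) (ω (n + 1)) • M ξ w n ω ∂Pμ = 0 := by
      rw [cond hP n x0.meas (M_meas x0.meas w n).stronglyMeasurable (M_frz w n) i2]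
      simp [x0.zero]
    have e : ∀ ω, M ξ w (n + 1) ω ^ 2 = M ξ w n ω ^ 2 + (2 * w n) * (ξ (ω n) (ω (n + 1)) • M ξ w n ω)
        + w n ^ 2 * ξ (ω n) (ω (n + 1)) ^ 2 := by
      intro ω
      rw [M_succ, smul_eq_mul]; ring
    simp only [e]
    have i12 : Integrable (fun ω => M ξ w n ω ^ 2 + (2 * w n) * (ξ (ω n) (ω (n + 1)) • M ξ w n ω)) Pμ :=
      i1.add (i2.const_mul _)
    rw [integral_add i12 (i3.const_mul _), integral_add i1 (i2.const_mul _),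
      integral_const_mul, integral_const_mul, h0, mul_zero, add_zero, Finset.sum_range_succ, add_mul]
    exact add_le_add ih (mul_le_mul_of_nonneg_left (x0.path_sq_le D hP hμ n) (sq_nonneg _))

/-- replacing `f` by its mean -/
lemma partA (x0 : Xi P V ξ c) (e : Env P K V l b l' b' μ π Pμ) (f : FW (fun x => √(V x)))
    (hf : ∫ x, (f : X → ℝ) x ∂π = 0) :
    Tendsto (fun n : ℕ => ∫ ω, |(1 / (n:ℝ)) * ∑ l ∈ Finset.range n, ev _ (ω l) f *
      M ξ (fun k => if k < n then 1 / √(n:ℝ) else 0) l ω| ∂Pμ) atTop (𝓝 0) := by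
  set B := c * (e.D.c2 * ∫ x, V x ∂μ) with hB
  have hB0 : 0 ≤ B := mul_nonneg x0.c0 (mul_nonneg (zero_le_one.trans e.D.one_le_c2)
    (integral_nonneg fun x => (e.D.Wpos x).le))
  refine e.smooth f hf (U := fun n l => M ξ (fun k => if k < n then 1 / √(n:ℝ) else 0) l) (C := B)
    (fun n l => x0.M_memLp e.D e.hP e.hμ _ _) (fun n l => ?_) (fun n l hn => ?_)
  · simp only [Real.norm_eq_abs, sq_abs]
    refine (x0.M_sq e.D e.hP e.hμ _ _).trans ?_
    have : ∑ k ∈ Finset.range l, (if k < n then 1 / √(n:ℝ) else 0) ^ 2 ≤ 1 := by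
      calc _ = ∑ k ∈ (Finset.range l).filter (· < n), 1 / (n:ℝ) := by
            rw [Finset.sum_filter]
            refine Finset.sum_congr rfl fun k _ => ?_
            split_ifs
            · rw [div_pow, one_pow, Real.sq_sqrt (Nat.cast_nonneg n)]
            · simp
        _ ≤ ∑ k ∈ Finset.range n, 1 / (n:ℝ) := by
            refine Finset.sum_le_sum_of_subset_of_nonneg ?_ (fun _ _ _ => by positivity)
            intro k hk
            simp only [Finset.mem_filter, Finset.mem_range] at hk ⊢
            exact hk.2
        _ ≤ 1 := by
            simp only [Finset.sum_const, Finset.card_range, nsmul_eq_mul, one_div]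
            exact mul_inv_le_one
    calc _ ≤ 1 * B := mul_le_mul_of_nonneg_right this hB0
      _ = B := one_mul B
  · simp only [M_succ, add_sub_cancel_left, Real.norm_eq_abs, sq_abs, mul_pow]
    rw [integral_const_mul, div_eq_inv_mul B]
    refine mul_le_mul ?_ (x0.path_sq_le e.D e.hP e.hμ l) (integral_nonneg fun _ => sq_nonneg _)
      (by positivity)
    split_ifs
    · rw [div_pow, one_pow, Real.sq_sqrt (Nat.cast_nonneg n), one_div]
    · simp

end Xi
end

section

lemma exp_taylor_bound (x : ℝ) :
    ‖Complex.exp (Complex.I * x) - 1 - Complex.I * x + (x:ℂ) ^ 2 / 2‖ ≤ 4 * (x ^ 2 * min 1 |x|) := by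
  rcases le_total |x| 1 with h | h
  · have hn : ‖Complex.I * (x:ℂ)‖ = |x| := by simp
    have := Complex.exp_bound (x := Complex.I * x) (by rw [hn]; exact h) (n := 3) (by norm_num)
    rw [hn] at this
    have e : Complex.exp (Complex.I * x) - 1 - Complex.I * x + (x:ℂ) ^ 2 / 2 =
      Complex.exp (Complex.I * x) - ∑ m ∈ Finset.range 3, (Complex.I * (x:ℂ)) ^ m / (m.factorial : ℂ) := by
      simp only [Finset.sum_range_succ, Finset.sum_range_zero, Nat.factorial, mul_pow, Complex.I_sq]
      push_cast
      ring
    rw [e, min_eq_right h]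
    refine this.trans ?_
    have h3 : 0 ≤ |x| ^ 3 := by positivity
    have e3 : x ^ 2 * |x| = |x| ^ 3 := by rw [← sq_abs x]; ring
    rw [e3, mul_comm]
    refine mul_le_mul_of_nonneg_right ?_ h3
    norm_num [Nat.factorial]
  · rw [min_eq_left h]
    have h1 : ‖Complex.exp (Complex.I * x)‖ = 1 := Complex.norm_exp_I_mul_ofReal x
    have h2 : ‖Complex.I * (x:ℂ)‖ = |x| := by simp
    have h3 : ‖(x:ℂ) ^ 2 / 2‖ = |x| ^ 2 / 2 := by simp
    calc _ ≤ 1 + 1 + |x| + |x| ^ 2 / 2 := by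
          refine (norm_add_le _ _).trans (add_le_add ((norm_sub_le _ _).trans (add_le_add
            ((norm_sub_le _ _).trans (add_le_add h1.le (by simp))) h2.le)) h3.le)
      _ ≤ _ := by rw [← sq_abs x]; nlinarith

lemma exp_lip (x y : ℝ) : ‖Complex.exp (Complex.I * x) - Complex.exp (Complex.I * y)‖ ≤ |x - y| := by
  have e : Complex.exp (Complex.I * x) - Complex.exp (Complex.I * y) =
      Complex.exp (Complex.I * y) * (Complex.exp (Complex.I * (x - y : ℝ)) - 1) := by
    rw [mul_sub, ← Complex.exp_add]
    push_cast
    ring_nf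
  rw [e, norm_mul, Complex.norm_exp_I_mul_ofReal, one_mul]
  exact Real.norm_exp_I_mul_ofReal_sub_one_le

lemma exp_neg_bound {v : ℝ} (hv : 0 ≤ v) : |Real.exp (-v) - 1 + v| ≤ v ^ 2 := by
  have h1 : 1 - v ≤ Real.exp (-v) := Real.one_sub_le_exp_neg v
  have h2 : v + 1 ≤ Real.exp v := Real.add_one_le_exp v
  rw [abs_of_nonneg (by linarith)]
  have h3 : Real.exp (-v) * Real.exp v = 1 := by rw [← Real.exp_add]; simp
  have h4 : Real.exp (-v) * (v + 1) ≤ 1 := by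
    calc Real.exp (-v) * (v + 1) ≤ Real.exp (-v) * Real.exp v :=
          mul_le_mul_of_nonneg_left h2 (Real.exp_pos _).le
      _ = 1 := h3
  nlinarith [Real.exp_pos (-v), sq_nonneg v, mul_nonneg hv (sq_nonneg v)]

/-- admissible weights -/
structure Wts (s : ℕ → ℕ → ℝ) (A Q : ℝ) : Prop where
  A0 : 0 ≤ A
  bd : ∀ n k, |s n k| ≤ A / √(n:ℝ)
  lip : ∀ n k, |s n (k + 1) - s n k| ≤ A / n
  zero : ∀ n k, n ≤ k → s n k = 0
  lim : Tendsto (fun n : ℕ => ∑ k ∈ Finset.range n, s n k ^ 2) atTop (𝓝 Q)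

namespace Wts
variable {s : ℕ → ℕ → ℝ} {A Q : ℝ}

lemma sq_le (h : Wts s A Q) (n k : ℕ) : s n k ^ 2 ≤ A ^ 2 / n := by
  rw [← sq_abs]
  refine (pow_le_pow_left₀ (abs_nonneg _) (h.bd n k) 2).trans (le_of_eq ?_)
  rw [div_pow, Real.sq_sqrt (Nat.cast_nonneg n)]

lemma sum_le (h : Wts s A Q) (n k : ℕ) : ∑ j ∈ Finset.range k, s n j ^ 2 ≤ A ^ 2 := by
  calc ∑ j ∈ Finset.range k, s n j ^ 2 = ∑ j ∈ (Finset.range k).filter (· < n), s n j ^ 2 := by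
        rw [Finset.sum_filter]
        refine Finset.sum_congr rfl fun j _ => ?_
        split_ifs with hj
        · rfl
        · rw [h.zero n j (by omega)]; simp
    _ ≤ ∑ j ∈ Finset.range n, s n j ^ 2 := by
        refine Finset.sum_le_sum_of_subset_of_nonneg ?_ (fun _ _ _ => by positivity)
        intro k hk
        simp only [Finset.mem_filter, Finset.mem_range] at hk ⊢
        exact hk.2
    _ ≤ ∑ j ∈ Finset.range n, A ^ 2 / n := Finset.sum_le_sum fun j _ => h.sq_le n j
    _ ≤ A ^ 2 := by
        simp only [Finset.sum_const, Finset.card_range, nsmul_eq_mul]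
        rcases Nat.eq_zero_or_pos n with rfl | hn
        · simp; positivity
        · have : (0:ℝ) < n := by exact_mod_cast hn
          exact le_of_eq (by field_simp)

/-- the compensator -/
def cc (s : ℕ → ℕ → ℝ) (v : ℝ) (n k : ℕ) : ℝ := Real.exp (v / 2 * ∑ j ∈ Finset.range k, s n j ^ 2)

lemma cc_pos (v : ℝ) (n k : ℕ) : 0 < cc s v n k := Real.exp_pos _

lemma cc_le (h : Wts s A Q) {v : ℝ} (hv : 0 ≤ v) (n k : ℕ) : cc s v n k ≤ Real.exp (v / 2 * A ^ 2) :=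
  Real.exp_le_exp.2 (mul_le_mul_of_nonneg_left (h.sum_le n k) (by positivity))

lemma cc_succ (v : ℝ) (n k : ℕ) :
    cc s v n k = cc s v n (k + 1) * Real.exp (-(v / 2 * s n k ^ 2)) := by
  unfold cc
  rw [← Real.exp_add, Finset.sum_range_succ]
  ring_nf

/-- the deterministic factor of `U` -/
def rr (s : ℕ → ℕ → ℝ) (v : ℝ) (n k : ℕ) : ℝ := cc s v n (k + 1) * (n * s n k ^ 2 / 2)

lemma rr_nonneg (v : ℝ) (n k : ℕ) : 0 ≤ rr s v n k :=
  mul_nonneg (cc_pos _ _ _).le (by positivity)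

lemma n_sq_le (h : Wts s A Q) (n k : ℕ) : n * s n k ^ 2 / 2 ≤ A ^ 2 / 2 := by
  rcases Nat.eq_zero_or_pos n with rfl | hn
  · simp; positivity
  · have hn0 : (0:ℝ) < n := by exact_mod_cast hn
    have := mul_le_mul_of_nonneg_left (h.sq_le n k) hn0.le
    rw [mul_div_cancel₀ _ hn0.ne'] at this
    linarith

lemma rr_le (h : Wts s A Q) {v : ℝ} (hv : 0 ≤ v) (n k : ℕ) :
    rr s v n k ≤ Real.exp (v / 2 * A ^ 2) * (A ^ 2 / 2) :=
  mul_le_mul (h.cc_le hv n _) (h.n_sq_le n k) (by positivity) (Real.exp_pos _).le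

lemma rr_lip (h : Wts s A Q) {v : ℝ} (hv : 0 ≤ v) (n k : ℕ) (hn : 0 < n) :
    |rr s v n (k + 1) - rr s v n k| ≤
      (Real.exp (v / 2 * A ^ 2) * (v / 2 * A ^ 2) * (A ^ 2 / 2) + Real.exp (v / 2 * A ^ 2) * A ^ 2) / √(n:ℝ) := by
  have hn0 : (0:ℝ) < n := by exact_mod_cast hn
  have hn1 : (1:ℝ) ≤ n := by exact_mod_cast hn
  have hsn : 0 < √(n:ℝ) := Real.sqrt_pos.2 hn0
  have hA0 := h.A0
  have hsn' : √(n:ℝ) ≤ n := by rw [Real.sqrt_le_left hn0.le]; nlinarith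
  set c := Real.exp (v / 2 * A ^ 2) with hc
  have hc0 : 0 < c := Real.exp_pos _
  have e : rr s v n (k + 1) - rr s v n k = (cc s v n (k + 1 + 1) - cc s v n (k + 1)) * (n * s n (k + 1) ^ 2 / 2)
      + cc s v n (k + 1) * (n * s n (k + 1) ^ 2 / 2 - n * s n k ^ 2 / 2) := by
    unfold rr; ring
  have b1 : |cc s v n (k + 1 + 1) - cc s v n (k + 1)| ≤ c * (v / 2 * A ^ 2) / √n := by
    rw [cc_succ v n (k + 1)]
    have h1 : 1 - v / 2 * s n (k + 1) ^ 2 ≤ Real.exp (-(v / 2 * s n (k + 1) ^ 2)) := Real.one_sub_le_exp_neg _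
    have h2 : Real.exp (-(v / 2 * s n (k + 1) ^ 2)) ≤ 1 := Real.exp_le_one_iff.2 (by
      have : 0 ≤ v / 2 * s n (k + 1) ^ 2 := by positivity
      linarith)
    have h3 : cc s v n (k + 1 + 1) - cc s v n (k + 1 + 1) * Real.exp (-(v / 2 * s n (k + 1) ^ 2))
      = cc s v n (k + 1 + 1) * (1 - Real.exp (-(v / 2 * s n (k + 1) ^ 2))) := by ring
    rw [h3, abs_of_nonneg (mul_nonneg (cc_pos _ _ _).le (by linarith)), mul_div_assoc]
    refine mul_le_mul (h.cc_le hv _ _) ?_ (by linarith) hc0.le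
    calc _ ≤ v / 2 * s n (k + 1) ^ 2 := by linarith
      _ ≤ v / 2 * (A ^ 2 / n) := mul_le_mul_of_nonneg_left (h.sq_le _ _) (by positivity)
      _ ≤ v / 2 * (A ^ 2 / √n) := mul_le_mul_of_nonneg_left
          (div_le_div_of_nonneg_left (by positivity) hsn hsn') (by positivity)
      _ = _ := by ring
  have b2 : |n * s n (k + 1) ^ 2 / 2 - n * s n k ^ 2 / 2| ≤ A ^ 2 / √n := by
    have e2 : n * s n (k + 1) ^ 2 / 2 - n * s n k ^ 2 / 2
      = (n / 2) * ((s n (k + 1) - s n k) * (s n (k + 1) + s n k)) := by ring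
    rw [e2, abs_mul, abs_mul, abs_of_pos (by positivity : (0:ℝ) < n / 2)]
    have h1 : |s n (k + 1) + s n k| ≤ A / √n + A / √n :=
      (abs_add_le _ _).trans (add_le_add (h.bd _ _) (h.bd _ _))
    calc _ ≤ ((n:ℝ) / 2) * ((A / n) * (A / √n + A / √n)) := by
          refine mul_le_mul_of_nonneg_left (mul_le_mul (h.lip n k) h1 (abs_nonneg _) (by positivity))
            (by positivity)
      _ = _ := by field_simp; ring
  rw [e]
  refine (abs_add_le _ _).trans ?_
  rw [abs_mul, abs_mul, abs_of_pos (cc_pos v n (k + 1)),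
    abs_of_nonneg (by positivity : 0 ≤ n * s n (k + 1) ^ 2 / 2), add_div]
  refine add_le_add ?_ ?_
  · calc _ ≤ (c * (v / 2 * A ^ 2) / √n) * (A ^ 2 / 2) :=
        mul_le_mul b1 (h.n_sq_le _ _) (by positivity) (by positivity)
      _ = _ := by ring
  · rw [mul_div_assoc c (A ^ 2)]
    exact mul_le_mul (h.cc_le hv _ _) b2 (abs_nonneg _) hc0.le

end Wts
end

section

namespace Xi
open DriftC
variable {X : Type*} [MeasurableSpace X] {P : Kernel X X} {K : Set X} {V : X → ℝ} {l b l' b' : ℝ}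
  {μ π : Measure X} {Pμ : Measure (ℕ → X)} [IsMarkovKernel P] [IsProbabilityMeasure μ]
  [IsProbabilityMeasure π] {ξ : X → X → ℝ} {c : ℝ}

/-- truncated square -/
def qt (ξ : X → X → ℝ) (τ : ℝ) (x y : X) : ℝ := ξ x y ^ 2 * min 1 (τ * |ξ x y|)

lemma qt_meas (h : Measurable (Function.uncurry ξ)) (τ : ℝ) :
    Measurable (Function.uncurry (qt ξ τ)) := by
  have h2 : Measurable (fun z : X × X => |Function.uncurry ξ z|) := h.abs
  exact (h.pow_const 2).mul (measurable_const.min (h2.const_mul τ))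

lemma qt_nonneg {τ : ℝ} (hτ : 0 ≤ τ) (x y : X) : 0 ≤ qt ξ τ x y :=
  mul_nonneg (sq_nonneg _) (le_min zero_le_one (mul_nonneg hτ (abs_nonneg _)))

lemma qt_le {τ : ℝ} (x y : X) : qt ξ τ x y ≤ ξ x y ^ 2 := by
  have := mul_le_mul_of_nonneg_left (min_le_left 1 (τ * |ξ x y|)) (sq_nonneg (ξ x y))
  rw [mul_one] at this
  exact this

lemma qt_tendsto (x y : X) :
    Tendsto (fun N : ℕ => qt ξ (1 / ((N:ℝ) + 1)) x y) atTop (𝓝 0) := by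
  have h1 : Tendsto (fun N : ℕ => 1 / ((N:ℝ) + 1)) atTop (𝓝 0) := tendsto_one_div_add_atTop_nhds_zero_nat
  have h2 := ((tendsto_const_nhds (x := (1:ℝ))).min (h1.mul_const |ξ x y|)).const_mul (ξ x y ^ 2)
  rw [zero_mul, min_eq_right zero_le_one, mul_zero] at h2
  exact h2

lemma lindeberg (x0 : Xi P V ξ c) (D : DriftC P K V l b) (hπ : Integrable V π) {η : ℝ} (hη : 0 < η) :
    ∃ τ > 0, ∫ x, (∫ y, qt ξ τ x y ∂(P x)) ∂π < η := by
  have t : ∀ N : ℕ, (0:ℝ) ≤ 1 / ((N:ℝ) + 1) := fun N => by positivity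
  have h1 : ∀ x, Tendsto (fun N : ℕ => ∫ y, qt ξ (1 / ((N:ℝ) + 1)) x y ∂(P x)) atTop (𝓝 0) := by
    intro x
    have := tendsto_integral_of_dominated_convergence (μ := P x)
      (F := fun N : ℕ => fun y => qt ξ (1 / ((N:ℝ) + 1)) x y) (f := fun _ => 0)
      (fun y => ξ x y ^ 2) (fun N => (meas_x (qt_meas x0.meas _) x).aestronglyMeasurable)
      (x0.integrable_sq_x x) (fun N => Eventually.of_forall fun y => by
        rw [Real.norm_eq_abs, abs_of_nonneg (qt_nonneg (t N) x y)]; exact qt_le x y)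
      (Eventually.of_forall fun y => qt_tendsto x y)
    simpa using this
  have h2 : Tendsto (fun N : ℕ => ∫ x, (∫ y, qt ξ (1 / ((N:ℝ) + 1)) x y ∂(P x)) ∂π) atTop (𝓝 (∫ x, 0 ∂π)) := by
    refine tendsto_integral_of_dominated_convergence (fun x => c * V x) (fun N => ?_) (hπ.const_mul c)
      (fun N => Eventually.of_forall fun x => ?_) (Eventually.of_forall h1)
    · exact (StronglyMeasurable.integral_kernel_prod_right'
        (qt_meas x0.meas _).stronglyMeasurable).aestronglyMeasurable
    · rw [Real.norm_eq_abs, abs_of_nonneg (integral_nonneg fun y => qt_nonneg (t N) x y)]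
      exact (integral_mono_of_nonneg (Eventually.of_forall fun y => qt_nonneg (t N) x y)
        (x0.integrable_sq_x x) (Eventually.of_forall fun y => qt_le x y)).trans (x0.integral_sq_le D x)
  rw [integral_zero] at h2
  obtain ⟨N, hN⟩ := (h2.eventually_lt_const hη).exists
  exact ⟨1 / ((N:ℝ) + 1), by positivity, hN⟩

/-- the exponential martingale integrand -/
def EE (ξ : X → X → ℝ) (w : ℕ → ℝ) (k : ℕ) (ω : ℕ → X) : ℂ := Complex.exp (Complex.I * (M ξ w k ω : ℝ))

lemma EE_norm (w : ℕ → ℝ) (k : ℕ) (ω : ℕ → X) : ‖EE ξ w k ω‖ = 1 := Complex.norm_exp_I_mul_ofReal _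

lemma EE_meas (h : Measurable (Function.uncurry ξ)) (w : ℕ → ℝ) (k : ℕ) : Measurable (EE ξ w k) := by
  have := M_meas h w k
  unfold EE
  fun_prop

lemma EE_succ (w : ℕ → ℝ) (k : ℕ) (ω : ℕ → X) :
    EE ξ w (k + 1) ω = EE ξ w k ω * Complex.exp (Complex.I * (w k * ξ (ω k) (ω (k + 1)) : ℝ)) := by
  unfold EE
  rw [M_succ, ← Complex.exp_add]
  push_cast
  ring_nf

lemma EE_int [IsProbabilityMeasure Pμ] (h : Measurable (Function.uncurry ξ)) (w : ℕ → ℝ) (k : ℕ) :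
    Integrable (EE ξ w k) Pμ :=
  (integrable_const (1:ℝ)).mono' (EE_meas h w k).aestronglyMeasurable
    (Eventually.of_forall fun ω => (EE_norm w k ω).le)

lemma smul_EE_int {q : (ℕ → X) → ℝ} (hq : Integrable q Pμ)
    (h : Measurable (Function.uncurry ξ)) (w : ℕ → ℝ) (k : ℕ) :
    Integrable (fun ω => q ω • EE ξ w k ω) Pμ :=
  hq.norm.mono' (hq.1.smul (EE_meas h w k).aestronglyMeasurable)
    (Eventually.of_forall fun ω => by rw [norm_smul, EE_norm, mul_one])

lemma step (x0 : Xi P V ξ c) (D : DriftC P K V l b) (hP : IsMarkovChainLaw μ P Pμ)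
    (hμ : Integrable V μ) (w : ℕ → ℝ) (k : ℕ) {v τ : ℝ} (hv : 0 ≤ v) (hτ : |w k| ≤ τ) :
    ‖∫ ω, EE ξ w (k + 1) ω ∂Pμ - (Real.exp (-(v / 2 * w k ^ 2)) : ℝ) * ∫ ω, EE ξ w k ω ∂Pμ
      + ((w k ^ 2 / 2 : ℝ) : ℂ) * ∫ ω, ev V (ω k) (x0.G D - D.cst v) • EE ξ w k ω ∂Pμ‖
      ≤ 4 * w k ^ 2 * (∫ ω, qt ξ τ (ω k) (ω (k + 1)) ∂Pμ) + (v / 2 * w k ^ 2) ^ 2 := by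
  have := hP.1
  have hEz : ∀ ω, EE ξ w k (frz k ω) = EE ξ w k ω := fun ω => by unfold EE; rw [M_frz]
  have iE := EE_int (Pμ := Pμ) x0.meas w k
  have iE1 := EE_int (Pμ := Pμ) x0.meas w (k + 1)
  have i1 := smul_EE_int ((x0.memLp D hP hμ k).integrable (by norm_num)) x0.meas w k
  have i2 := smul_EE_int (x0.path_sq D hP hμ k) x0.meas w k
  have i3 := smul_EE_int (D.path_integrable hP hμ k (x0.G D)) x0.meas w k
  have c1 := cond hP k x0.meas (EE_meas x0.meas w k).stronglyMeasurable hEz i1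
  simp only [x0.zero, zero_smul, integral_zero] at c1
  have c2 : ∫ ω, ξ (ω k) (ω (k + 1)) ^ 2 • EE ξ w k ω ∂Pμ = ∫ ω, ev V (ω k) (x0.G D) • EE ξ w k ω ∂Pμ :=
    cond hP k (q := fun x y => ξ x y ^ 2) (x0.meas.pow_const 2)
      (EE_meas x0.meas w k).stronglyMeasurable hEz i2
  have c3 : ∫ ω, ev V (ω k) (x0.G D - D.cst v) • EE ξ w k ω ∂Pμ =
      ∫ ω, ξ (ω k) (ω (k + 1)) ^ 2 • EE ξ w k ω ∂Pμ - v * ∫ ω, EE ξ w k ω ∂Pμ := by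
    rw [c2, ← integral_const_mul, ← integral_sub i3 (iE.const_mul _)]
    refine integral_congr_ae (Eventually.of_forall fun ω => ?_)
    have : ev V (ω k) (x0.G D - D.cst v) = ev V (ω k) (x0.G D) - v := by rw [map_sub]; rfl
    simp only [this, sub_smul, Complex.real_smul]
  set a := w k
  set r := Real.exp (-(v / 2 * a ^ 2))
  set F : (ℕ → X) → ℂ := fun ω => EE ξ w (k + 1) ω - r * EE ξ w k ω
      + ((a ^ 2 / 2 : ℝ) : ℂ) * (ξ (ω k) (ω (k + 1)) ^ 2 • EE ξ w k ω - v * EE ξ w k ω)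
      - (Complex.I * a) * (ξ (ω k) (ω (k + 1)) • EE ξ w k ω) with hF
  have j1 : Integrable (fun ω => EE ξ w (k + 1) ω - r * EE ξ w k ω) Pμ := iE1.sub (iE.const_mul _)
  have j2 : Integrable (fun ω => ξ (ω k) (ω (k + 1)) ^ 2 • EE ξ w k ω - v * EE ξ w k ω) Pμ :=
    i2.sub (iE.const_mul _)
  have j3 : Integrable (fun ω => EE ξ w (k + 1) ω - r * EE ξ w k ω
      + ((a ^ 2 / 2 : ℝ) : ℂ) * (ξ (ω k) (ω (k + 1)) ^ 2 • EE ξ w k ω - v * EE ξ w k ω)) Pμ :=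
    j1.add (j2.const_mul _)
  have hFi : ∫ ω, F ω ∂Pμ = ∫ ω, EE ξ w (k + 1) ω ∂Pμ - r * ∫ ω, EE ξ w k ω ∂Pμ
      + ((a ^ 2 / 2 : ℝ) : ℂ) * ∫ ω, ev V (ω k) (x0.G D - D.cst v) • EE ξ w k ω ∂Pμ := by
    rw [hF, integral_sub j3 (i1.const_mul _), integral_add j1 (j2.const_mul _),
      integral_sub iE1 (iE.const_mul _), integral_const_mul, integral_const_mul, integral_const_mul,
      c1, c3, integral_sub i2 (iE.const_mul _), integral_const_mul]
    simp
  rw [← hFi]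
  have iq : Integrable (fun ω => qt ξ τ (ω k) (ω (k + 1))) Pμ :=
    x0.path_q D hP hμ k (qt_meas x0.meas τ) (fun x y => by
      rw [abs_of_nonneg (qt_nonneg ((abs_nonneg _).trans hτ) x y)]; exact qt_le x y)
  refine (norm_integral_le_of_norm_le (g := fun ω => 4 * a ^ 2 * qt ξ τ (ω k) (ω (k + 1)) + (v / 2 * a ^ 2) ^ 2)
    ((iq.const_mul _).add (integrable_const _)) (Eventually.of_forall fun ω => ?_)).trans (le_of_eq ?_)
  · set z := ξ (ω k) (ω (k + 1)) with hz
    have e1 : F ω = EE ξ w k ω * ((Complex.exp (Complex.I * (a * z : ℝ)) - 1 - Complex.I * (a * z : ℝ)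
        + ((a * z : ℝ) : ℂ) ^ 2 / 2) - ((r - 1 + v / 2 * a ^ 2 : ℝ) : ℂ)) := by
      simp only [hF, EE_succ, Complex.real_smul]
      push_cast
      ring
    rw [e1, norm_mul, EE_norm, one_mul]
    refine (norm_sub_le _ _).trans (add_le_add ((exp_taylor_bound _).trans ?_) ?_)
    · unfold qt
      rw [← hz, mul_pow, abs_mul, mul_assoc 4, mul_assoc (a ^ 2)]
      gcongr
    · rw [Complex.norm_real, Real.norm_eq_abs]
      exact exp_neg_bound (by positivity)
  · rw [integral_add (iq.const_mul _) (integrable_const _), integral_const_mul]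
    simp

end Xi
end

section

namespace Xi
open DriftC Wts
variable {X : Type*} [MeasurableSpace X] {P : Kernel X X} {K : Set X} {V : X → ℝ} {l b l' b' : ℝ}
  {μ π : Measure X} {Pμ : Measure (ℕ → X)} [IsMarkovKernel P] [IsProbabilityMeasure μ]
  [IsProbabilityMeasure π] {ξ : X → X → ℝ} {c : ℝ} {s : ℕ → ℕ → ℝ} {A Q : ℝ}

lemma U_incr (x0 : Xi P V ξ c) (D : DriftC P K V l b) (hP : IsMarkovChainLaw μ P Pμ)
    (hμ : Integrable V μ) (h : Wts s A Q) {v : ℝ} (hv : 0 ≤ v) :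
    ∃ C, ∀ n k, 0 < n →
      ∫ ω, ‖rr s v n (k + 1) • EE ξ (s n) (k + 1) ω - rr s v n k • EE ξ (s n) k ω‖ ^ 2 ∂Pμ ≤ C / n := by
  have := hP.1
  set B := c * (D.c2 * ∫ x, V x ∂μ) with hB
  set r1 := Real.exp (v / 2 * A ^ 2) * (A ^ 2 / 2) with hr1
  have hr10 : 0 ≤ r1 := mul_nonneg (Real.exp_pos _).le (by positivity)
  set R := Real.exp (v / 2 * A ^ 2) * (v / 2 * A ^ 2) * (A ^ 2 / 2) + Real.exp (v / 2 * A ^ 2) * A ^ 2 with hR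
  have hR0 : 0 ≤ R := by positivity
  have hA0 := h.A0
  refine ⟨2 * ((r1 * A) ^ 2 * B + R ^ 2), fun n k hn => ?_⟩
  have hn0 : (0:ℝ) < n := by exact_mod_cast hn
  have iq := x0.path_sq D hP hμ k
  have ib : Integrable (fun ω => 2 * ((r1 * A) ^ 2 * ξ (ω k) (ω (k + 1)) ^ 2 + R ^ 2) / n) Pμ :=
    (((iq.const_mul _).add (integrable_const _)).const_mul _).div_const _
  have hpt : ∀ ω, ‖rr s v n (k + 1) • EE ξ (s n) (k + 1) ω - rr s v n k • EE ξ (s n) k ω‖ ^ 2 ≤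
      2 * ((r1 * A) ^ 2 * ξ (ω k) (ω (k + 1)) ^ 2 + R ^ 2) / n := by
    intro ω
    set z := ξ (ω k) (ω (k + 1)) with hz
    have hE : ‖EE ξ (s n) (k + 1) ω - EE ξ (s n) k ω‖ ≤ A / √n * |z| := by
      refine (exp_lip _ _).trans ?_
      rw [M_succ, add_sub_cancel_left, abs_mul]
      exact mul_le_mul_of_nonneg_right (h.bd n k) (abs_nonneg _)
    have e1 : rr s v n (k + 1) • EE ξ (s n) (k + 1) ω - rr s v n k • EE ξ (s n) k ω =
      (rr s v n (k + 1) - rr s v n k) • EE ξ (s n) (k + 1) ω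
        + rr s v n k • (EE ξ (s n) (k + 1) ω - EE ξ (s n) k ω) := by
      simp only [sub_smul, smul_sub]; ring
    have hb : ‖rr s v n (k + 1) • EE ξ (s n) (k + 1) ω - rr s v n k • EE ξ (s n) k ω‖ ≤
        (R + r1 * A * |z|) / √n := by
      rw [e1]
      refine (norm_add_le _ _).trans ?_
      rw [norm_smul, norm_smul, EE_norm, mul_one, Real.norm_eq_abs, Real.norm_eq_abs,
        abs_of_nonneg (rr_nonneg v n k), add_div]
      refine add_le_add (h.rr_lip hv n k hn) ?_
      calc _ ≤ r1 * (A / √n * |z|) := mul_le_mul (h.rr_le hv n k) hE (norm_nonneg _) hr10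
        _ = _ := by ring
    refine (pow_le_pow_left₀ (norm_nonneg _) hb 2).trans ?_
    rw [div_pow, Real.sq_sqrt hn0.le]
    refine div_le_div_of_nonneg_right ?_ hn0.le
    rw [← sq_abs z]
    nlinarith [sq_nonneg (R - r1 * A * |z|)]
  refine (integral_mono_of_nonneg (Eventually.of_forall fun ω => by positivity) ib
    (Eventually.of_forall hpt)).trans ?_
  rw [integral_div, integral_const_mul, integral_add (iq.const_mul _) (integrable_const _), integral_const_mul]
  simp only [integral_const, probReal_univ, smul_eq_mul, one_mul]
  have := x0.path_sq_le D hP hμ k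
  gcongr

theorem clt (x0 : Xi P V ξ c) (e : Env P K V l b l' b' μ π Pμ) (h : Wts s A Q) :
    Tendsto (fun n : ℕ => ∫ ω, EE ξ (s n) n ω ∂Pμ) atTop
      (𝓝 ((Real.exp (-((∫ x, (x0.G e.D : X → ℝ) x ∂π) / 2 * Q)) : ℝ) : ℂ)) := by
  have := e.hP.1
  set v := ∫ x, (x0.G e.D : X → ℝ) x ∂π with hvdef
  have hv : 0 ≤ v := integral_nonneg fun x => integral_nonneg fun y => sq_nonneg _
  set g := x0.G e.D - e.D.cst v with hg
  have hg0 : ∫ x, (g : X → ℝ) x ∂π = 0 := by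
    have : ∫ x, (g : X → ℝ) x ∂π = ∫ x, ((x0.G e.D : X → ℝ) x - v) ∂π := rfl
    rw [this, integral_sub (integrable_of_FW e.hπ _) (integrable_const _), ← hvdef]
    simp
  obtain ⟨C, hC⟩ := x0.U_incr e.D e.hP e.hμ h hv
  set cb := Real.exp (v / 2 * A ^ 2) with hcb
  have hcb0 : 0 < cb := Real.exp_pos _
  have hA0 := h.A0
  have hsm := e.smoothV g hg0 (U := fun n k ω => rr s v n k • EE ξ (s n) k ω) (C := C) (u := cb * (A ^ 2 / 2))
    (fun n k => (EE_meas x0.meas (s n) k).aestronglyMeasurable.const_smul (rr s v n k))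
    (fun n k ω => by
      rw [norm_smul, EE_norm, mul_one, Real.norm_eq_abs, abs_of_nonneg (rr_nonneg v n k)]
      exact h.rr_le hv n k) hC
  set φ : ℕ → ℕ → ℂ := fun n k => ∫ ω, EE ξ (s n) k ω ∂Pμ with hφ
  set Sn : ℕ → ℂ := fun n => ∑ k ∈ Finset.range n, (cc s v n (k + 1) : ℂ) * (((s n k ^ 2 / 2 : ℝ) : ℂ) *
    ∫ ω, ev V (ω k) g • EE ξ (s n) k ω ∂Pμ) with hSn
  have hgE : ∀ n k, Integrable (fun ω => ev V (ω k) g • EE ξ (s n) k ω) Pμ := fun n k =>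
    smul_EE_int (e.D.path_integrable e.hP e.hμ k g) x0.meas _ _
  have hS0 : Tendsto Sn atTop (𝓝 0) := by
    refine squeeze_zero_norm' ?_ hsm
    filter_upwards [eventually_gt_atTop 0] with n hn
    have hn0 : (n:ℝ) ≠ 0 := by exact_mod_cast hn.ne'
    refine le_trans (le_of_eq ?_) (norm_integral_le_integral_norm _)
    congr 1
    rw [hSn, integral_smul, integral_finsetSum, Finset.smul_sum]
    · refine Finset.sum_congr rfl fun k _ => ?_
      have e1 : (fun ω : ℕ → X => ev V (ω k) g • (rr s v n k • EE ξ (s n) k ω)) =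
          fun ω => rr s v n k • (ev V (ω k) g • EE ξ (s n) k ω) := by
        funext ω; rw [smul_comm]
      rw [e1, integral_smul, smul_smul, Complex.real_smul, ← mul_assoc]
      congr 1
      unfold rr
      push_cast
      have : (n:ℂ) ≠ 0 := by exact_mod_cast hn.ne'
      field_simp
    · intro k _
      have e1 : (fun ω : ℕ → X => ev V (ω k) g • (rr s v n k • EE ξ (s n) k ω)) =
          fun ω => rr s v n k • (ev V (ω k) g • EE ξ (s n) k ω) := by
        funext ω; rw [smul_comm]
      rw [e1]
      exact (hgE n k).smul (rr s v n k)
  have htel : ∀ n, (cc s v n n : ℂ) * φ n n - 1 + Sn n = ∑ k ∈ Finset.range n, (cc s v n (k + 1) : ℂ) *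
      (φ n (k + 1) - (Real.exp (-(v / 2 * s n k ^ 2)) : ℝ) * φ n k
        + ((s n k ^ 2 / 2 : ℝ) : ℂ) * ∫ ω, ev V (ω k) g • EE ξ (s n) k ω ∂Pμ) := by
    intro n
    have h1 := Finset.sum_range_sub (fun k => (cc s v n k : ℂ) * φ n k) n
    have h0 : (cc s v n 0 : ℂ) * φ n 0 = 1 := by
      simp [hφ, cc, EE, M]
    rw [h0] at h1
    rw [← h1, hSn, ← Finset.sum_add_distrib]
    refine Finset.sum_congr rfl fun k _ => ?_
    rw [cc_succ v n k]
    push_cast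
    ring
  have hlim1 : Tendsto (fun n => (cc s v n n : ℂ) * φ n n - 1 + Sn n) atTop (𝓝 0) := by
    rw [Metric.tendsto_atTop]
    intro η hη
    set d := cb * (4 * A ^ 2) + 1 with hd
    have hd0 : 0 < d := by positivity
    obtain ⟨τ, hτ, hL⟩ := x0.lindeberg e.D e.hπ (show 0 < η / d by positivity)
    set kq := x0.KI e.D (qt ξ τ) (qt_meas x0.meas τ) (qt_nonneg hτ.le) qt_le with hkq
    have hces := e.D.cesaro e.hP e.hμ e.ED kq
    have hkq' : ∫ x, (kq : X → ℝ) x ∂π < η / d := hL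
    have hT : Tendsto (fun n : ℕ => cb * (4 * A ^ 2) * ((1 / (n:ℝ)) * ∑ k ∈ Finset.range n, ∫ ω, ev V (ω k) kq ∂Pμ)
        + cb * (v / 2 * A ^ 2) ^ 2 * (1 / (n:ℝ))) atTop
        (𝓝 (cb * (4 * A ^ 2) * (∫ x, (kq : X → ℝ) x ∂π) + cb * (v / 2 * A ^ 2) ^ 2 * 0)) :=
      (hces.const_mul _).add (tendsto_one_div_atTop_nhds_zero_nat.const_mul _)
    have hlt : cb * (4 * A ^ 2) * (∫ x, (kq : X → ℝ) x ∂π) + cb * (v / 2 * A ^ 2) ^ 2 * 0 < η := by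
      rw [mul_zero, add_zero]
      calc _ ≤ cb * (4 * A ^ 2) * (η / d) := mul_le_mul_of_nonneg_left hkq'.le (by positivity)
        _ < d * (η / d) := mul_lt_mul_of_pos_right (by rw [hd]; linarith) (by positivity)
        _ = η := by field_simp
    have hsm2 : Tendsto (fun n : ℕ => A / √(n:ℝ)) atTop (𝓝 0) :=
      tendsto_const_nhds.div_atTop (Real.tendsto_sqrt_atTop.comp tendsto_natCast_atTop_atTop)
    have hev := (hT.eventually_lt_const hlt).and ((hsm2.eventually_le_const hτ).and (eventually_gt_atTop 0))
    rw [eventually_atTop] at hev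
    obtain ⟨N, hN⟩ := hev
    refine ⟨N, fun n hn => ?_⟩
    obtain ⟨hn1, hn2, hn3⟩ := hN n hn
    have hn0 : (0:ℝ) < n := by exact_mod_cast hn3
    rw [dist_zero_right]
    refine lt_of_le_of_lt ?_ hn1
    rw [htel]
    refine (norm_sum_le _ _).trans ?_
    calc _ ≤ ∑ k ∈ Finset.range n, cb * (4 * (A ^ 2 / n) * (∫ ω, ev V (ω k) kq ∂Pμ) + (v / 2 * (A ^ 2 / n)) ^ 2) := by
          refine Finset.sum_le_sum fun k _ => ?_
          rw [norm_mul, Complex.norm_real, Real.norm_eq_abs, abs_of_pos (cc_pos v n _)]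
          refine mul_le_mul (h.cc_le hv n _) ?_ (norm_nonneg _) hcb0.le
          have hs := x0.step e.D e.hP e.hμ (s n) k hv ((h.bd n k).trans hn2)
          refine hs.trans ?_
          have hq := x0.path_KI e.D e.hP e.hμ k (qt ξ τ) (qt_meas x0.meas τ) (qt_nonneg hτ.le) qt_le
          rw [hq]
          have hq0 : 0 ≤ ∫ ω, ev V (ω k) kq ∂Pμ := by
            rw [← hq]; exact integral_nonneg fun ω => qt_nonneg hτ.le _ _
          have := h.sq_le n k
          refine add_le_add (mul_le_mul_of_nonneg_right (by linarith) hq0) ?_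
          gcongr
      _ = _ := by
          rw [← Finset.mul_sum, Finset.sum_add_distrib, ← Finset.mul_sum]
          simp only [Finset.sum_const, Finset.card_range, nsmul_eq_mul]
          field_simp
  have hlim2 : Tendsto (fun n => (cc s v n n : ℂ) * φ n n) atTop (𝓝 1) := by
    have := (hlim1.sub hS0).add_const 1
    simp only [sub_zero, zero_add] at this
    refine this.congr fun n => by ring
  have hcc : Tendsto (fun n => (((cc s v n n)⁻¹ : ℝ) : ℂ)) atTop (𝓝 ((Real.exp (-(v / 2 * Q)) : ℝ) : ℂ)) := by
    refine (Complex.continuous_ofReal.tendsto _).comp ?_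
    have h1 : Tendsto (fun n => Real.exp (-(v / 2 * ∑ j ∈ Finset.range n, s n j ^ 2))) atTop
        (𝓝 (Real.exp (-(v / 2 * Q)))) :=
      (Real.continuous_exp.tendsto _).comp ((h.lim.const_mul _).neg)
    refine h1.congr fun n => ?_
    rw [Real.exp_neg]; rfl
  have := hcc.mul hlim2
  rw [mul_one] at this
  refine this.congr fun n => ?_
  have hne : (cc s v n n : ℂ) ≠ 0 := by exact_mod_cast (cc_pos v n n).ne'
  push_cast
  rw [← mul_assoc, inv_mul_cancel₀ hne, one_mul]

end Xi
end

section

lemma double_sum (c : ℕ → ℝ) (n : ℕ) : ∑ l ∈ Finset.range n, ∑ k ∈ Finset.range l, c k =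
    ∑ k ∈ Finset.range n, ((n - 1 - k : ℕ) : ℝ) * c k := by
  induction n with
  | zero => simp
  | succ n ih =>
    rw [Finset.sum_range_succ, ih, Finset.sum_range_succ, ← Finset.sum_add_distrib]
    simp only [Nat.add_sub_cancel, Nat.sub_self, Nat.cast_zero, zero_mul, add_zero]
    refine Finset.sum_congr rfl fun k hk => ?_
    have := Finset.mem_range.1 hk
    have e : n - k = (n - 1 - k) + 1 := by omega
    rw [e]
    push_cast
    ring

lemma sum_sq_nat (n : ℕ) : ∑ j ∈ Finset.range n, (j:ℝ) ^ 2 = n * (n - 1) * (2 * n - 1) / 6 := by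
  induction n with
  | zero => simp
  | succ n ih => rw [Finset.sum_range_succ, ih]; push_cast; ring

/-- the weights of the integrated martingale -/
def sw (α : ℝ) (n k : ℕ) : ℝ := α * ((n - 1 - k : ℕ) : ℝ) / (n * √(n:ℝ))

lemma sw_wts (α : ℝ) : Wts (sw α) |α| (α ^ 2 / 3) where
  A0 := abs_nonneg _
  bd n k := by
    rcases Nat.eq_zero_or_pos n with rfl | hn
    · simp [sw]
    · have hn0 : (0:ℝ) < n := by exact_mod_cast hn
      have hs : 0 < √(n:ℝ) := Real.sqrt_pos.2 hn0
      unfold sw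
      rw [abs_div, abs_mul, abs_of_pos (mul_pos hn0 hs), Nat.abs_cast,
        div_le_div_iff₀ (mul_pos hn0 hs) hs, mul_assoc]
      refine mul_le_mul_of_nonneg_left (mul_le_mul_of_nonneg_right ?_ hs.le) (abs_nonneg _)
      exact_mod_cast (by omega)
  lip n k := by
    rcases Nat.eq_zero_or_pos n with rfl | hn
    · simp [sw]
    · have hn0 : (0:ℝ) < n := by exact_mod_cast hn
      have hn1 : (1:ℝ) ≤ n := by exact_mod_cast hn
      have hs : 0 < √(n:ℝ) := Real.sqrt_pos.2 hn0
      have hs1 : 1 ≤ √(n:ℝ) := Real.one_le_sqrt.2 hn1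
      have hd : |((n - 1 - (k + 1) : ℕ) : ℝ) - ((n - 1 - k : ℕ) : ℝ)| ≤ 1 := by
        rcases Nat.lt_or_ge k (n - 1) with hk | hk
        · have e : n - 1 - k = (n - 1 - (k + 1)) + 1 := by omega
          rw [e]; push_cast
          rw [abs_le]; constructor <;> linarith
        · have e1 : n - 1 - k = 0 := by omega
          have e2 : n - 1 - (k + 1) = 0 := by omega
          rw [e1, e2]; simp
      have e : sw α n (k + 1) - sw α n k =
          α * (((n - 1 - (k + 1) : ℕ) : ℝ) - ((n - 1 - k : ℕ) : ℝ)) / (n * √(n:ℝ)) := by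
        unfold sw; ring
      rw [e, abs_div, abs_mul, abs_of_pos (mul_pos hn0 hs)]
      refine div_le_div₀ (abs_nonneg _) ?_ hn0 (by nlinarith)
      nlinarith [abs_nonneg α]
  zero n k h := by
    have : n - 1 - k = 0 := by omega
    simp [sw, this]
  lim := by
    have h1 : Tendsto (fun n : ℕ => 1 / (n:ℝ)) atTop (𝓝 0) := tendsto_one_div_atTop_nhds_zero_nat
    have h2 : Tendsto (fun n : ℕ => α ^ 2 * ((1 - 1 / (n:ℝ)) * (2 - 1 / (n:ℝ)) / 6)) atTop
        (𝓝 (α ^ 2 * ((1 - 0) * (2 - 0) / 6))) :=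
      (((h1.const_sub 1).mul (h1.const_sub 2)).div_const 6).const_mul _
    have e0 : α ^ 2 * ((1 - 0) * (2 - 0) / 6) = α ^ 2 / 3 := by ring
    rw [e0] at h2
    refine h2.congr' ?_
    filter_upwards [eventually_gt_atTop 0] with n hn
    have hn0 : (0:ℝ) < n := by exact_mod_cast hn
    have e1 : ∀ k, sw α n k ^ 2 = α ^ 2 / (n:ℝ) ^ 3 * ((n - 1 - k : ℕ) : ℝ) ^ 2 := by
      intro k
      unfold sw
      rw [div_pow, mul_pow, mul_pow, Real.sq_sqrt hn0.le]
      field_simp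
    simp only [e1]
    rw [← Finset.mul_sum, Finset.sum_range_reflect (fun j => (j:ℝ) ^ 2) n, sum_sq_nat]
    field_simp

namespace Xi
open DriftC Wts
variable {X : Type*} [MeasurableSpace X] {P : Kernel X X} {K : Set X} {V : X → ℝ} {l b l' b' : ℝ}
  {μ π : Measure X} {Pμ : Measure (ℕ → X)} [IsMarkovKernel P] [IsProbabilityMeasure μ]
  [IsProbabilityMeasure π] {ξ : X → X → ℝ} {c : ℝ}

/-- The normalized integral -/
def NI (ξ : X → X → ℝ) (f : X → ℝ) (n : ℕ) (ω : ℕ → X) : ℝ :=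
  (1 / (n:ℝ)) * ∑ l ∈ Finset.range n, f (ω l) * M ξ (fun k => if k < n then 1 / √(n:ℝ) else 0) l ω

lemma NI_meas (h : Measurable (Function.uncurry ξ)) {f : X → ℝ} (hf : Measurable f) (n : ℕ) :
    Measurable (NI ξ f n) :=
  (Finset.measurable_fun_sum _ fun k _ => (hf.comp (measurable_pi_apply k)).mul (M_meas h _ k)).const_mul _

lemma NI_const (α : ℝ) (n : ℕ) (ω : ℕ → X) : NI ξ (fun _ => α) n ω = M ξ (sw α n) n ω := by
  unfold NI M
  have h1 : ∀ l ∈ Finset.range n, α * ∑ k ∈ Finset.range l, (if k < n then 1 / √(n:ℝ) else 0) * ξ (ω k) (ω (k + 1))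
      = ∑ k ∈ Finset.range l, α * (1 / √(n:ℝ) * ξ (ω k) (ω (k + 1))) := by
    intro l hl
    rw [Finset.mul_sum]
    refine Finset.sum_congr rfl fun k hk => ?_
    have := Finset.mem_range.1 hl
    have := Finset.mem_range.1 hk
    rw [if_pos (by omega)]
  rw [Finset.sum_congr rfl h1, double_sum, Finset.mul_sum]
  refine Finset.sum_congr rfl fun k _ => ?_
  unfold sw
  ring

lemma NI_sub (f : X → ℝ) (α : ℝ) (n : ℕ) (ω : ℕ → X) :
    NI ξ f n ω - NI ξ (fun _ => α) n ω = NI ξ (fun x => f x - α) n ω := by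
  unfold NI
  rw [← mul_sub, ← Finset.sum_sub_distrib]
  congr 1
  exact Finset.sum_congr rfl fun k _ => by ring

theorem charlim (x0 : Xi P V ξ c) (e : Env P K V l b l' b' μ π Pμ) (f : FW (fun x => √(V x)))
    (hfπ : Integrable (f : X → ℝ) π) {α : ℝ} (hα : α = ∫ x, (f : X → ℝ) x ∂π) :
    Tendsto (fun n : ℕ => ∫ ω, Complex.exp (Complex.I * (NI ξ (f : X → ℝ) n ω : ℝ)) ∂Pμ) atTop
      (𝓝 ((Real.exp (-((∫ x, (x0.G e.D : X → ℝ) x ∂π) / 2 * (α ^ 2 / 3))) : ℝ) : ℂ)) := by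
  have := e.hP.1
  have hfm : Measurable (f : X → ℝ) := f.2.1
  have h1 := x0.clt e (sw_wts α)
  set g : FW (fun x => √(V x)) := f - e.S.cst α with hg
  have hg' : ∀ x, (g : X → ℝ) x = (f : X → ℝ) x - α := fun x => rfl
  have hg0 : ∫ x, (g : X → ℝ) x ∂π = 0 := by
    simp only [hg']
    rw [integral_sub hfπ (integrable_const _), ← hα]
    simp
  have h2 := x0.partA e g hg0
  have hgNI : ∀ n, (fun ω => NI ξ (fun x => (f : X → ℝ) x - α) n ω) = fun ω => (1 / (n:ℝ)) *
      ∑ l ∈ Finset.range n, ev _ (ω l) g * M ξ (fun k => if k < n then 1 / √(n:ℝ) else 0) l ω := fun n => rfl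
  have hIntg : ∀ n, Integrable (fun ω => NI ξ (fun x => (f : X → ℝ) x - α) n ω) Pμ := fun n => by
    rw [hgNI]
    exact (integrable_finsetSum _ fun k _ =>
      (e.memLp g k).integrable_mul (x0.M_memLp e.D e.hP e.hμ _ k)).const_mul _
  have hdiff : Tendsto (fun n : ℕ => ∫ ω, Complex.exp (Complex.I * (NI ξ (f : X → ℝ) n ω : ℝ)) ∂Pμ
      - ∫ ω, EE ξ (sw α n) n ω ∂Pμ) atTop (𝓝 0) := by
    refine squeeze_zero_norm (fun n => ?_) h2
    have iN : Integrable (fun ω => Complex.exp (Complex.I * (NI ξ (f : X → ℝ) n ω : ℝ))) Pμ := by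
      refine (integrable_const (1:ℝ)).mono' ?_ (Eventually.of_forall fun ω => (Complex.norm_exp_I_mul_ofReal _).le)
      have := NI_meas x0.meas hfm n
      exact Measurable.aestronglyMeasurable (by fun_prop)
    rw [← integral_sub iN (EE_int x0.meas _ _)]
    refine norm_integral_le_of_norm_le (hIntg n).abs (Eventually.of_forall fun ω => ?_)
    change _ ≤ |NI ξ (fun x => (f : X → ℝ) x - α) n ω|
    rw [← NI_sub]
    unfold EE
    rw [← NI_const]
    exact exp_lip _ _
  have := hdiff.add h1
  rw [zero_add] at this
  exact this.congr fun n => by ring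

end Xi
end

section

lemma gauss_char {d : ℕ} (t : Fin d → ℝ) :
    ∫ w : Fin d → ℝ, Complex.exp (Complex.I * ((∑ j, t j * w j : ℝ) : ℂ))
      ∂(Measure.pi fun _ : Fin d => gaussianReal 0 1) = ((Real.exp (-(∑ j, t j ^ 2) / 2) : ℝ) : ℂ) := by
  have e1 : ∀ w : Fin d → ℝ, Complex.exp (Complex.I * ((∑ j, t j * w j : ℝ) : ℂ)) =
      ∏ j, Complex.exp ((t j : ℂ) * (w j : ℂ) * Complex.I) := by
    intro w
    rw [← Complex.exp_sum]
    congr 1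
    push_cast
    rw [Finset.mul_sum]
    exact Finset.sum_congr rfl fun j _ => by ring
  simp only [e1]
  rw [integral_fintype_prod_eq_prod (fun j (x : ℝ) => Complex.exp ((t j : ℂ) * (x : ℂ) * Complex.I))]
  have e2 : ∀ j, ∫ x : ℝ, Complex.exp ((t j : ℂ) * (x : ℂ) * Complex.I) ∂(gaussianReal 0 1) =
      Complex.exp (-(t j : ℂ) ^ 2 / 2) := by
    intro j
    rw [← charFun_apply_real, charFun_gaussianReal]
    congr 1
    push_cast
    ring
  simp only [e2]
  rw [← Complex.exp_sum]
  push_cast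
  congr 1
  rw [← Finset.sum_div, Finset.sum_neg_distrib]

lemma levy_pi {Ω : Type*} [MeasurableSpace Ω] {ρ : Measure Ω} [IsProbabilityMeasure ρ] {d : ℕ}
    {Z : ℕ → Ω → Fin d → ℝ} (hZ : ∀ n, Measurable (Z n)) (C : Matrix (Fin d) (Fin d) ℝ)
    (h : ∀ u : Fin d → ℝ, Tendsto (fun n : ℕ => ∫ ω, Complex.exp (Complex.I * ((∑ i, u i * Z n ω i : ℝ) : ℂ)) ∂ρ)
      atTop (𝓝 ((Real.exp (-(∑ i, ∑ j, u i * u j * (C * C.transpose) i j) / 2) : ℝ) : ℂ)))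
    (φ : BoundedContinuousFunction (Fin d → ℝ) ℝ) :
    Tendsto (fun n : ℕ => ∫ ω, φ (Z n ω) ∂ρ) atTop
      (𝓝 (∫ w, φ (C.mulVec w) ∂(Measure.pi fun _ : Fin d => gaussianReal 0 1))) := by
  set γ := Measure.pi fun _ : Fin d => gaussianReal 0 1 with hγ
  have hL : Measurable (WithLp.toLp 2 : (Fin d → ℝ) → EuclideanSpace ℝ (Fin d)) :=
    (PiLp.continuous_toLp 2 _).measurable
  have hCm : Measurable (fun w : Fin d → ℝ => C.mulVec w) := by
    refine measurable_pi_lambda _ fun i => ?_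
    unfold Matrix.mulVec dotProduct
    fun_prop
  have m1 : ∀ n, Measurable (fun ω => (WithLp.toLp 2 (Z n ω) : EuclideanSpace ℝ (Fin d))) :=
    fun n => hL.comp (hZ n)
  have m2 : Measurable (fun w : Fin d → ℝ => (WithLp.toLp 2 (C.mulVec w) : EuclideanSpace ℝ (Fin d))) :=
    hL.comp hCm
  let νn : ℕ → ProbabilityMeasure (EuclideanSpace ℝ (Fin d)) := fun n =>
    ⟨ρ.map (fun ω => WithLp.toLp 2 (Z n ω)), Measure.isProbabilityMeasure_map (m1 n).aemeasurable⟩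
  let ν0 : ProbabilityMeasure (EuclideanSpace ℝ (Fin d)) :=
    ⟨γ.map (fun w => WithLp.toLp 2 (C.mulVec w)), Measure.isProbabilityMeasure_map m2.aemeasurable⟩
  have hinner : ∀ (z u : Fin d → ℝ) , inner ℝ (WithLp.toLp 2 z : EuclideanSpace ℝ (Fin d)) (WithLp.toLp 2 u)
      = ∑ i, u i * z i := by
    intro z u
    simp [PiLp.inner_apply]
  have key : Tendsto νn atTop (𝓝 ν0) := by
    refine ProbabilityMeasure.tendsto_of_tendsto_charFun fun t => ?_
    obtain ⟨u, rfl⟩ : ∃ u : Fin d → ℝ, t = WithLp.toLp 2 u := ⟨WithLp.ofLp t, rfl⟩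
    have c1 : ∀ n, charFun (νn n : Measure (EuclideanSpace ℝ (Fin d))) (WithLp.toLp 2 u) =
        ∫ ω, Complex.exp (Complex.I * ((∑ i, u i * Z n ω i : ℝ) : ℂ)) ∂ρ := by
      intro n
      rw [charFun_apply]
      change ∫ x, _ ∂(ρ.map (fun ω => WithLp.toLp 2 (Z n ω))) = _
      rw [integral_map (m1 n).aemeasurable (Continuous.aestronglyMeasurable (by fun_prop))]
      refine integral_congr_ae (Eventually.of_forall fun ω => ?_)
      simp only [hinner, mul_comm Complex.I]
    have c2 : charFun (ν0 : Measure (EuclideanSpace ℝ (Fin d))) (WithLp.toLp 2 u) =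
        ((Real.exp (-(∑ i, ∑ j, u i * u j * (C * C.transpose) i j) / 2) : ℝ) : ℂ) := by
      rw [charFun_apply]
      change ∫ x, _ ∂(γ.map (fun w => WithLp.toLp 2 (C.mulVec w))) = _
      rw [integral_map m2.aemeasurable (Continuous.aestronglyMeasurable (by fun_prop))]
      have e1 : ∀ w : Fin d → ℝ, ∑ i, u i * C.mulVec w i = ∑ j, (∑ i, u i * C i j) * w j := by
        intro w
        simp only [Matrix.mulVec, dotProduct, Finset.mul_sum, Finset.sum_mul]
        rw [Finset.sum_comm]
        exact Finset.sum_congr rfl fun _ _ => Finset.sum_congr rfl fun _ _ => by ring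
      simp only [hinner, mul_comm _ Complex.I, e1]
      rw [hγ, gauss_char]
      congr 4
      simp only [Matrix.mul_apply, Matrix.transpose_apply, sq, Finset.sum_mul, Finset.mul_sum]
      rw [Finset.sum_comm]
      refine Finset.sum_congr rfl fun i _ => ?_
      rw [Finset.sum_comm]
      exact Finset.sum_congr rfl fun _ _ => Finset.sum_congr rfl fun _ _ => by ring
    rw [c2]
    simp only [c1]
    exact h u
  rw [ProbabilityMeasure.tendsto_iff_forall_integral_tendsto] at key
  have k2 := key (φ.compContinuous ⟨WithLp.ofLp, PiLp.continuous_ofLp 2 _⟩)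
  have i1 : ∀ n, ∫ x, (φ.compContinuous ⟨WithLp.ofLp, PiLp.continuous_ofLp 2 _⟩) x
      ∂(νn n : Measure (EuclideanSpace ℝ (Fin d))) = ∫ ω, φ (Z n ω) ∂ρ := by
    intro n
    change ∫ x, _ ∂(ρ.map (fun ω => WithLp.toLp 2 (Z n ω))) = _
    rw [integral_map (m1 n).aemeasurable (BoundedContinuousFunction.continuous _).aestronglyMeasurable]
    rfl
  have i2 : ∫ x, (φ.compContinuous ⟨WithLp.ofLp, PiLp.continuous_ofLp 2 _⟩) x
      ∂(ν0 : Measure (EuclideanSpace ℝ (Fin d))) = ∫ w, φ (C.mulVec w) ∂γ := by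
    change ∫ x, _ ∂(γ.map (fun w => WithLp.toLp 2 (C.mulVec w))) = _
    rw [integral_map m2.aemeasurable (BoundedContinuousFunction.continuous _).aestronglyMeasurable]
    rfl
  rw [i2] at k2
  simp only [i1] at k2
  exact k2
end

section

lemma tri_sum (F : ℕ → ℕ → ℝ) (n : ℕ) :
    ∑ k ∈ Finset.Icc 1 (n - 1), ∑ l ∈ Finset.Icc k (n - 1), F l k =
      ∑ l ∈ Finset.range n, ∑ k ∈ Finset.range l, F l (k + 1) := by
  rw [Finset.sum_comm' (t' := Finset.range n) (s' := fun l => Finset.Icc 1 l)]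
  · refine Finset.sum_congr rfl fun l _ => ?_
    induction l with
    | zero => simp
    | succ m ih =>
      have : ∀ g : ℕ → ℝ, ∀ m : ℕ, ∑ k ∈ Finset.Icc 1 m, g k = ∑ k ∈ Finset.range m, g (k + 1) := by
        intro g m
        induction m with
        | zero => simp
        | succ m ih => rw [Finset.sum_Icc_succ_top (by omega), ih, Finset.sum_range_succ]
      exact this _ _
  · intro k l
    simp only [Finset.mem_Icc, Finset.mem_range]
    omega

namespace Xi
open DriftC Wts
variable {X : Type*} [MeasurableSpace X] {P : Kernel X X} {K : Set X} {V : X → ℝ} {l b l' b' : ℝ}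
  {μ π : Measure X} {Pμ : Measure (ℕ → X)} [IsMarkovKernel P] [IsProbabilityMeasure μ]
  [IsProbabilityMeasure π] {d : ℕ} {dp : Fin d → X → X → ℝ} {Cc : Fin d → ℝ}

lemma NI_eq (ξ : X → X → ℝ) (f : X → ℝ) (n : ℕ) (ω : ℕ → X) :
    NI ξ f n ω = ∑ l ∈ Finset.range n, ∑ k ∈ Finset.range l,
      (1 / (n:ℝ) * f (ω l) / √(n:ℝ)) * ξ (ω k) (ω (k + 1)) := by
  unfold NI M
  rw [Finset.mul_sum]
  refine Finset.sum_congr rfl fun l hl => ?_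
  rw [← mul_assoc, Finset.mul_sum]
  refine Finset.sum_congr rfl fun k hk => ?_
  have := Finset.mem_range.1 hl
  have := Finset.mem_range.1 hk
  have hkn : k < n := by omega
  simp only [if_pos hkn]
  ring

/-- linear combination -/
def lc (dp : Fin d → X → X → ℝ) (u : Fin d → ℝ) (x y : X) : ℝ := ∑ i, u i * dp i x y

lemma NI_lc (f : X → ℝ) (u : Fin d → ℝ) (n : ℕ) (ω : ℕ → X) :
    ∑ i, u i * ((1 / (n : ℝ)) * (∑ k ∈ Finset.Icc 1 (n - 1),
      ∑ l ∈ Finset.Icc k (n - 1), f (ω l) * dp i (ω (k - 1)) (ω k)) / √(n:ℝ)) = NI (lc dp u) f n ω := by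
  have h1 : ∀ i, ∑ k ∈ Finset.Icc 1 (n - 1),
      ∑ l ∈ Finset.Icc k (n - 1), f (ω l) * dp i (ω (k - 1)) (ω k) =
      ∑ l ∈ Finset.range n, ∑ k ∈ Finset.range l, f (ω l) * dp i (ω k) (ω (k + 1)) := fun i =>
    tri_sum (fun l k => f (ω l) * dp i (ω (k - 1)) (ω k)) n
  simp only [h1]
  rw [NI_eq]
  unfold lc
  simp only [Finset.mul_sum, Finset.sum_div]
  rw [Finset.sum_comm]
  refine Finset.sum_congr rfl fun l _ => ?_
  rw [Finset.sum_comm]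
  exact Finset.sum_congr rfl fun k _ => Finset.sum_congr rfl fun i _ => by ring

lemma memLp_x {ξ : X → X → ℝ} {c : ℝ} (x0 : Xi P V ξ c) (x : X) : MemLp (ξ x) 2 (P x) := by
  rw [memLp_two_iff_integrable_sq (meas_x x0.meas x).aestronglyMeasurable]
  exact x0.integrable_sq_x x

lemma lc_xi (D : DriftC P K V l b) (hx : ∀ i, Xi P V (dp i) (Cc i)) (u : Fin d → ℝ) :
    Xi P V (lc dp u) (∑ i, (d * u i ^ 2) * Cc i) where
  meas := by
    have : Function.uncurry (lc dp u) = fun z => ∑ i, u i * Function.uncurry (dp i) z := rfl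
    rw [this]
    exact Finset.measurable_fun_sum _ fun i _ => (hx i).meas.const_mul _
  c0 := Finset.sum_nonneg fun i _ => mul_nonneg (by positivity) (hx i).c0
  sq x := by
    have hpt : ∀ y, ENNReal.ofReal (lc dp u x y ^ 2) ≤
        ∑ i, ENNReal.ofReal (d * u i ^ 2) * ENNReal.ofReal (dp i x y ^ 2) := by
      intro y
      have h1 : lc dp u x y ^ 2 ≤ ∑ i, (d * u i ^ 2) * dp i x y ^ 2 := by
        have := sq_sum_le_card_mul_sum_sq (s := Finset.univ) (f := fun i => u i * dp i x y)
        rw [Finset.card_univ, Fintype.card_fin] at this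
        refine this.trans (le_of_eq ?_)
        rw [Finset.mul_sum]
        exact Finset.sum_congr rfl fun i _ => by ring
      refine (ENNReal.ofReal_le_ofReal h1).trans (le_of_eq ?_)
      rw [ENNReal.ofReal_sum_of_nonneg fun i _ => by positivity]
      exact Finset.sum_congr rfl fun i _ => ENNReal.ofReal_mul (by positivity)
    refine (lintegral_mono hpt).trans ?_
    rw [lintegral_finsetSum _ fun i _ => (((meas_x (hx i).meas x).pow_const 2).ennreal_ofReal.const_mul _),
      Finset.sum_mul, ENNReal.ofReal_sum_of_nonneg fun i _ =>
        mul_nonneg (mul_nonneg (by positivity) (hx i).c0) (D.Wpos x).le]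
    refine Finset.sum_le_sum fun i _ => ?_
    rw [lintegral_const_mul _ ((meas_x (hx i).meas x).pow_const 2).ennreal_ofReal, mul_assoc,
      ENNReal.ofReal_mul (p := d * u i ^ 2) (q := Cc i * V x) (by positivity)]
    exact mul_le_mul_right ((hx i).sq x) _
  zero x := by
    unfold lc
    rw [integral_finsetSum _ fun i _ => (((hx i).memLp_x x).integrable (by norm_num)).const_mul _]
    refine Finset.sum_eq_zero fun i _ => ?_
    rw [integral_const_mul, (hx i).zero, mul_zero]

lemma lc_G (D : DriftC P K V l b) (hπ : Integrable V π) (hx : ∀ i, Xi P V (dp i) (Cc i)) (u : Fin d → ℝ) :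
    ∫ x, ((lc_xi D hx u).G D : X → ℝ) x ∂π =
      ∑ i, ∑ j, u i * u j * ∫ x, ∫ y, dp i x y * dp j x y ∂(P x) ∂π := by
  have hij : ∀ i j x, Integrable (fun y => dp i x y * dp j x y) (P x) := fun i j x =>
    ((hx i).memLp_x x).integrable_mul ((hx j).memLp_x x)
  have hπij : ∀ i j, Integrable (fun x => ∫ y, dp i x y * dp j x y ∂(P x)) π := by
    intro i j
    refine (hπ.const_mul (Cc i + Cc j)).mono' ?_ (Eventually.of_forall fun x => ?_)
    · exact (StronglyMeasurable.integral_kernel_prod_right'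
        ((hx i).meas.mul (hx j).meas).stronglyMeasurable).aestronglyMeasurable
    · refine (norm_integral_le_of_norm_le (g := fun y => dp i x y ^ 2 + dp j x y ^ 2)
        (((hx i).integrable_sq_x x).add ((hx j).integrable_sq_x x))
        (Eventually.of_forall fun y => ?_)).trans ?_
      · rw [Real.norm_eq_abs, abs_le]
        constructor <;> nlinarith [sq_nonneg (dp i x y + dp j x y), sq_nonneg (dp i x y - dp j x y),
          sq_nonneg (dp i x y), sq_nonneg (dp j x y)]
      · rw [integral_add ((hx i).integrable_sq_x x) ((hx j).integrable_sq_x x), add_mul]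
        exact add_le_add ((hx i).integral_sq_le D x) ((hx j).integral_sq_le D x)
  have h1 : ∀ x, ((lc_xi D hx u).G D : X → ℝ) x = ∑ i, ∑ j, u i * u j * ∫ y, dp i x y * dp j x y ∂(P x) := by
    intro x
    change ∫ y, lc dp u x y ^ 2 ∂(P x) = _
    have e : ∀ y, lc dp u x y ^ 2 = ∑ i, ∑ j, u i * u j * (dp i x y * dp j x y) := by
      intro y
      unfold lc
      rw [_root_.sq, Finset.sum_mul_sum]
      exact Finset.sum_congr rfl fun _ _ => Finset.sum_congr rfl fun _ _ => by ring
    simp only [e]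
    rw [integral_finsetSum _ fun i _ => integrable_finsetSum _ fun j _ => (hij i j x).const_mul _]
    refine Finset.sum_congr rfl fun i _ => ?_
    rw [integral_finsetSum _ fun j _ => (hij i j x).const_mul _]
    exact Finset.sum_congr rfl fun j _ => integral_const_mul _ _
  simp only [h1]
  rw [integral_finsetSum _ fun i _ => integrable_finsetSum _ fun j _ => (hπij i j).const_mul _]
  refine Finset.sum_congr rfl fun i _ => ?_
  rw [integral_finsetSum _ fun j _ => (hπij i j).const_mul _]
  exact Finset.sum_congr rfl fun j _ => integral_const_mul _ _

end Xi

lemma zero_mean {X : Type*} [MeasurableSpace X] {d : ℕ} {θ₀ : Fin d → ℝ} {ε : ℝ} (hε : 0 < ε)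
    {P : (Fin d → ℝ) → Kernel X X}
    (hPmarkov : ∀ θ ∈ Metric.ball θ₀ ε, IsMarkovKernel (P θ)) [IsMarkovKernel (P θ₀)]
    {p : (Fin d → ℝ) → X → X → ℝ}
    (hp_meas : ∀ θ ∈ Metric.ball θ₀ ε, Measurable (Function.uncurry (p θ)))
    (hp_nonneg : ∀ θ ∈ Metric.ball θ₀ ε, ∀ x y, 0 ≤ p θ x y)
    (hp_density : ∀ θ ∈ Metric.ball θ₀ ε, ∀ x,
      (P θ) x = ((P θ₀) x).withDensity fun y => ENNReal.ofReal (p θ x y))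
    {q : X → X → ℝ} {V : X → ℝ} (hV1 : ∀ x, 1 ≤ V x) (i : Fin d)
    (hq : ∀ x, Integrable (q x) (P θ₀ x))
    (hdiff : ∀ δ' : ℝ, 0 < δ' → ∃ η > 0, ∀ h : ℝ, h ≠ 0 → |h| < η →
      ∀ x, ∀ g : X → ℝ, Measurable g → (∀ y, |g y| ≤ V y) →
        |∫ y, g y * ((p (θ₀ + h • (Pi.single i 1 : Fin d → ℝ)) x y - 1) / h - q x y) ∂((P θ₀) x)|
          ≤ δ' * V x) (x : X) : ∫ y, q x y ∂(P θ₀ x) = 0 := by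
  have hVx : 0 < V x := lt_of_lt_of_le one_pos (hV1 x)
  have hb : ∀ δ' : ℝ, 0 < δ' → |∫ y, q x y ∂(P θ₀ x)| ≤ δ' * V x := by
    intro δ' hδ'
    obtain ⟨η, hη, H⟩ := hdiff δ' hδ'
    set h := min η ε / 2 with hh
    have hm : 0 < min η ε := lt_min hη hε
    have h0 : 0 < h := by positivity
    have h1 : h < η := by have := min_le_left η ε; linarith
    have h2 : h < ε := by have := min_le_right η ε; linarith
    set θ := θ₀ + h • (Pi.single i 1 : Fin d → ℝ) with hθ
    have hball : θ ∈ Metric.ball θ₀ ε := by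
      rw [Metric.mem_ball, dist_eq_norm, hθ, add_sub_cancel_left, norm_smul, Pi.norm_single,
        Real.norm_eq_abs, abs_of_pos h0]
      simpa using h2
    have hpm : Measurable (p θ x) := (hp_meas θ hball).comp measurable_prodMk_left
    have hlin : ∫⁻ y, ENNReal.ofReal (p θ x y) ∂(P θ₀ x) = 1 := by
      have := (hPmarkov θ hball).isProbabilityMeasure x
      have h3 : P θ x Set.univ = 1 := measure_univ
      rw [hp_density θ hball x, withDensity_apply _ MeasurableSet.univ, Measure.restrict_univ] at h3
      exact h3
    have hpi : Integrable (p θ x) (P θ₀ x) := by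
      refine ⟨hpm.aestronglyMeasurable, ?_⟩
      rw [hasFiniteIntegral_iff_ofReal (Eventually.of_forall fun y => hp_nonneg θ hball x y), hlin]
      exact ENNReal.one_lt_top
    have hp1 : ∫ y, p θ x y ∂(P θ₀ x) = 1 := by
      rw [integral_eq_lintegral_of_nonneg_ae (Eventually.of_forall fun y => hp_nonneg θ hball x y)
        hpm.aestronglyMeasurable, hlin]
      simp
    have hH := H h h0.ne' (by rwa [abs_of_pos h0]) x (fun _ => 1) measurable_const
      (fun y => by simpa using hV1 y)
    simp only [one_mul] at hH
    have i1 : Integrable (fun y => (p θ x y - 1) / h) (P θ₀ x) := (hpi.sub (integrable_const _)).div_const _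
    rw [integral_sub i1 (hq x), integral_div, integral_sub hpi (integrable_const _), hp1] at hH
    simpa using hH
  by_contra hne
  have hpos : 0 < |∫ y, q x y ∂(P θ₀ x)| := abs_pos.2 hne
  have := hb (|∫ y, q x y ∂(P θ₀ x)| / (2 * V x)) (by positivity)
  have e : |∫ y, q x y ∂(P θ₀ x)| / (2 * V x) * V x = |∫ y, q x y ∂(P θ₀ x)| / 2 := by field_simp
  linarith
end

/-- Proposition 4.1 (marginal at `t = 1`): under Assumption 1, the normalized
discrete stochastic integral `n^{−1/2}·Y_n`, where
`Y_n = (1/n) ∑_{k=1}^{n−1} ∑_{l=k}^{n−1} f(Φ_l)·D_k`, converges in distribution to a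
centered multivariate Gaussian with covariance `(α(θ₀)²/3)·Σ`. -/
theorem integral_estimator_clt {X : Type*} [MeasurableSpace X] (d : ℕ)
    (θ₀ : Fin d → ℝ) (ε : ℝ) (hε : 0 < ε)
    (P : (Fin d → ℝ) → Kernel X X)
    (hPmarkov : ∀ θ ∈ Metric.ball θ₀ ε, IsMarkovKernel (P θ))
    [IsMarkovKernel (P θ₀)]
    -- densities with respect to `P θ₀`
    (p : (Fin d → ℝ) → X → X → ℝ)
    (hp_meas : ∀ θ ∈ Metric.ball θ₀ ε, Measurable (Function.uncurry (p θ)))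
    (hp_nonneg : ∀ θ ∈ Metric.ball θ₀ ε, ∀ x y, 0 ≤ p θ x y)
    (hp_density : ∀ θ ∈ Metric.ball θ₀ ε, ∀ x,
      (P θ) x = ((P θ₀) x).withDensity fun y => ENNReal.ofReal (p θ x y))
    (hp_one : ∀ x y, p θ₀ x y = 1)
    -- differentiability of the densities at `θ₀` with partial derivatives `dp i`
    (dp : Fin d → X → X → ℝ)
    (hdp_meas : ∀ i, Measurable (Function.uncurry (dp i)))
    (hdp : ∀ x y, HasFDerivAt (fun θ => p θ x y)
      (∑ i : Fin d, dp i x y • (ContinuousLinearMap.proj i : (Fin d → ℝ) →L[ℝ] ℝ)) θ₀)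
    -- (i) ψ-irreducibility
    (ψ : Measure X) [SigmaFinite ψ] (hψ : ψ ≠ 0)
    (hirr : ∀ θ ∈ Metric.ball θ₀ ε, ∀ A : Set X, MeasurableSet A → 0 < ψ A →
      ∀ x, ∃ n : ℕ, 0 < (kpow (P θ) n) x A)
    -- (ii) minorization on the small set `K`
    (K : Set X) (hK : MeasurableSet K) (δ : ℝ) (hδ : 0 < δ) (m : ℕ)
    (ν : Measure X) [IsProbabilityMeasure ν]
    (hminor : ∀ θ ∈ Metric.ball θ₀ ε, ∀ x ∈ K, ∀ A : Set X, MeasurableSet A →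
      ENNReal.ofReal δ * ν A ≤ (kpow (P θ) m) x A)
    -- (iii) drift condition
    (V : X → ℝ) (hVmeas : Measurable V) (hV1 : ∀ x, 1 ≤ V x)
    (l b : ℝ) (hl0 : 0 < l) (hl1 : l < 1) (hb : 0 ≤ b)
    (hdrift : ∀ θ ∈ Metric.ball θ₀ ε, ∀ x,
      ∫⁻ y, ENNReal.ofReal (V y) ∂((P θ) x)
        ≤ ENNReal.ofReal (l * V x + b * K.indicator (fun _ => 1) x))
    -- (iv) finiteness of `|||P^{(i)}(θ₀)|||_V` and differentiability in `V`-operator norm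
    (hPi_bdd : ∀ i : Fin d, ∃ C : ℝ, ∀ x, ∀ g : X → ℝ, Measurable g → (∀ y, |g y| ≤ V y) →
      |∫ y, g y * dp i x y ∂((P θ₀) x)| ≤ C * V x)
    (hPi_diff : ∀ i : Fin d, ∀ δ' : ℝ, 0 < δ' → ∃ η > 0, ∀ h : ℝ, h ≠ 0 → |h| < η →
      ∀ x, ∀ g : X → ℝ, Measurable g → (∀ y, |g y| ≤ V y) →
        |∫ y, g y * ((p (θ₀ + h • (Pi.single i 1 : Fin d → ℝ)) x y - 1) / h - dp i x y) ∂((P θ₀) x)|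
          ≤ δ' * V x)
    -- (v) `sup_x g_{ii}(x)/V(x) < ∞`
    (hgV : ∀ i : Fin d, ∃ C : ℝ, ∀ x,
      ∫⁻ y, ENNReal.ofReal ((dp i x y) ^ 2) ∂((P θ₀) x) ≤ ENNReal.ofReal (C * V x))
    -- (vi) `sup_x |f(x)|/√V(x) < ∞`
    (f : X → ℝ) (hf_meas : Measurable f)
    (hf_bdd : ∃ κ : ℝ, ∀ x, |f x| ≤ κ * Real.sqrt (V x))
    -- invariant probability measure with `πV < ∞`
    (π : Measure X) [IsProbabilityMeasure π]
    (hπ_inv : π.bind (fun x => (P θ₀) x) = π)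
    (hπV : ∫⁻ x, ENNReal.ofReal (V x) ∂π < ⊤)
    (α : ℝ) (hα : α = ∫ x, f x ∂π)
    (Sig : Matrix (Fin d) (Fin d) ℝ)
    (hSig : ∀ i j, Sig i j = ∫ x, ∫ y, dp i x y * dp j x y ∂((P θ₀) x) ∂π)
    -- the chain with initial distribution `μ`
    (μ : Measure X) [IsProbabilityMeasure μ]
    (hμV : ∫⁻ x, ENNReal.ofReal (V x) ∂μ < ⊤)
    (Pμ : Measure (ℕ → X)) (hPμ : IsMarkovChainLaw μ (P θ₀) Pμ)
    (Y : ℕ → (ℕ → X) → Fin d → ℝ)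
    (hY : ∀ n ω i, Y n ω i = (1 / (n : ℝ)) * ∑ k ∈ Finset.Icc 1 (n - 1),
      ∑ l ∈ Finset.Icc k (n - 1), f (ω l) * dp i (ω (k - 1)) (ω k)) :
    ∀ C : Matrix (Fin d) (Fin d) ℝ, C * C.transpose = (α ^ 2 / 3) • Sig →
      ∀ φ : BoundedContinuousFunction (Fin d → ℝ) ℝ,
        Tendsto (fun n : ℕ => ∫ ω, φ (fun i => Y n ω i / Real.sqrt n) ∂Pμ)
          atTop
          (nhds (∫ w, φ (C.mulVec w) ∂(Measure.pi fun _ : Fin d => gaussianReal 0 1))) := by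
  intro C hC φ
  have hθ : θ₀ ∈ Metric.ball θ₀ ε := Metric.mem_ball_self hε
  have D : DriftC (P θ₀) K V l b := ⟨hVmeas, hV1, hK, hl0.le, hl1, hb, hdrift θ₀ hθ⟩
  have intV : ∀ ρ : Measure X, ∫⁻ x, ENNReal.ofReal (V x) ∂ρ < ⊤ → Integrable V ρ := fun ρ h =>
    ⟨hVmeas.aestronglyMeasurable,
      (hasFiniteIntegral_iff_ofReal (Eventually.of_forall fun x => (D.Wpos x).le)).2 h⟩
  have iπ := intV π hπV
  have iμ := intV μ hμV
  have e : Env (P θ₀) K V l b (√l) (√b) μ π Pμ :=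
    { D := D
      S := D.sqrt_drift hl0
      hP := hPμ
      hμ := iμ
      hπ := iπ
      ED := D.ergodic hδ m ν (hminor θ₀ hθ) hπ_inv iπ
      ES := (D.sqrt_drift hl0).ergodic hδ m ν (hminor θ₀ hθ) hπ_inv (D.sqrt_integrable iπ) }
  have hprob := hPμ.1
  choose Cc hCc using hgV
  have hCc' : ∀ i x, ∫⁻ y, ENNReal.ofReal ((dp i x y) ^ 2) ∂((P θ₀) x) ≤ ENNReal.ofReal (|Cc i| * V x) :=
    fun i x => (hCc i x).trans (ENNReal.ofReal_le_ofReal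
      (mul_le_mul_of_nonneg_right (le_abs_self _) (D.Wpos x).le))
  have hIntg : ∀ i x, Integrable (dp i x) (P θ₀ x) := by
    intro i x
    have hm : Measurable (dp i x) := Xi.meas_x (hdp_meas i) x
    have h2 : MemLp (dp i x) 2 (P θ₀ x) := by
      rw [memLp_two_iff_integrable_sq hm.aestronglyMeasurable]
      refine ⟨(hm.pow_const 2).aestronglyMeasurable, ?_⟩
      rw [hasFiniteIntegral_iff_ofReal (Eventually.of_forall fun y => sq_nonneg _)]
      exact (hCc i x).trans_lt ENNReal.ofReal_lt_top
    exact h2.integrable (by norm_num)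
  have hx : ∀ i, Xi (P θ₀) V (dp i) |Cc i| := fun i =>
    ⟨hdp_meas i, abs_nonneg _, hCc' i, zero_mean hε hPmarkov hp_meas hp_nonneg hp_density hV1 i
      (hIntg i) (hPi_diff i)⟩
  obtain ⟨κ, hκ⟩ := hf_bdd
  let fF : FW (fun x => √(V x)) := ⟨f, hf_meas, κ, hκ⟩
  have hfF : (fF : X → ℝ) = f := rfl
  have hfπ : Integrable (fF : X → ℝ) π := DriftC.integrable_of_FW (D.sqrt_integrable iπ) fF
  have hZ : ∀ n, Measurable (fun ω : ℕ → X => fun i => Y n ω i / Real.sqrt n) := by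
    intro n
    refine measurable_pi_lambda _ fun i => ?_
    simp only [hY]
    refine Measurable.div_const (Measurable.const_mul ?_ _) _
    refine Finset.measurable_fun_sum _ fun k _ => Finset.measurable_fun_sum _ fun j _ => ?_
    refine (hf_meas.comp (measurable_pi_apply j)).mul ?_
    exact Measurable.comp (f := fun ω : ℕ → X => (ω (k - 1), ω k)) (hdp_meas i)
      ((measurable_pi_apply (k - 1)).prodMk (measurable_pi_apply k))
  refine levy_pi hZ C (fun u => ?_) φ
  have key := (Xi.lc_xi D hx u).charlim e fF hfπ hα
  have hG := Xi.lc_G D iπ hx u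
  rw [hG, hfF] at key
  have hR : -(∑ i, ∑ j, u i * u j * (C * C.transpose) i j) / 2 =
      -((∑ i, ∑ j, u i * u j * ∫ x, ∫ y, dp i x y * dp j x y ∂(P θ₀ x) ∂π) / 2 * (α ^ 2 / 3)) := by
    rw [hC]
    simp only [Matrix.smul_apply, smul_eq_mul, hSig]
    rw [neg_div, neg_inj, div_mul_eq_mul_div]
    congr 1
    rw [Finset.sum_mul]
    refine Finset.sum_congr rfl fun i _ => ?_
    rw [Finset.sum_mul]
    exact Finset.sum_congr rfl fun j _ => by ring
  rw [hR]
  refine key.congr fun n => ?_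
  refine integral_congr_ae (Eventually.of_forall fun ω => ?_)
  simp only [hY]
  rw [← Xi.NI_lc]

end
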